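/- For every fixed n ∈ ℕ there exist effectively computable constants α_{2n-1,n} ≠ 0, …, α_{1,n}, α_{0,n} such that for X → ∞, Σ_{ρ^{(1)},…,ρ^{(n)}} exp(−|ρ^{(1)}⋯ρ^{(n)}|/X) = X(α_{2n-1,n} log^{2n-1} X + ⋯ + α_{1,n} log X + α_{0,n}) + R^n(0) + O_ε(X^{ε−1}) for every ε > 0, where ρ^{(1)},…,ρ^{(n)} run independently over all nontrivial zeros of ζ(s). -/

import Mathlib

open Complex Real MeasureTheory Set Filter

noncomputable section

/-- The multiplicity of `ρ` as a zero of the Riemann zeta function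
(the order of vanishing, i.e. the least `n` with `ζ⁽ⁿ⁾(ρ) ≠ 0`). -/
def zetaMult (ρ : ℂ) : ℕ := sInf {n : ℕ | iteratedDeriv n riemannZeta ρ ≠ 0}

/-- `ρ` is a nontrivial zero of the Riemann zeta function. -/
def IsNontrivialZero (ρ : ℂ) : Prop := riemannZeta ρ = 0 ∧ 0 < ρ.re ∧ ρ.re < 1

/-- The function `(-log t)^j` on `(0, 1]`, extended by zero. -/
def negLogPow (j : ℕ) : ℝ → ℂ := indicator (Ioc 0 1) fun t : ℝ => (-(Real.log t : ℂ)) ^ j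

lemma negLogPow_succ (j : ℕ) :
    negLogPow (j + 1) = fun t : ℝ => -(Real.log t • negLogPow j t) := by
  funext t
  by_cases ht : t ∈ Ioc (0 : ℝ) 1
  · simp only [negLogPow, indicator_of_mem ht, pow_succ, real_smul]
    ring
  · simp [negLogPow, indicator_of_notMem ht]

lemma negLogPow_isBigO_zero (j : ℕ) {b : ℝ} (hb : 0 < b) :
    negLogPow j =O[nhdsWithin 0 (Ioi 0)] fun t : ℝ => t ^ (-b) := by
  induction j generalizing b with
  | zero =>
    refine Asymptotics.IsBigO.of_bound 1 ?_
    have : ∀ᶠ t : ℝ in nhdsWithin 0 (Ioi 0), t ∈ Ioc (0 : ℝ) 1 :=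
      Ioc_mem_nhdsGT one_pos
    filter_upwards [this] with t ht
    have : 1 ≤ t ^ (-b) := Real.one_le_rpow_of_pos_of_le_one_of_nonpos ht.1 ht.2 (by linarith)
    simp only [negLogPow, indicator_of_mem ht, pow_zero, norm_one, one_mul]
    exact this.trans (le_abs_self _)
  | succ j ih =>
    rw [negLogPow_succ]
    exact (isBigO_rpow_zero_log_smul (half_lt_self hb) (ih (half_pos hb))).neg_left

lemma negLogPow_eq_zero {j : ℕ} {t : ℝ} (ht : 1 < t) : negLogPow j t = 0 :=
  indicator_of_notMem (fun h => absurd h.2 (not_le.2 ht)) _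

lemma negLogPow_isBigO_atTop (j : ℕ) (a : ℝ) :
    negLogPow j =O[atTop] fun t : ℝ => t ^ (-a) := by
  refine Asymptotics.IsBigO.of_bound 1 ?_
  filter_upwards [eventually_gt_atTop 1] with t ht
  rw [negLogPow_eq_zero ht, norm_zero, one_mul]
  exact norm_nonneg _

lemma locallyIntegrableOn_negLogPow (j : ℕ) : LocallyIntegrableOn (negLogPow j) (Ioi 0) := by
  have h : ContinuousOn (fun t : ℝ => (-(Real.log t : ℂ)) ^ j) (Ioi 0) := by
    refine ContinuousOn.pow (ContinuousOn.neg ?_) j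
    exact continuous_ofReal.comp_continuousOn
      (Real.continuousOn_log.mono fun t ht => ne_of_gt ht)
  intro t ht
  obtain ⟨u, hu, hi⟩ := (h.locallyIntegrableOn (μ := volume) measurableSet_Ioi) t ht
  exact ⟨u, hu, hi.indicator measurableSet_Ioc⟩

lemma hasMellin_negLogPow (j : ℕ) {s : ℂ} (hs : 0 < s.re) :
    HasMellin (negLogPow j) s ((j.factorial : ℂ) / s ^ (j + 1)) := by
  induction j generalizing s with
  | zero =>
    have := hasMellin_one_Ioc hs
    simpa [negLogPow] using this
  | succ j ih =>
    have key := mellin_hasDerivAt_of_isBigO_rpow (a := s.re + 1) (s := s)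
      (locallyIntegrableOn_negLogPow j)
      (negLogPow_isBigO_atTop j _) (by linarith) (negLogPow_isBigO_zero j (half_pos hs))
      (half_lt_self hs)
    have hs0 : s ≠ 0 := by rintro rfl; simp at hs
    have hev : mellin (negLogPow j) =ᶠ[nhds s] fun z => (j.factorial : ℂ) / z ^ (j + 1) := by
      filter_upwards [(isOpen_lt continuous_const continuous_re).mem_nhds hs] with z hz
      exact (ih hz).2
    have hd : HasDerivAt (fun z : ℂ => (j.factorial : ℂ) / z ^ (j + 1))
        (-((j + 1).factorial : ℂ) / s ^ (j + 2)) s := by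
      have := ((hasDerivAt_const s (j.factorial : ℂ)).div (hasDerivAt_pow (j + 1) s)
        (pow_ne_zero _ hs0))
      refine this.congr_deriv ?_
      rw [Nat.factorial_succ]
      push_cast
      field_simp
      simp
      ring
    have heq := (key.2.congr_of_eventuallyEq hev.symm).unique hd
    rw [negLogPow_succ]
    refine ⟨?_, ?_⟩
    · have := key.1.neg
      refine this.congr (ae_of_all _ fun t => ?_)
      simp
    · have : mellin (fun t : ℝ => -(Real.log t • negLogPow j t)) s
          = -mellin (fun t : ℝ => Real.log t • negLogPow j t) s := by
        simp only [mellin, smul_neg, integral_neg]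
      rw [this, heq]
      ring

lemma norm_Gamma_le_re {z : ℂ} (hz : 0 < z.re) : ‖Complex.Gamma z‖ ≤ Real.Gamma z.re := by
  rw [Complex.Gamma_eq_integral hz, Real.Gamma_eq_integral hz, Complex.GammaIntegral]
  refine (norm_integral_le_integral_norm _).trans (le_of_eq ?_)
  refine setIntegral_congr_fun measurableSet_Ioi fun x hx => ?_
  simp only [norm_mul, Complex.norm_real, Real.norm_eq_abs, abs_of_pos (Real.exp_pos _)]
  rw [norm_cpow_eq_rpow_re_of_pos hx]
  simp

lemma exists_norm_Gamma_mul_pow_le (N : ℕ) {a b : ℝ} (ha : 0 < a) :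
    ∃ C : ℝ, ∀ z : ℂ, a ≤ z.re → z.re ≤ b → ‖Complex.Gamma z‖ * ‖z‖ ^ N ≤ C := by
  induction N generalizing a b with
  | zero =>
    have hc : ContinuousOn Real.Gamma (Icc a b) := fun x hx =>
      (Real.differentiableAt_Gamma fun m => by
        have : 0 < x := ha.trans_le hx.1
        have := Nat.cast_nonneg (α := ℝ) m
        linarith).continuousAt.continuousWithinAt
    obtain ⟨C, hC⟩ := isCompact_Icc.exists_bound_of_continuousOn hc
    refine ⟨C, fun z h1 h2 => ?_⟩
    rw [pow_zero, mul_one]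
    exact (norm_Gamma_le_re (ha.trans_le h1)).trans ((le_abs_self _).trans (hC _ ⟨h1, h2⟩))
  | succ N ih =>
    obtain ⟨C, hC⟩ := ih (a := a + 1) (b := b + 1) (by linarith)
    refine ⟨C, fun z h1 h2 => ?_⟩
    have hz : z ≠ 0 := by rintro rfl; simp at h1; linarith
    have hle : ‖z‖ ≤ ‖z + 1‖ := by
      rw [← sq_le_sq₀ (norm_nonneg _) (norm_nonneg _), ← normSq_eq_norm_sq, ← normSq_eq_norm_sq,
        normSq_apply, normSq_apply]
      simp only [add_re, one_re, add_im, one_im]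
      nlinarith
    calc ‖Complex.Gamma z‖ * ‖z‖ ^ (N + 1) = ‖Complex.Gamma (z + 1)‖ * ‖z‖ ^ N := by
          rw [Complex.Gamma_add_one _ hz, norm_mul]; ring
      _ ≤ ‖Complex.Gamma (z + 1)‖ * ‖z + 1‖ ^ N := by gcongr
      _ ≤ C := hC _ (by simpa using h1) (by simpa using h2)

/-- A function on a strip dominated by `(1 + t²)⁻¹` is integrable along vertical lines. -/
lemma verticalIntegrable_of_bound {h : ℂ → ℂ} {σ C : ℝ}
    (hc : Continuous fun t : ℝ => h (σ + t * I))
    (hb : ∀ t : ℝ, ‖h (σ + t * I)‖ ≤ C * (1 + t ^ 2)⁻¹) : VerticalIntegrable h σ :=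
  (integrable_inv_one_add_sq.const_mul C).mono' hc.aestronglyMeasurable (ae_of_all _ hb)

lemma continuous_vertical_of_differentiableAt {h : ℂ → ℂ} {σ : ℝ}
    (hd : ∀ s : ℂ, s.re = σ → DifferentiableAt ℂ h s) :
    Continuous fun t : ℝ => h (σ + t * I) := by
  refine continuous_iff_continuousAt.2 fun t => ?_
  exact ContinuousAt.comp' (hd _ (by simp)).continuousAt (by fun_prop)

lemma verticalIntegrable_Gamma {σ : ℝ} (hσ : 0 < σ) : VerticalIntegrable Complex.Gamma σ := by
  obtain ⟨C₀, h₀⟩ := exists_norm_Gamma_mul_pow_le 0 (b := σ) hσ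
  obtain ⟨C₂, h₂⟩ := exists_norm_Gamma_mul_pow_le 2 (b := σ) hσ
  refine verticalIntegrable_of_bound (C := C₀ + C₂) ?_ fun t => ?_
  · refine continuous_vertical_of_differentiableAt fun s hs => ?_
    refine Complex.differentiableAt_Gamma s fun m hm => ?_
    have := Nat.cast_nonneg (α := ℝ) m
    rw [hm] at hs
    simp at hs
    linarith
  · have e0 := h₀ (σ + t * I) (by simp) (by simp)
    have e2 := h₂ (σ + t * I) (by simp) (by simp)
    have hn : t ^ 2 ≤ ‖(σ + t * I : ℂ)‖ ^ 2 := by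
      rw [← normSq_eq_norm_sq, normSq_add_mul_I]
      nlinarith
    rw [← div_eq_mul_inv, le_div_iff₀ (by positivity)]
    have := mul_le_mul_of_nonneg_left hn (norm_nonneg (Complex.Gamma (σ + t * I)))
    simp only [pow_zero, mul_one] at e0
    linarith

lemma mellinInv_Gamma {σ x : ℝ} (hσ : 0 < σ) (hx : 0 < x) :
    mellinInv σ Complex.Gamma x = (Real.exp (-x) : ℂ) := by
  have hm : ∀ s : ℂ, 0 < s.re → mellin (fun x : ℝ => (Real.exp (-x) : ℂ)) s = Complex.Gamma s := by
    intro s hs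
    rw [Complex.Gamma_eq_integral hs, Complex.GammaIntegral_eq_mellin]
  have := mellinInv_mellin_eq σ (fun x : ℝ => (Real.exp (-x) : ℂ)) hx ?_ ?_ ?_
  · rw [← this]
    simp only [mellinInv]
    congr 2 with t
    rw [hm _ (by simpa using hσ)]
  · have := Complex.GammaIntegral_convergent (s := σ) (by simpa using hσ)
    refine this.congr (ae_of_all _ fun t => ?_)
    simp [mul_comm]
  · refine (verticalIntegrable_Gamma hσ).congr (ae_of_all _ fun t => ?_)
    exact (hm _ (by simpa using hσ)).symm
  · fun_prop

/-- Shifting the line of integration of an inverse Mellin transform. -/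
lemma mellinInv_eq_mellinInv_of_bound {h : ℂ → ℂ} {a b C x : ℝ} (hab : a ≤ b) (hx : 0 < x)
    (hd : ∀ s : ℂ, a ≤ s.re → s.re ≤ b → DifferentiableAt ℂ h s)
    (hb : ∀ s : ℂ, a ≤ s.re → s.re ≤ b → ‖h s‖ ≤ C * (1 + s.im ^ 2)⁻¹) :
    mellinInv a h x = mellinInv b h x := by
  have hx0 : (x : ℂ) ≠ 0 := ofReal_ne_zero.2 hx.ne'
  set k : ℂ → ℂ := fun s => (x : ℂ) ^ (-s) * h s with hk
  have hkd : ∀ s : ℂ, a ≤ s.re → s.re ≤ b → DifferentiableAt ℂ k s := fun s h1 h2 =>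
    (DifferentiableAt.const_cpow differentiableAt_id.neg (Or.inl hx0)).mul (hd s h1 h2)
  set M : ℝ := max (x ^ (-a)) (x ^ (-b)) with hM
  have hM0 : 0 ≤ M := le_max_of_le_left (Real.rpow_nonneg hx.le _)
  have hkb : ∀ s : ℂ, a ≤ s.re → s.re ≤ b → ‖k s‖ ≤ M * C * (1 + s.im ^ 2)⁻¹ := by
    intro s h1 h2
    rw [hk]
    simp only [norm_mul]
    rw [norm_cpow_eq_rpow_re_of_pos hx, neg_re, mul_assoc]
    refine mul_le_mul ?_ (hb s h1 h2) (norm_nonneg _) hM0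
    rcases le_total x 1 with hx1 | hx1
    · exact (Real.rpow_le_rpow_of_exponent_ge hx hx1 (by linarith)).trans (le_max_right _ _)
    · exact (Real.rpow_le_rpow_of_exponent_le hx1 (by linarith)).trans (le_max_left _ _)
  have hIntegrable : ∀ σ : ℝ, a ≤ σ → σ ≤ b → Integrable fun t : ℝ => k (σ + t * I) := by
    intro σ h1 h2
    refine verticalIntegrable_of_bound (C := M * C)
      (continuous_vertical_of_differentiableAt fun s hs => hkd s (hs ▸ h1) (hs ▸ h2)) fun t => ?_
    simpa using hkb (σ + t * I) (by simpa using h1) (by simpa using h2)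
  have hhor : ∀ c : ℝ, c = 1 ∨ c = -1 →
      Tendsto (fun T : ℝ => ∫ y in a..b, k (y + (c * T : ℝ) * I)) atTop (nhds 0) := by
    intro c hc
    have hc2 : c ^ 2 = 1 := by rcases hc with rfl | rfl <;> norm_num
    refine squeeze_zero_norm (a := fun T : ℝ => M * C * (1 + T ^ 2)⁻¹ * |b - a|) (fun T => ?_) ?_
    · refine intervalIntegral.norm_integral_le_of_norm_le_const fun y hy => ?_
      rw [uIoc_of_le hab] at hy
      refine (hkb _ (by simpa using hy.1.le) (by simpa using hy.2)).trans (le_of_eq ?_)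
      have : ((y : ℂ) + ((c * T : ℝ) : ℂ) * I).im = c * T := by simp
      rw [this, mul_pow, hc2, one_mul]
    · have : Tendsto (fun T : ℝ => (1 + T ^ 2)⁻¹) atTop (nhds 0) :=
        (tendsto_atTop_add_const_left _ _ (tendsto_pow_atTop two_ne_zero)).inv_tendsto_atTop
      simpa using (this.const_mul (M * C)).mul_const |b - a|
  have hver : ∀ σ : ℝ, a ≤ σ → σ ≤ b → Tendsto (fun T : ℝ => ∫ y in (-T)..T, k (σ + y * I)) atTop
      (nhds (∫ y : ℝ, k (σ + y * I))) := fun σ h1 h2 =>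
    intervalIntegral_tendsto_integral (hIntegrable σ h1 h2) tendsto_neg_atTop_atBot tendsto_id
  have hrect : ∀ T : ℝ, (∫ y in a..b, k (y + ((-1) * T : ℝ) * I))
      - (∫ y in a..b, k (y + (1 * T : ℝ) * I)) + I * (∫ y in (-T)..T, k (b + y * I))
      - I * (∫ y in (-T)..T, k (a + y * I)) = 0 := by
    intro T
    have := Complex.integral_boundary_rect_eq_zero_of_differentiableOn k (a + (-T : ℝ) * I)
      (b + (T : ℝ) * I) ?_
    · simpa using this
    · intro s hs
      rw [mem_reProdIm] at hs
      simp only [add_re, ofReal_re, mul_re, I_re, mul_zero, ofReal_im, I_im, mul_one, sub_self,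
        add_zero, uIcc_of_le hab] at hs
      exact (hkd s hs.1.1 hs.1.2).differentiableWithinAt
  have hlim := (((hhor (-1) (Or.inr rfl)).sub (hhor 1 (Or.inl rfl))).add
    ((hver b hab le_rfl).const_mul I)).sub ((hver a le_rfl hab).const_mul I)
  have h0 := tendsto_nhds_unique (hlim.congr hrect) tendsto_const_nhds
  have : (∫ y : ℝ, k (a + y * I)) = ∫ y : ℝ, k (b + y * I) := by
    have h1 : I * ((∫ y : ℝ, k (b + y * I)) - ∫ y : ℝ, k (a + y * I)) = 0 := by
      linear_combination h0
    rcases mul_eq_zero.1 h1 with h2 | h2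
    · exact absurd h2 I_ne_zero
    · exact (sub_eq_zero.1 h2).symm
  simp only [mellinInv, smul_eq_mul]
  congr 1

lemma norm_mellinInv_le {h : ℂ → ℂ} {a C x : ℝ} (hx : 0 < x)
    (hb : ∀ t : ℝ, ‖h (a + t * I)‖ ≤ C * (1 + t ^ 2)⁻¹) :
    ‖mellinInv a h x‖ ≤ C / 2 * x ^ (-a) := by
  rw [mellinInv, norm_smul]
  have h1 : ‖∫ y : ℝ, (x : ℂ) ^ (-(a + y * I)) • h (a + y * I)‖
      ≤ ∫ y : ℝ, x ^ (-a) * (C * (1 + y ^ 2)⁻¹) := by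
    refine norm_integral_le_of_norm_le ((integrable_inv_one_add_sq.const_mul C).const_mul _)
      (ae_of_all _ fun y => ?_)
    rw [norm_smul, norm_cpow_eq_rpow_re_of_pos hx]
    have : (-((a : ℂ) + y * I)).re = -a := by simp
    rw [this]
    exact mul_le_mul_of_nonneg_left (hb y) (Real.rpow_nonneg hx.le _)
  rw [integral_const_mul, integral_const_mul, integral_univ_inv_one_add_sq] at h1
  have h2 : ‖(1 / (2 * π) : ℝ)‖ = 1 / (2 * π) := by
    rw [Real.norm_eq_abs, abs_of_pos (by positivity)]
  rw [h2]
  refine (mul_le_mul_of_nonneg_left h1 (by positivity)).trans (le_of_eq ?_)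
  field_simp

lemma hasSum_pi_fin_prod {ι : Type*} {f : ι → ℂ} (hf : Summable fun i => ‖f i‖) (n : ℕ) :
    (Summable fun v : Fin n → ι => ‖∏ k, f (v k)‖) ∧
      HasSum (fun v : Fin n → ι => ∏ k, f (v k)) ((∑' i, f i) ^ n) := by
  induction n with
  | zero =>
    refine ⟨(hasSum_fintype _).summable, ?_⟩
    simp
  | succ n ih =>
    let e : (Fin (n + 1) → ι) ≃ ι × (Fin n → ι) := (Fin.consEquiv fun _ => ι).symm
    have he : ∀ v : Fin (n + 1) → ι, ∏ k, f (v k) = f (e v).1 * ∏ k, f ((e v).2 k) := by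
      intro v
      rw [Fin.prod_univ_succ]
      rfl
    have hn := summable_mul_of_summable_norm hf ih.1
    have hs : Summable fun p : ι × (Fin n → ι) => ‖f p.1 * ∏ k, f (p.2 k)‖ := by
      have := hf.mul_of_nonneg ih.1 (fun i => norm_nonneg _) (fun v => norm_nonneg _)
      exact this.congr fun p => (norm_mul _ _).symm
    refine ⟨?_, ?_⟩
    · simp only [he]
      exact (e.summable_iff (f := fun p : ι × (Fin n → ι) => ‖f p.1 * ∏ k, f (p.2 k)‖)).2 hs
    · simp only [he]
      refine (e.hasSum_iff (f := fun p : ι × (Fin n → ι) => f p.1 * ∏ k, f (p.2 k))).2 ?_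
      have := hn.hasSum
      rwa [← tsum_mul_tsum_of_summable_norm hf ih.1, ih.2.tsum_eq, ← pow_succ'] at this

lemma Complex.VerticalIntegrable.integrable_cpow_smul {h : ℂ → ℂ} {σ x : ℝ} (hx : 0 < x)
    (hh : VerticalIntegrable h σ) :
    Integrable fun y : ℝ => (x : ℂ) ^ (-(σ + y * I)) • h (σ + y * I) := by
  refine Integrable.bdd_mul (c := x ^ (-σ)) hh ?_ (ae_of_all _ fun y => ?_)
  · refine Continuous.aestronglyMeasurable ?_
    exact Continuous.const_cpow (by fun_prop) (Or.inl (ofReal_ne_zero.2 hx.ne'))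
  · rw [norm_cpow_eq_rpow_re_of_pos hx]
    simp

lemma mellinInv_add {f g : ℂ → ℂ} {σ x : ℝ} (hx : 0 < x)
    (hf : VerticalIntegrable f σ) (hg : VerticalIntegrable g σ) :
    mellinInv σ (fun s => f s + g s) x = mellinInv σ f x + mellinInv σ g x := by
  simp only [mellinInv, smul_add]
  rw [integral_add (hf.integrable_cpow_smul hx) (hg.integrable_cpow_smul hx), smul_add]

lemma mellinInv_congr {f g : ℂ → ℂ} {σ x : ℝ} (h : ∀ s : ℂ, s.re = σ → f s = g s) :
    mellinInv σ f x = mellinInv σ g x := by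
  simp only [mellinInv]
  congr 2 with t
  rw [h _ (by simp)]

/-- Termwise Mellin inversion of a generalized Dirichlet series. -/
lemma hasSum_mul_exp_eq_mellinInv {ι : Type*} [Countable ι] {c p : ι → ℝ} (hp : ∀ i, 0 < p i)
    {σ x : ℝ} (hσ : 0 < σ) (hx : 0 < x)
    (hs : Summable fun i => ‖(c i : ℂ) * (p i : ℂ) ^ (-(σ : ℂ))‖) :
    HasSum (fun i => (c i : ℂ) * (Real.exp (-(p i * x)) : ℂ))
      (mellinInv σ (fun s => Complex.Gamma s * ∑' i, (c i : ℂ) * (p i : ℂ) ^ (-s)) x) := by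
  have hnorm : ∀ i (y : ℝ), ‖(c i : ℂ) * (p i : ℂ) ^ (-(σ + y * I : ℂ))‖
      = ‖(c i : ℂ) * (p i : ℂ) ^ (-(σ : ℂ))‖ := by
    intro i y
    rw [norm_mul, norm_mul, norm_cpow_eq_rpow_re_of_pos (hp i),
      norm_cpow_eq_rpow_re_of_pos (hp i)]
    simp
  set F : ι → ℝ → ℂ := fun i y => (x : ℂ) ^ (-(σ + y * I : ℂ)) *
    (Complex.Gamma (σ + y * I) * ((c i : ℂ) * (p i : ℂ) ^ (-(σ + y * I : ℂ)))) with hF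
  have hFn : ∀ i y, ‖F i y‖ = ‖(c i : ℂ) * (p i : ℂ) ^ (-(σ : ℂ))‖ *
      ‖(x : ℂ) ^ (-(σ + y * I : ℂ)) • Complex.Gamma (σ + y * I)‖ := by
    intro i y
    rw [← hnorm i y, smul_eq_mul]
    simp only [hF, norm_mul]
    ring
  have hG := (verticalIntegrable_Gamma hσ).integrable_cpow_smul hx
  have hFeq : ∀ i y, F i y = (c i : ℂ) *
      (((p i * x : ℝ) : ℂ) ^ (-(σ + y * I : ℂ)) • Complex.Gamma (σ + y * I)) := by
    intro i y
    simp only [hF, smul_eq_mul, ofReal_mul]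
    rw [mul_cpow_ofReal_nonneg (hp i).le hx.le]
    ring
  have hFi : ∀ i, Integrable (F i) := by
    intro i
    have := ((verticalIntegrable_Gamma hσ).integrable_cpow_smul
      (mul_pos (hp i) hx)).const_mul (c i : ℂ)
    exact this.congr (ae_of_all _ fun y => (hFeq i y).symm)
  have hsum : Summable fun i => ∫ y, ‖F i y‖ := by
    simp only [hFn, integral_const_mul]
    exact hs.mul_right _
  have key := hasSum_integral_of_summable_integral_norm hFi hsum
  have key2 := key.mul_left ((1 / (2 * π) : ℝ) : ℂ)
  have hterm : ∀ i, ((1 / (2 * π) : ℝ) : ℂ) * ∫ y, F i y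
      = (c i : ℂ) * (Real.exp (-(p i * x)) : ℂ) := by
    intro i
    rw [← mellinInv_Gamma hσ (mul_pos (hp i) hx), mellinInv, real_smul]
    simp only [hFeq, integral_const_mul]
    ring
  simp only [hterm] at key2
  convert! key2 using 1
  rw [mellinInv, real_smul]
  congr 2 with y
  simp only [hF, tsum_mul_left, smul_eq_mul]

lemma HasMellin.add {f g : ℝ → ℂ} {s a b : ℂ} (hf : HasMellin f s a) (hg : HasMellin g s b) :
    HasMellin (fun t => f t + g t) s (a + b) := by
  have := hasMellin_add hf.1 hg.1
  rwa [hf.2, hg.2] at this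

lemma HasMellin.const_mul {f : ℝ → ℂ} {s a : ℂ} (hf : HasMellin f s a) (c : ℂ) :
    HasMellin (fun t => c * f t) s (c * a) := by
  have := hasMellin_const_smul hf.1 c
  rwa [hf.2] at this

lemma HasMellin.sum {κ : Type*} (S : Finset κ) {f : κ → ℝ → ℂ} {s : ℂ} {a : κ → ℂ}
    (hf : ∀ i ∈ S, HasMellin (f i) s (a i)) :
    HasMellin (fun t => ∑ i ∈ S, f i t) s (∑ i ∈ S, a i) := by
  classical
  induction S using Finset.induction_on with
  | empty =>
    refine ⟨?_, ?_⟩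
    · simp [MellinConvergent, IntegrableOn]
    · simp [mellin]
  | insert i S hi ih =>
    simp only [Finset.sum_insert hi]
    exact (hf i (Finset.mem_insert_self i S)).add
      (ih fun j hj => hf j (Finset.mem_insert_of_mem hj))

lemma hasMellin_cpow_mul_negLogPow (j : ℕ) {s a : ℂ} (hs : 0 < (s + a).re) :
    HasMellin (fun t : ℝ => (t : ℂ) ^ a * negLogPow j t) s
      ((j.factorial : ℂ) / (s + a) ^ (j + 1)) := by
  have := hasMellin_negLogPow j hs
  refine ⟨?_, ?_⟩
  · exact MellinConvergent.cpow_smul.2 this.1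
  · rw [← this.2, ← mellin_cpow_smul]
    rfl

lemma exists_taylor_remainder {f : ℂ → ℂ} {U : Set ℂ} {c : ℂ} (hU : U ∈ nhds c)
    (hf : DifferentiableOn ℂ f U) (N : ℕ) :
    ∃ (a : ℕ → ℂ) (g : ℂ → ℂ), DifferentiableOn ℂ g U ∧
      ∀ s, f s = ∑ k ∈ Finset.range N, a k * (s - c) ^ k + (s - c) ^ N * g s := by
  induction N with
  | zero => exact ⟨0, f, hf, by simp⟩
  | succ N ih =>
    obtain ⟨a, g, hg, h⟩ := ih
    refine ⟨Function.update a N (g c), dslope g c,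
      (Complex.differentiableOn_dslope hU).2 hg, fun s => ?_⟩
    have h1 := sub_smul_dslope g c s
    rw [smul_eq_mul] at h1
    have h2 : ∑ k ∈ Finset.range N, Function.update a N (g c) k * (s - c) ^ k =
        ∑ k ∈ Finset.range N, a k * (s - c) ^ k := Finset.sum_congr rfl fun k hk => by
      rw [Function.update_of_ne (Finset.mem_range.1 hk).ne]
    rw [h s, Finset.sum_range_succ, Function.update_self, h2, pow_succ, mul_assoc _ (s - c), h1]
    ring

/-- A rational function with a simple pole at `0`, a pole of order at most `N` at `1`, and a
simple pole at `-2` chosen so that it decays quadratically. -/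
def polarPart (κ : ℂ) (b : ℕ → ℂ) (N : ℕ) (s : ℂ) : ℂ :=
  κ / s + ∑ j ∈ Finset.range N, b j / (s - 1) ^ (j + 1) - (κ + b 0) / (s + 2)

/-- The inverse Mellin transform of `polarPart`. -/
def polarFun (κ : ℂ) (b : ℕ → ℂ) (N : ℕ) (t : ℝ) : ℂ :=
  κ * ((t : ℂ) ^ (0 : ℂ) * negLogPow 0 t) +
    ∑ j ∈ Finset.range N, b j / j.factorial * ((t : ℂ) ^ (-1 : ℂ) * negLogPow j t) +
    (-(κ + b 0)) * ((t : ℂ) ^ (2 : ℂ) * negLogPow 0 t)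

lemma hasMellin_polarFun (κ : ℂ) (b : ℕ → ℂ) (N : ℕ) {s : ℂ} (hs : 1 < s.re) :
    HasMellin (polarFun κ b N) s (polarPart κ b N s) := by
  have h0 : 0 < (s + 0).re := by simp; linarith
  have h1 : 0 < (s + (-1)).re := by simp; linarith
  have h2 : 0 < (s + 2).re := by simp; linarith
  have := (((hasMellin_cpow_mul_negLogPow 0 h0).const_mul κ).add
    (HasMellin.sum (Finset.range N) fun j _ =>
      (hasMellin_cpow_mul_negLogPow j h1).const_mul (b j / j.factorial))).add
    ((hasMellin_cpow_mul_negLogPow 0 h2).const_mul (-(κ + b 0)))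
  convert! this using 1
  simp only [polarPart, Nat.factorial, zero_add, pow_one, add_zero, Nat.cast_one]
  rw [sub_eq_add_neg]
  congr 1
  · congr 1
    · ring
    · refine Finset.sum_congr rfl fun j _ => ?_
      have : (j.factorial : ℂ) ≠ 0 := by exact_mod_cast j.factorial_ne_zero
      rw [← sub_eq_add_neg]
      field_simp
  · ring

lemma exists_norm_polarPart_le (κ : ℂ) (b : ℕ → ℂ) {N : ℕ} (hN : 1 ≤ N) :
    ∃ C : ℝ, 0 ≤ C ∧ ∀ (s : ℂ) (T : ℝ), 1 ≤ T → T ≤ ‖s‖ → T ≤ ‖s - 1‖ → T ≤ ‖s + 2‖ →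
      ‖polarPart κ b N s‖ ≤ C * (T ^ 2)⁻¹ := by
  obtain ⟨M, rfl⟩ : ∃ M, N = M + 1 := ⟨N - 1, by omega⟩
  refine ⟨2 * ‖κ‖ + 3 * ‖b 0‖ + ∑ j ∈ Finset.range M, ‖b (j + 1)‖, by positivity, ?_⟩
  intro s T hT h0 h1 h2
  have hT0 : 0 < T := by linarith
  have hs0 : s ≠ 0 := norm_pos_iff.1 (by linarith)
  have hs1 : s - 1 ≠ 0 := norm_pos_iff.1 (by linarith)
  have hs2 : s + 2 ≠ 0 := norm_pos_iff.1 (by linarith)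
  have e : polarPart κ b (M + 1) s = 2 * κ * (s * (s + 2))⁻¹ + 3 * b 0 * ((s - 1) * (s + 2))⁻¹ +
      ∑ j ∈ Finset.range M, b (j + 1) * ((s - 1) ^ (j + 2))⁻¹ := by
    simp only [polarPart, Finset.sum_range_succ', zero_add, pow_one]
    have : ∀ j : ℕ, b (j + 1) / (s - 1) ^ (j + 1 + 1) = b (j + 1) * ((s - 1) ^ (j + 2))⁻¹ :=
      fun j => by rw [div_eq_mul_inv]
    simp only [this]
    field_simp
    ring
  have two : ∀ u v : ℂ, T ≤ ‖u‖ → T ≤ ‖v‖ → ‖(u * v)⁻¹‖ ≤ (T ^ 2)⁻¹ := by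
    intro u v hu hv
    rw [norm_inv, norm_mul, pow_two]
    gcongr
  have pw : ∀ j : ℕ, ‖((s - 1) ^ (j + 2))⁻¹‖ ≤ (T ^ 2)⁻¹ := by
    intro j
    rw [norm_inv, norm_pow]
    apply inv_anti₀ (by positivity)
    calc T ^ 2 ≤ T ^ (j + 2) := pow_le_pow_right₀ hT (by omega)
      _ ≤ _ := by gcongr
  rw [e, add_mul, add_mul, Finset.sum_mul]
  refine (norm_add_le _ _).trans (add_le_add ((norm_add_le _ _).trans (add_le_add ?_ ?_))
    ((norm_sum_le _ _).trans (Finset.sum_le_sum fun j _ => ?_)))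
  · rw [norm_mul, norm_mul]
    simpa using mul_le_mul_of_nonneg_left (two _ _ h0 h2) (by positivity : 0 ≤ 2 * ‖κ‖)
  · rw [norm_mul, norm_mul]
    simpa using mul_le_mul_of_nonneg_left (two _ _ h1 h2) (by positivity : 0 ≤ 3 * ‖b 0‖)
  · rw [norm_mul]
    exact mul_le_mul_of_nonneg_left (pw j) (norm_nonneg _)

lemma polarFun_of_lt_one (κ : ℂ) (b : ℕ → ℂ) (N : ℕ) {t : ℝ} (h0 : 0 < t) (h1 : t < 1) :
    polarFun κ b N t = κ + ∑ j ∈ Finset.range N, b j / j.factorial *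
      ((t : ℂ)⁻¹ * (-(Real.log t : ℂ)) ^ j) - (κ + b 0) * (t : ℂ) ^ 2 := by
  have : ∀ j, negLogPow j t = (-(Real.log t : ℂ)) ^ j := fun j => by
    simp [negLogPow, h0, h1.le]
  simp only [polarFun, this, cpow_zero, cpow_neg_one, cpow_ofNat, pow_zero]
  ring

lemma continuousAt_polarFun (κ : ℂ) (b : ℕ → ℂ) (N : ℕ) {t : ℝ} (h0 : 0 < t) (h1 : t < 1) :
    ContinuousAt (polarFun κ b N) t := by
  have : polarFun κ b N =ᶠ[nhds t] fun t => κ + ∑ j ∈ Finset.range N, b j / j.factorial *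
      ((t : ℂ)⁻¹ * (-(Real.log t : ℂ)) ^ j) - (κ + b 0) * (t : ℂ) ^ 2 := by
    filter_upwards [Ioo_mem_nhds h0 h1] with u hu
    exact polarFun_of_lt_one κ b N hu.1 hu.2
  refine ContinuousAt.congr ?_ this.symm
  have hl : ContinuousAt (fun t : ℝ => (Real.log t : ℂ)) t :=
    continuous_ofReal.continuousAt.comp (Real.continuousAt_log h0.ne')
  have hi : ContinuousAt (fun t : ℝ => (t : ℂ)⁻¹) t :=
    continuous_ofReal.continuousAt.inv₀ (ofReal_ne_zero.2 h0.ne')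
  have hc : ContinuousAt (fun t : ℝ => (t : ℂ)) t := continuous_ofReal.continuousAt
  fun_prop

lemma mellinInv_polarPart (κ : ℂ) (b : ℕ → ℂ) {N : ℕ} (hN : 1 ≤ N) {t : ℝ} (h0 : 0 < t)
    (h1 : t < 1) :
    VerticalIntegrable (polarPart κ b N) 2 ∧
      mellinInv 2 (polarPart κ b N) t = polarFun κ b N t := by
  obtain ⟨C, hC0, hC⟩ := exists_norm_polarPart_le κ b hN
  have hv : VerticalIntegrable (polarPart κ b N) 2 := by
    refine verticalIntegrable_of_bound (C := C) (continuous_vertical_of_differentiableAt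
      fun s hs => ?_) fun t => ?_
    · have hs0 : s ≠ 0 := by rintro rfl; norm_num at hs
      have hs1 : s - 1 ≠ 0 := by
        intro h; rw [sub_eq_zero.1 h] at hs; norm_num at hs
      have hs2 : s + 2 ≠ 0 := by
        intro h; rw [eq_neg_of_add_eq_zero_left h] at hs; norm_num at hs
      have hs1' : ∀ j : ℕ, (s - 1) ^ (j + 1) ≠ 0 := fun j => pow_ne_zero _ hs1
      unfold polarPart
      fun_prop (disch := first | assumption | exact hs1' _)
    · have key : ∀ u : ℝ, 1 ≤ u → √(1 + t ^ 2) ≤ ‖(u + t * I : ℂ)‖ := by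
        intro u hu
        rw [Complex.norm_add_mul_I]
        exact Real.sqrt_le_sqrt (by nlinarith)
      have hsq : √(1 + t ^ 2) ^ 2 = 1 + t ^ 2 := Real.sq_sqrt (by positivity)
      rw [← hsq]
      refine hC _ _ ?_ ?_ ?_ ?_
      · exact Real.one_le_sqrt.2 (by nlinarith)
      · exact key 2 (by norm_num)
      · convert key 1 le_rfl using 2; push_cast; ring
      · convert key 4 (by norm_num) using 2; push_cast; ring
  refine ⟨hv, ?_⟩
  have hm : ∀ s : ℂ, s.re = 2 → mellin (polarFun κ b N) s = polarPart κ b N s := fun s hs =>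
    (hasMellin_polarFun κ b N (by rw [hs]; norm_num)).2
  rw [← mellinInv_congr hm]
  refine mellinInv_mellin_eq 2 _ h0 (hasMellin_polarFun κ b N (by simp)).1 ?_
    (continuousAt_polarFun κ b N h0 h1)
  refine hv.congr (ae_of_all _ fun t => ?_)
  exact (hm _ (by simp)).symm

lemma exists_polarPart_add {W : ℂ → ℂ} {U : Set ℂ} (hUo : IsOpen U) (h0 : 0 ∈ U) (h1 : 1 ∈ U)
    (hW : DifferentiableOn ℂ W U) (n : ℕ) (hn : 1 ≤ n) :
    ∃ (b : ℕ → ℂ) (h : ℂ → ℂ), b (2 * n - 1) = W 1 ∧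
      (∀ s ∈ U, s + 2 ≠ 0 → DifferentiableAt ℂ h s) ∧
      ∀ s, s ≠ 0 → s ≠ 1 →
        W s / (s * (s - 1) ^ (2 * n)) = polarPart (W 0) b (2 * n) s + h s := by
  set N := 2 * n with hN
  have hNe : (-1 : ℂ) ^ N = 1 := by rw [hN, pow_mul]; norm_num
  obtain ⟨a₀, w, hw, hwe⟩ := exists_taylor_remainder (hUo.mem_nhds h0)
    (f := fun s => W s - W 0 * (s - 1) ^ N) (by fun_prop) 1
  obtain ⟨a, g, hg, hge⟩ := exists_taylor_remainder (hUo.mem_nhds h1) hw N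
  have ha₀ : a₀ 0 = 0 := by
    have := hwe 0
    simpa [hNe] using this.symm
  have hWe : ∀ s, W s = W 0 * (s - 1) ^ N +
      s * (∑ k ∈ Finset.range N, a k * (s - 1) ^ k + (s - 1) ^ N * g s) := by
    intro s
    rw [← hge s]
    have := hwe s
    simp only [Finset.range_one, Finset.sum_singleton, ha₀, sub_zero, pow_one, zero_mul,
      zero_add] at this
    linear_combination this
  refine ⟨fun j => a (N - 1 - j), fun s => g s + (W 0 + a (N - 1)) / (s + 2), ?_, ?_, ?_⟩
  · have := hWe 1
    have hN0 : N ≠ 0 := by omega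
    obtain ⟨M, hM⟩ : ∃ M, N = M + 1 := ⟨N - 1, by omega⟩
    rw [hM, Finset.sum_range_succ'] at this
    simp at this
    simp [this]
  · intro s hs hs2
    have := (hg s hs).differentiableAt (hUo.mem_nhds hs)
    fun_prop (disch := assumption)
  · intro s hs0 hs1
    have hs1' : s - 1 ≠ 0 := sub_ne_zero.2 hs1
    have hsum : ∑ j ∈ Finset.range N, a (N - 1 - j) / (s - 1) ^ (j + 1) =
        (∑ k ∈ Finset.range N, a k * (s - 1) ^ k) / (s - 1) ^ N := by
      rw [← Finset.sum_range_reflect (fun k => a k * (s - 1) ^ k), Finset.sum_div]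
      refine Finset.sum_congr rfl fun j hj => ?_
      have hj' : N = (N - 1 - j) + (j + 1) := by
        have := Finset.mem_range.1 hj
        omega
      have : (s - 1) ^ N = (s - 1) ^ (N - 1 - j) * (s - 1) ^ (j + 1) := by
        rw [← pow_add, ← hj']
      rw [this]
      field_simp
    simp only [polarPart, hsum, Nat.sub_zero]
    rw [hWe s]
    have : (s - 1) ^ N ≠ 0 := pow_ne_zero _ hs1'
    field_simp
    ring

lemma exists_norm_Gamma_mul_le {V : ℂ → ℂ} {δ : ℝ} (hδ : 0 < δ) {C : ℝ} {N : ℕ}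
    (hV : ∀ s : ℂ, -1 + δ ≤ s.re → s.re ≤ 2 → ‖V s‖ ≤ C * (1 + ‖s‖) ^ N) (n : ℕ) :
    ∃ D : ℝ, 0 ≤ D ∧ ∀ s : ℂ, -1 + δ ≤ s.re → s.re ≤ 2 →
      ‖Complex.Gamma (s + 1) * V s ^ n‖ ≤ D := by
  obtain ⟨D, hD⟩ := exists_norm_Gamma_mul_pow_le (N * n) (a := δ) (b := 3) hδ
  refine ⟨|C| ^ n * ((2 / δ + 1) ^ (N * n) * |D|), by positivity, fun s h1 h2 => ?_⟩
  have hre : δ ≤ (s + 1).re := by simp; linarith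
  have hre2 : (s + 1).re ≤ 3 := by simp; linarith
  have hn : δ ≤ ‖s + 1‖ := hre.trans ((le_abs_self _).trans (abs_re_le_norm _))
  have hb : 1 + ‖s‖ ≤ (2 / δ + 1) * ‖s + 1‖ := by
    have h3 : ‖s‖ ≤ ‖s + 1‖ + 1 := by
      simpa using norm_sub_le (s + 1) 1
    have h4 : 2 ≤ 2 / δ * ‖s + 1‖ := by
      rw [div_mul_eq_mul_div, le_div_iff₀ hδ]; linarith
    linarith
  have hVs : ‖V s‖ ≤ |C| * ((2 / δ + 1) * ‖s + 1‖) ^ N :=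
    (hV s h1 h2).trans (by gcongr; exact le_abs_self C)
  rw [norm_mul, norm_pow]
  calc ‖Complex.Gamma (s + 1)‖ * ‖V s‖ ^ n
      ≤ ‖Complex.Gamma (s + 1)‖ * (|C| * ((2 / δ + 1) * ‖s + 1‖) ^ N) ^ n := by gcongr
    _ = |C| ^ n * ((2 / δ + 1) ^ (N * n) * (‖Complex.Gamma (s + 1)‖ * ‖s + 1‖ ^ (N * n))) := by
        rw [mul_pow, ← pow_mul, mul_pow]; ring
    _ ≤ _ := by
        gcongr
        exact (hD _ hre hre2).trans (le_abs_self D)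

lemma exists_norm_remainder_le {W h : ℂ → ℂ} {b : ℕ → ℂ} {κ : ℂ} {N : ℕ} (hN : 1 ≤ N) {δ D : ℝ}
    (hδ : 0 < δ) (hD : 0 ≤ D)
    (hW : ∀ s : ℂ, -1 + δ ≤ s.re → s.re ≤ 2 → ‖W s‖ ≤ D)
    (hd : ∀ s : ℂ, -1 < s.re → DifferentiableAt ℂ h s)
    (he : ∀ s, s ≠ 0 → s ≠ 1 → W s / (s * (s - 1) ^ N) = polarPart κ b N s + h s) :
    ∃ C : ℝ, ∀ s : ℂ, -1 + δ ≤ s.re → s.re ≤ 2 → ‖h s‖ ≤ C * (1 + s.im ^ 2)⁻¹ := by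
  obtain ⟨CQ, hCQ0, hCQ⟩ := exists_norm_polarPart_le κ b hN
  have hcpt : IsCompact (Icc (-1 + δ) 2 ×ℂ Icc (-1 : ℝ) 1) := isCompact_Icc.reProdIm isCompact_Icc
  obtain ⟨C₀, hC₀⟩ := hcpt.exists_bound_of_continuousOn (f := h) fun s hs =>
    (hd s (by linarith [hs.1.1])).continuousAt.continuousWithinAt
  refine ⟨2 * (|C₀| + D + CQ), fun s h1 h2 => ?_⟩
  rcases le_or_gt |s.im| 1 with ht | ht
  · have := hC₀ s ⟨⟨h1, h2⟩, abs_le.1 ht⟩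
    have h3 : s.im ^ 2 ≤ 1 := (sq_le_one_iff_abs_le_one _).2 ht
    rw [← div_eq_mul_inv, le_div_iff₀ (by positivity)]
    calc ‖h s‖ * (1 + s.im ^ 2) ≤ |C₀| * 2 := by
          gcongr
          · exact this.trans (le_abs_self _)
          · linarith
      _ ≤ _ := by linarith
  · have hT : ∀ u : ℝ, |s.im| ≤ ‖s + u‖ := fun u => by
      simpa using abs_im_le_norm (s + u)
    have hT0 := hT 0
    have hT1 := hT (-1)
    have hT2 := hT 2
    push_cast at hT0 hT1 hT2
    rw [add_zero] at hT0
    rw [← sub_eq_add_neg] at hT1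
    have hs0 : s ≠ 0 := norm_pos_iff.1 (by linarith)
    have hs1 : s - 1 ≠ 0 := norm_pos_iff.1 (by linarith)
    have hh : h s = W s / (s * (s - 1) ^ N) - polarPart κ b N s := by
      rw [he s hs0 (sub_ne_zero.1 hs1)]; ring
    have hWb : ‖W s / (s * (s - 1) ^ N)‖ ≤ D * (|s.im| ^ 2)⁻¹ := by
      rw [norm_div, div_eq_mul_inv, norm_mul, norm_pow]
      refine mul_le_mul (hW s h1 h2) (inv_anti₀ (by positivity) ?_) (by positivity) hD
      rw [pow_two]
      refine mul_le_mul hT0 ?_ (by positivity) (by positivity)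
      calc |s.im| ≤ |s.im| ^ N := le_self_pow₀ ht.le (by omega)
        _ ≤ _ := by gcongr
    have hQb := hCQ s |s.im| ht.le hT0 hT1 hT2
    have hsq : (|s.im| ^ 2)⁻¹ ≤ 2 * (1 + s.im ^ 2)⁻¹ := by
      rw [sq_abs, ← div_eq_mul_inv, inv_eq_one_div, div_le_div_iff₀ (by nlinarith [sq_abs s.im])
        (by positivity)]
      nlinarith [sq_abs s.im]
    calc ‖h s‖ ≤ D * (|s.im| ^ 2)⁻¹ + CQ * (|s.im| ^ 2)⁻¹ := by
          rw [hh]; exact (norm_sub_le _ _).trans (add_le_add hWb hQb)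
      _ = (D + CQ) * (|s.im| ^ 2)⁻¹ := by ring
      _ ≤ (D + CQ) * (2 * (1 + s.im ^ 2)⁻¹) := by gcongr
      _ = 2 * (0 + D + CQ) * (1 + s.im ^ 2)⁻¹ := by ring
      _ ≤ _ := by gcongr; exact abs_nonneg _

lemma ofReal_prod_cpow {ι : Type*} (S : Finset ι) {f : ι → ℝ} (hf : ∀ i ∈ S, 0 ≤ f i) (z : ℂ) :
    ((∏ i ∈ S, f i : ℝ) : ℂ) ^ z = ∏ i ∈ S, (f i : ℂ) ^ z := by
  classical
  induction S using Finset.induction_on with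
  | empty => simp
  | insert i S hi ih =>
    rw [Finset.prod_insert hi, Finset.prod_insert hi, ofReal_mul,
      mul_cpow_ofReal_nonneg (hf i (Finset.mem_insert_self i S))
        (Finset.prod_nonneg fun j hj => hf j (Finset.mem_insert_of_mem hj)),
      ih fun j hj => hf j (Finset.mem_insert_of_mem hj)]

/-- Exponential sums attached to the `n`-th power of a generalized Dirichlet series with a
double pole at `1`. -/
theorem exists_exp_sum_asymptotic {ι : Type*} [Countable ι] {m a : ι → ℝ} (ha : ∀ i, 0 < a i)
    {V : ℂ → ℂ} (hV : ∀ s : ℂ, -1 < s.re → DifferentiableAt ℂ V s)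
    (hgrow : ∀ δ : ℝ, 0 < δ → ∃ (C : ℝ) (N : ℕ), ∀ s : ℂ, -1 + δ ≤ s.re → s.re ≤ 2 →
      ‖V s‖ ≤ C * (1 + ‖s‖) ^ N)
    (hser : ∀ s : ℂ, 1 < s.re → HasSum (fun i => (m i : ℂ) * (a i : ℂ) ^ (-s)) (V s / (s - 1) ^ 2))
    {n : ℕ} (hn : 1 ≤ n) :
    ∃ c : ℕ → ℂ, c (2 * n - 1) = V 1 ^ n / (2 * n - 1).factorial ∧
      ∀ ε : ℝ, 0 < ε → ∃ K : ℝ, ∀ X : ℝ, 2 ≤ X →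
        ‖((∑' v : Fin n → ι, (∏ i, m (v i)) * Real.exp (-(∏ i, a (v i)) / X) : ℝ) : ℂ)
          - (X : ℂ) * ∑ j ∈ Finset.range (2 * n), c j * (Real.log X : ℂ) ^ j - V 0 ^ n‖
        ≤ K * X ^ (ε - 1) := by
  set W : ℂ → ℂ := fun s => Complex.Gamma (s + 1) * V s ^ n with hWdef
  have hUo : IsOpen {s : ℂ | -1 < s.re} := isOpen_lt continuous_const continuous_re
  have hWd : DifferentiableOn ℂ W {s : ℂ | -1 < s.re} := by
    intro s hs
    refine DifferentiableAt.differentiableWithinAt ?_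
    have h1 : DifferentiableAt ℂ Complex.Gamma (s + 1) := by
      refine differentiableAt_Gamma _ fun k hk => ?_
      have := congrArg re hk
      simp at this hs
      have : (0 : ℝ) ≤ k := k.cast_nonneg
      linarith
    have h2 := hV s hs
    exact (h1.comp s (by fun_prop)).mul (h2.pow n)
  obtain ⟨b, h, hb1, hhd, hWe⟩ := exists_polarPart_add hUo (by simp) (by simp) hWd n hn
  have hW0 : W 0 = V 0 ^ n := by simp [hWdef]
  have hW1 : W 1 = V 1 ^ n := by
    have : Complex.Gamma (1 + 1) = 1 := by
      rw [Complex.Gamma_add_one 1 one_ne_zero, Complex.Gamma_one, one_mul]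
    simp [hWdef, this]
  have hhd' : ∀ s : ℂ, -1 < s.re → DifferentiableAt ℂ h s := fun s hs => hhd s hs fun h0 => by
    have := congrArg re h0
    simp at this
    linarith
  refine ⟨fun j => b j / j.factorial, by simp only [hb1, hW1], fun ε hε => ?_⟩
  set δ := min ε 1 with hδdef
  have hδ : 0 < δ := lt_min hε one_pos
  have hδ1 : δ ≤ 1 := min_le_right _ _
  obtain ⟨C₁, N₁, hV₁⟩ := hgrow δ hδ
  obtain ⟨D, hD0, hD⟩ := exists_norm_Gamma_mul_le hδ hV₁ n
  obtain ⟨C, hC⟩ := exists_norm_remainder_le (by omega : 1 ≤ 2 * n) hδ hD0 hD hhd' hWe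
  refine ⟨|C / 2| + ‖V 0 ^ n + b 0‖, fun X hX => ?_⟩
  have hX0 : 0 < X := by linarith
  set x := X⁻¹ with hx
  have hx0 : 0 < x := inv_pos.2 hX0
  have hx1 : x < 1 := inv_lt_one_of_one_lt₀ (by linarith)
  have hsumn : Summable fun i => ‖(m i : ℂ) * (a i : ℂ) ^ (-((2 : ℝ) : ℂ))‖ :=
    (hser ((2 : ℝ) : ℂ) (by simp)).summable.norm
  have hterm : ∀ (s : ℂ) (v : Fin n → ι), ((∏ i, m (v i) : ℝ) : ℂ) *
      ((∏ i, a (v i) : ℝ) : ℂ) ^ (-s) = ∏ i, (m (v i) : ℂ) * (a (v i) : ℂ) ^ (-s) := by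
    intro s v
    rw [Finset.prod_mul_distrib, ofReal_prod, ofReal_prod]
    congr 1
    rw [← ofReal_prod]
    exact ofReal_prod_cpow _ (fun i _ => (ha _).le) _
  have hF := hasSum_mul_exp_eq_mellinInv (c := fun v : Fin n → ι => ∏ i, m (v i))
    (p := fun v => ∏ i, a (v i)) (fun v => Finset.prod_pos fun i _ => ha _) two_pos hx0
    (by simp only [hterm]; exact (hasSum_pi_fin_prod hsumn n).1)
  have hline : ∀ s : ℂ, s.re = 2 → Complex.Gamma s * ∑' v : Fin n → ι, ((∏ i, m (v i) : ℝ) : ℂ) *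
      ((∏ i, a (v i) : ℝ) : ℂ) ^ (-s) = polarPart (W 0) b (2 * n) s + h s := by
    intro s hs
    have hs0 : s ≠ 0 := by rintro rfl; norm_num at hs
    have hs1 : s ≠ 1 := by rintro rfl; norm_num at hs
    have h1 := hser s (by rw [hs]; norm_num)
    simp only [hterm]
    rw [(hasSum_pi_fin_prod h1.summable.norm n).2.tsum_eq, h1.tsum_eq, ← hWe s hs0 hs1, hWdef]
    simp only [Complex.Gamma_add_one s hs0]
    have := sub_ne_zero.2 hs1
    rw [div_pow, ← pow_mul]
    field_simp
  have hcl : ∀ t : ℝ, ‖h ((-1 + δ : ℝ) + t * I)‖ ≤ C * (1 + t ^ 2)⁻¹ := fun t => by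
    simpa using hC ((-1 + δ : ℝ) + t * I) (by simp) (by simp; linarith)
  have hc2 : ∀ t : ℝ, ‖h ((2 : ℝ) + t * I)‖ ≤ C * (1 + t ^ 2)⁻¹ := fun t => by
    simpa using hC ((2 : ℝ) + t * I) (by simp; linarith) (by simp)
  have hvh : VerticalIntegrable h 2 := verticalIntegrable_of_bound
    (continuous_vertical_of_differentiableAt fun s hs => hhd' s (by rw [hs]; norm_num)) hc2
  obtain ⟨hvQ, hQ⟩ := mellinInv_polarPart (W 0) b (by omega : 1 ≤ 2 * n) hx0 hx1
  have hFx := hF.tsum_eq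
  rw [mellinInv_congr hline, mellinInv_add hx0 hvQ hvh, hQ,
    ← mellinInv_eq_mellinInv_of_bound (by linarith : -1 + δ ≤ 2) hx0
      (fun s h1 _ => hhd' s (by linarith)) hC,
    polarFun_of_lt_one _ _ _ hx0 hx1] at hFx
  have hlog : Real.log x = -Real.log X := Real.log_inv X
  have hE := norm_mellinInv_le hx0 hcl
  have hS : ((∑' v : Fin n → ι, (∏ i, m (v i)) * Real.exp (-(∏ i, a (v i)) / X) : ℝ) : ℂ) =
      ∑' v : Fin n → ι, ((∏ i, m (v i) : ℝ) : ℂ) * (Real.exp (-((∏ i, a (v i)) * x)) : ℂ) := by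
    rw [ofReal_tsum]
    refine tsum_congr fun v => ?_
    rw [hx, ofReal_mul, neg_div, div_eq_mul_inv]
  have hxX : (x : ℂ)⁻¹ = X := by rw [hx]; push_cast; rw [inv_inv]
  have hsumeq : ∑ j ∈ Finset.range (2 * n), b j / j.factorial *
      ((x : ℂ)⁻¹ * (-(Real.log x : ℂ)) ^ j) =
      (X : ℂ) * ∑ j ∈ Finset.range (2 * n), b j / j.factorial * (Real.log X : ℂ) ^ j := by
    rw [Finset.mul_sum, hlog, hxX]
    refine Finset.sum_congr rfl fun j _ => ?_
    push_cast
    ring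
  rw [hS, hFx, hsumeq, hW0]
  have hfin : ∀ A B M : ℂ, A + B - (A + b 0) * (x : ℂ) ^ 2 + M - B - A =
      M - (A + b 0) * (x : ℂ) ^ 2 := fun A B M => by ring
  rw [hfin]
  have hpow : x ^ (-(-1 + δ)) = X ^ (δ - 1) := by
    rw [hx, Real.inv_rpow hX0.le, ← Real.rpow_neg hX0.le]; ring_nf
  have hmono : X ^ (δ - 1) ≤ X ^ (ε - 1) :=
    Real.rpow_le_rpow_of_exponent_le (by linarith) (by linarith [min_le_left ε 1])
  have hx2 : x ^ 2 ≤ X ^ (ε - 1) := by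
    have : x ^ 2 = X ^ (-2 : ℝ) := by
      rw [hx, Real.rpow_neg hX0.le, inv_pow]; norm_cast
    rw [this]
    exact Real.rpow_le_rpow_of_exponent_le (by linarith) (by linarith)
  rw [hpow] at hE
  refine (norm_sub_le _ _).trans ?_
  rw [norm_mul, norm_pow, norm_real, add_mul (|C / 2|), Real.norm_of_nonneg hx0.le]
  refine add_le_add (hE.trans ?_) (by gcongr)
  calc C / 2 * X ^ (δ - 1) ≤ |C / 2| * X ^ (δ - 1) := by gcongr; exact le_abs_self _
    _ ≤ _ := by gcongr

lemma HasMellin.comp_inv {f : ℝ → ℂ} {s v : ℂ} (hf : HasMellin f s v) :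
    HasMellin (fun t => f t⁻¹) (-s) v := by
  refine ⟨?_, by rw [mellin_comp_inv, neg_neg, hf.2]⟩
  have := (MellinConvergent.comp_rpow (f := f) (s := -s) (a := -1) (by norm_num)).2
    (by simpa using hf.1)
  simpa only [Real.rpow_neg_one] using this

lemma HasMellin.integral_Ioi_one {f : ℝ → ℂ} {s v : ℂ} (hf : HasMellin f (-s) v)
    (h0 : ∀ t, 0 < t → t < 1 → f t = 0) :
    IntegrableOn (fun r : ℝ => f r * (r : ℂ) ^ (-s - 1)) (Ioi 1) ∧
      ∫ r in Ioi (1 : ℝ), f r * (r : ℂ) ^ (-s - 1) = v := by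
  have h1 : IntegrableOn (fun r : ℝ => f r * (r : ℂ) ^ (-s - 1)) (Ioi 0) := by
    refine IntegrableOn.congr_fun hf.1 (fun r _ => ?_) measurableSet_Ioi
    simp [mul_comm]
  refine ⟨h1.mono_set (Ioi_subset_Ioi zero_le_one), ?_⟩
  rw [← hf.2, mellin, ← integral_Ici_eq_integral_Ioi]
  symm
  rw [setIntegral_eq_of_subset_of_forall_sdiff_eq_zero measurableSet_Ioi
    (Ici_subset_Ioi.2 zero_lt_one)]
  · simp [mul_comm]
  · rintro x ⟨hx0, hx1⟩
    simp [h0 x hx0 (by simpa using hx1)]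

lemma integral_log_pow_mul_cpow (j : ℕ) {s a : ℂ} (h : a.re < s.re) :
    IntegrableOn (fun r : ℝ => (r : ℂ) ^ a * (Real.log r : ℂ) ^ j * (r : ℂ) ^ (-s - 1)) (Ioi 1) ∧
      ∫ r in Ioi (1 : ℝ), (r : ℂ) ^ a * (Real.log r : ℂ) ^ j * (r : ℂ) ^ (-s - 1) =
        j.factorial / (s - a) ^ (j + 1) := by
  have h0 : 0 < (s + -a).re := by simpa using h
  have := (hasMellin_cpow_mul_negLogPow j h0).comp_inv.integral_Ioi_one fun t ht0 ht1 => by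
    rw [negLogPow_eq_zero (one_lt_inv₀ ht0 |>.2 ht1), mul_zero]
  rw [← sub_eq_add_neg] at this
  have e : ∀ r ∈ Ioi (1 : ℝ), ((r⁻¹ : ℝ) : ℂ) ^ (-a) * negLogPow j r⁻¹ * (r : ℂ) ^ (-s - 1) =
      (r : ℂ) ^ a * (Real.log r : ℂ) ^ j * (r : ℂ) ^ (-s - 1) := by
    intro r hr
    have hr0 : 0 < r := zero_lt_one.trans hr
    have : negLogPow j r⁻¹ = (Real.log r : ℂ) ^ j := by
      have h1 : r⁻¹ ≤ 1 := inv_le_one_of_one_le₀ (le_of_lt hr)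
      simp [negLogPow, hr0, h1]
    rw [this, ofReal_inv, inv_cpow _ _ (by rw [arg_ofReal_of_nonneg hr0.le]; exact pi_pos.ne),
      cpow_neg, inv_inv]
  exact ⟨this.1.congr_fun e measurableSet_Ioi,
    (setIntegral_congr_fun measurableSet_Ioi e).symm.trans this.2⟩

lemma integral_posLog_mul_cpow {b : ℝ} (hb : 1 ≤ b) {s : ℂ} (hs : 0 < s.re) :
    IntegrableOn (fun r : ℝ => (Real.posLog (r / b) : ℂ) * (r : ℂ) ^ (-s - 1)) (Ioi 1) ∧
      ∫ r in Ioi (1 : ℝ), (Real.posLog (r / b) : ℂ) * (r : ℂ) ^ (-s - 1) =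
        (b : ℂ) ^ (-s) / s ^ 2 := by
  have hb0 : 0 < b := by linarith
  have h1 := (hasMellin_negLogPow 1 hs).comp_inv
  have h2 : HasMellin (fun t => negLogPow 1 (b⁻¹ * t)⁻¹) (-s) ((b : ℂ) ^ (-s) / s ^ 2) := by
    refine ⟨(MellinConvergent.comp_mul_left (inv_pos.2 hb0)).2 h1.1, ?_⟩
    rw [mellin_comp_mul_left (fun t => negLogPow 1 t⁻¹) _ (inv_pos.2 hb0), h1.2, ofReal_inv,
      inv_cpow _ _ (by rw [arg_ofReal_of_nonneg hb0.le]; exact pi_pos.ne), neg_neg, cpow_neg]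
    simp [div_eq_mul_inv]
  have hz : ∀ t, 0 < t → t < 1 → negLogPow 1 (b⁻¹ * t)⁻¹ = 0 := fun t h0 h1 => by
    refine negLogPow_eq_zero ((one_lt_inv₀ (by positivity)).2 ?_)
    rw [inv_mul_lt_iff₀ hb0]
    linarith
  have := h2.integral_Ioi_one hz
  have e : ∀ r ∈ Ioi (1 : ℝ), negLogPow 1 (b⁻¹ * r)⁻¹ * (r : ℂ) ^ (-s - 1) =
      (Real.posLog (r / b) : ℂ) * (r : ℂ) ^ (-s - 1) := by
    intro r hr
    have hr0 : 0 < r := zero_lt_one.trans hr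
    congr 1
    rcases le_or_gt b r with h | h
    · have h1 : 1 ≤ r / b := (one_le_div hb0).2 h
      rw [Real.posLog_eq_log (by rwa [abs_of_nonneg (by positivity)])]
      have h2 : (b⁻¹ * r)⁻¹ ≤ 1 := inv_le_one_of_one_le₀ (by rwa [inv_mul_eq_div])
      have h3 : 0 < (b⁻¹ * r)⁻¹ := by positivity
      rw [negLogPow, indicator_of_mem (show (b⁻¹ * r)⁻¹ ∈ Ioc (0 : ℝ) 1 from ⟨h3, h2⟩),
        Real.log_inv, inv_mul_eq_div]
      simp
    · have h1 : r / b ≤ 1 := ((div_lt_one hb0).2 h).le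
      rw [(Real.posLog_eq_zero_iff _).2 (by rwa [abs_of_nonneg (by positivity)]), negLogPow_eq_zero,
        ofReal_zero]
      refine (one_lt_inv₀ (by positivity)).2 ?_
      rwa [inv_mul_lt_iff₀ hb0, mul_one]
  exact ⟨this.1.congr_fun e measurableSet_Ioi,
    (setIntegral_congr_fun measurableSet_Ioi e).symm.trans this.2⟩

/-- Dominated differentiation of a Mellin-type integral over `(1, ∞)`. -/
lemma differentiableAt_integral_Ioi_one {f : ℝ → ℂ} {σ₀ : ℝ}
    (hf : ∀ σ : ℝ, σ₀ < σ → IntegrableOn (fun r : ℝ => f r * (r : ℂ) ^ (-(σ : ℂ) - 1)) (Ioi 1))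
    {s : ℂ} (hs : σ₀ < s.re) :
    DifferentiableAt ℂ (fun s : ℂ => ∫ r in Ioi (1 : ℝ), f r * (r : ℂ) ^ (-s - 1)) s := by
  set η := (s.re - σ₀) / 3 with hη
  have hη0 : 0 < η := by rw [hη]; linarith
  have hcp : ∀ z : ℂ, Measurable fun r : ℝ => (r : ℂ) ^ z := fun z => by fun_prop
  have hfm : AEStronglyMeasurable f (volume.restrict (Ioi 1)) := by
    have h1 := (hf (σ₀ + 1) (by linarith)).aestronglyMeasurable.mul
      ((hcp ((σ₀ + 1 : ℝ) + 1)).aestronglyMeasurable (μ := volume.restrict (Ioi 1)))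
    refine h1.congr ((ae_restrict_iff' measurableSet_Ioi).2 (ae_of_all _ fun r hr => ?_))
    have hr0 : (r : ℂ) ≠ 0 := ofReal_ne_zero.2 (zero_lt_one.trans hr).ne'
    simp only [Pi.mul_apply]
    rw [mul_assoc, ← cpow_add _ _ hr0]
    ring_nf
    simp
  refine (hasDerivAt_integral_of_dominated_loc_of_deriv_le (Metric.ball_mem_nhds s hη0)
    (F' := fun z r => f r * ((r : ℂ) ^ (-z - 1) * (Real.log r : ℂ) * (-1)))
    (bound := fun r => ‖f r * (r : ℂ) ^ (-((σ₀ + η : ℝ) : ℂ) - 1)‖ * η⁻¹)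
    (Eventually.of_forall fun z => hfm.mul (hcp _).aestronglyMeasurable)
    ?_ ?_ ?_ ?_ ?_).2.differentiableAt
  · refine Integrable.mono (hf s.re hs) (hfm.mul (hcp _).aestronglyMeasurable)
      ((ae_restrict_iff' measurableSet_Ioi).2 (ae_of_all _ fun r hr => ?_))
    rw [Pi.mul_apply, norm_mul, norm_mul, norm_cpow_eq_rpow_re_of_pos (zero_lt_one.trans hr),
      norm_cpow_eq_rpow_re_of_pos (zero_lt_one.trans hr)]
    simp
  · refine hfm.mul (Measurable.aestronglyMeasurable ?_)
    exact ((hcp _).mul (by fun_prop)).mul_const _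
  · refine (ae_restrict_iff' measurableSet_Ioi).2 (ae_of_all _ fun r hr z hz => ?_)
    have hr0 : 0 < r := zero_lt_one.trans hr
    have hr1 : (1 : ℝ) < r := hr
    have hzre : s.re - η < z.re := by
      have h1 := abs_re_le_norm (z - s)
      rw [Metric.mem_ball, dist_eq_norm] at hz
      have h2 := neg_abs_le (z - s).re
      rw [sub_re] at h1 h2
      linarith
    rw [norm_mul, norm_mul, norm_mul, norm_mul, norm_cpow_eq_rpow_re_of_pos hr0,
      norm_cpow_eq_rpow_re_of_pos hr0, norm_real, Real.norm_of_nonneg (Real.log_nonneg hr1.le),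
      norm_neg, norm_one, mul_one, mul_assoc]
    refine mul_le_mul_of_nonneg_left ?_ (norm_nonneg _)
    simp only [sub_re, neg_re, ofReal_re, one_re]
    have hlog : Real.log r ≤ r ^ η / η := Real.log_le_rpow_div hr0.le hη0
    calc r ^ (-z.re - 1) * Real.log r ≤ r ^ (-z.re - 1) * (r ^ η / η) := by gcongr
      _ = r ^ (-z.re - 1 + η) * η⁻¹ := by rw [Real.rpow_add hr0, div_eq_mul_inv, mul_assoc]
      _ ≤ r ^ (-(σ₀ + η) - 1) * η⁻¹ := by
        gcongr
        · exact hr1.le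
        · rw [hη] at hzre ⊢; linarith
  · exact (hf _ (by linarith)).norm.mul_const _
  · refine (ae_restrict_iff' measurableSet_Ioi).2 (ae_of_all _ fun r hr z _ => ?_)
    have hr0 : (r : ℂ) ≠ 0 := ofReal_ne_zero.2 (zero_lt_one.trans hr).ne'
    rw [ofReal_log (zero_lt_one.trans hr).le]
    refine HasDerivAt.const_mul _ ?_
    exact ((hasDerivAt_id z).neg.sub_const 1).const_cpow (Or.inl hr0)

lemma norm_integral_Ioi_one_le {f : ℝ → ℂ} {σ : ℝ}
    (hf : IntegrableOn (fun r : ℝ => f r * (r : ℂ) ^ (-(σ : ℂ) - 1)) (Ioi 1))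
    {s : ℂ} (hs : σ ≤ s.re) :
    ‖∫ r in Ioi (1 : ℝ), f r * (r : ℂ) ^ (-s - 1)‖ ≤
      ∫ r in Ioi (1 : ℝ), ‖f r * (r : ℂ) ^ (-(σ : ℂ) - 1)‖ := by
  refine norm_integral_le_of_norm_le hf.norm
    ((ae_restrict_iff' measurableSet_Ioi).2 (ae_of_all _ fun r hr => ?_))
  rw [norm_mul, norm_mul, norm_cpow_eq_rpow_re_of_pos (zero_lt_one.trans hr),
    norm_cpow_eq_rpow_re_of_pos (zero_lt_one.trans hr)]
  refine mul_le_mul_of_nonneg_left (Real.rpow_le_rpow_of_exponent_le (le_of_lt hr) ?_)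
    (norm_nonneg _)
  simpa using hs

/-- If the logarithmic counting function of a sequence `b` with weights `m` is
`A r log r + B r + C log r + D + E r`, this evaluates the Dirichlet series `∑ m b ^ (-s)`. -/
lemma hasSum_mul_cpow_of_posLog {ι : Type*} [Countable ι] {m b : ι → ℝ} (hm : ∀ i, 0 ≤ m i)
    (hb : ∀ i, 1 ≤ b i) {J E : ℝ → ℝ} {A B C D : ℝ}
    (hJ : ∀ r, 1 < r → HasSum (fun i => m i * Real.posLog (r / b i)) (J r))
    (hJE : ∀ r, 1 < r → J r = A * (r * Real.log r) + B * r + C * Real.log r + D + E r)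
    (hE : ∀ σ : ℝ, -1 < σ →
      IntegrableOn (fun r : ℝ => (E r : ℂ) * (r : ℂ) ^ (-(σ : ℂ) - 1)) (Ioi 1))
    {s : ℂ} (hs : 1 < s.re) :
    HasSum (fun i => (m i : ℂ) * (b i : ℂ) ^ (-s))
      (A * s ^ 2 / (s - 1) ^ 2 + B * s ^ 2 / (s - 1) + C + D * s +
        s ^ 2 * ∫ r in Ioi (1 : ℝ), (E r : ℂ) * (r : ℂ) ^ (-s - 1)) := by
  have main : ∀ z : ℂ, 1 < z.re →
      IntegrableOn (fun r : ℝ => (E r : ℂ) * (r : ℂ) ^ (-z - 1)) (Ioi 1) →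
      IntegrableOn (fun r : ℝ => (J r : ℂ) * (r : ℂ) ^ (-z - 1)) (Ioi 1) ∧
      ∫ r in Ioi (1 : ℝ), (J r : ℂ) * (r : ℂ) ^ (-z - 1) =
        A / (z - 1) ^ 2 + B / (z - 1) + C / z ^ 2 + D / z +
        ∫ r in Ioi (1 : ℝ), (E r : ℂ) * (r : ℂ) ^ (-z - 1) := by
    intro z hz hEz
    have z0 : (0 : ℂ).re < z.re := by simp; linarith
    have z1 : (1 : ℂ).re < z.re := by simpa using hz
    obtain ⟨i1, v1⟩ := integral_log_pow_mul_cpow 1 z1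
    obtain ⟨i2, v2⟩ := integral_log_pow_mul_cpow 0 z1
    obtain ⟨i3, v3⟩ := integral_log_pow_mul_cpow 1 z0
    obtain ⟨i4, v4⟩ := integral_log_pow_mul_cpow 0 z0
    have e : ∀ r ∈ Ioi (1 : ℝ), (J r : ℂ) * (r : ℂ) ^ (-z - 1) =
        A * ((r : ℂ) ^ (1 : ℂ) * (Real.log r : ℂ) ^ 1 * (r : ℂ) ^ (-z - 1)) +
        B * ((r : ℂ) ^ (1 : ℂ) * (Real.log r : ℂ) ^ 0 * (r : ℂ) ^ (-z - 1)) +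
        C * ((r : ℂ) ^ (0 : ℂ) * (Real.log r : ℂ) ^ 1 * (r : ℂ) ^ (-z - 1)) +
        D * ((r : ℂ) ^ (0 : ℂ) * (Real.log r : ℂ) ^ 0 * (r : ℂ) ^ (-z - 1)) +
        (E r : ℂ) * (r : ℂ) ^ (-z - 1) := by
      intro r hr
      rw [hJE r hr]
      simp only [cpow_one, cpow_zero, pow_one, pow_zero]
      push_cast
      ring
    have j1 := i1.const_mul (A : ℂ)
    have j2 := i2.const_mul (B : ℂ)
    have j3 := i3.const_mul (C : ℂ)
    have j4 := i4.const_mul (D : ℂ)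
    have k2 := Integrable.add j1 j2
    have k3 := Integrable.add k2 j3
    have k4 := Integrable.add k3 j4
    refine ⟨IntegrableOn.congr_fun (Integrable.add k4 hEz) (fun r hr => (e r hr).symm)
      measurableSet_Ioi, ?_⟩
    rw [setIntegral_congr_fun measurableSet_Ioi e]
    erw [integral_add k4 hEz, integral_add k3 j4, integral_add k2 j3, integral_add j1 j2]
    simp only [integral_const_mul, v1, v2, v3, v4]
    simp only [Nat.factorial, zero_add, pow_one, sub_zero, Nat.cast_one, mul_one,
      one_add_one_eq_two, mul_one_div]
  have hE' : IntegrableOn (fun r : ℝ => (E r : ℂ) * (r : ℂ) ^ (-s - 1)) (Ioi 1) := by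
    have h0 := hE s.re (by linarith)
    have hcp : ∀ z : ℂ, Measurable fun r : ℝ => (r : ℂ) ^ z := fun z => by fun_prop
    refine Integrable.mono h0 ?_ ((ae_restrict_iff' measurableSet_Ioi).2
      (ae_of_all _ fun r hr => ?_))
    · have h1 := h0.aestronglyMeasurable.mul
        ((hcp (s.re - s)).aestronglyMeasurable (μ := volume.restrict (Ioi 1)))
      refine h1.congr ((ae_restrict_iff' measurableSet_Ioi).2 (ae_of_all _ fun r hr => ?_))
      have hr0 : (r : ℂ) ≠ 0 := ofReal_ne_zero.2 (zero_lt_one.trans hr).ne'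
      simp only [Pi.mul_apply]
      rw [mul_assoc, ← cpow_add _ _ hr0]
      ring_nf
    · rw [norm_mul, norm_mul, norm_cpow_eq_rpow_re_of_pos (zero_lt_one.trans hr),
        norm_cpow_eq_rpow_re_of_pos (zero_lt_one.trans hr)]
      simp
  have hs0 : 0 < s.re := by linarith
  have hs0' : s ≠ 0 := by rintro rfl; simp at hs0
  have hs1' : s - 1 ≠ 0 := by
    intro h; rw [sub_eq_zero.1 h] at hs; simp at hs
  set F : ι → ℝ → ℂ := fun i r => (m i : ℂ) * ((Real.posLog (r / b i) : ℂ) * (r : ℂ) ^ (-s - 1))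
    with hF
  have hFi : ∀ i, Integrable (F i) (volume.restrict (Ioi 1)) := fun i =>
    (integral_posLog_mul_cpow (hb i) hs0).1.const_mul _
  have hJn : IntegrableOn (fun r : ℝ => J r * r ^ (-s.re - 1)) (Ioi 1) := by
    have h1 := (main s hs hE').1.norm
    refine IntegrableOn.congr_fun h1 (fun r hr => ?_) measurableSet_Ioi
    have hJ0 : 0 ≤ J r := (hJ r hr).nonneg fun i => mul_nonneg (hm i) Real.posLog_nonneg
    rw [norm_mul, norm_cpow_eq_rpow_re_of_pos (zero_lt_one.trans hr), norm_real,
      Real.norm_of_nonneg hJ0]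
    simp
  have hsum : Summable fun i => ∫ r in Ioi (1 : ℝ), ‖F i r‖ := by
    refine summable_of_sum_le (c := ∫ r in Ioi (1 : ℝ), J r * r ^ (-s.re - 1))
      (fun i => integral_nonneg fun r => norm_nonneg _) fun u => ?_
    rw [← integral_finsetSum u fun i _ => (hFi i).norm]
    refine setIntegral_mono_on (integrable_finsetSum u fun i _ => (hFi i).norm) hJn
      measurableSet_Ioi fun r hr => ?_
    have hn : ∀ i, ‖F i r‖ = m i * Real.posLog (r / b i) * r ^ (-s.re - 1) := fun i => by
      rw [hF, norm_mul, norm_mul, norm_cpow_eq_rpow_re_of_pos (zero_lt_one.trans hr), norm_real,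
        norm_real, Real.norm_of_nonneg (hm i), Real.norm_of_nonneg Real.posLog_nonneg]
      simp [mul_assoc]
    simp only [hn]
    rw [← Finset.sum_mul]
    refine mul_le_mul_of_nonneg_right (sum_le_hasSum u
      (fun i _ => mul_nonneg (hm i) Real.posLog_nonneg) (hJ r hr)) ?_
    exact Real.rpow_nonneg (zero_lt_one.trans hr).le _
  have key := (hasSum_integral_of_summable_integral_norm hFi hsum).mul_left (s ^ 2)
  have hv : ∀ i, s ^ 2 * ∫ r in Ioi (1 : ℝ), F i r = (m i : ℂ) * (b i : ℂ) ^ (-s) := fun i => by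
    simp only [hF]
    rw [integral_const_mul, (integral_posLog_mul_cpow (hb i) hs0).2]
    field_simp
  have hT : ∫ r in Ioi (1 : ℝ), ∑' i, F i r =
      ∫ r in Ioi (1 : ℝ), (J r : ℂ) * (r : ℂ) ^ (-s - 1) := by
    refine setIntegral_congr_fun measurableSet_Ioi fun r hr => ?_
    have h1 := (Complex.hasSum_ofReal.2 (hJ r hr)).mul_right ((r : ℂ) ^ (-s - 1))
    simp only [hF]
    convert! h1.tsum_eq using 3 with i
    push_cast
    ring
  simp only [hv] at key
  rw [hT, (main s hs hE').2] at key
  convert! key using 1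
  field_simp

lemma norm_cpow_sub_cpow_le {a b K : ℝ} (ha : 0 < a) (hb : 1 ≤ b)
    (hab : |Real.log a - Real.log b| ≤ K / b ^ 2) (s : ℂ) :
    ‖(a : ℂ) ^ (-s) - (b : ℂ) ^ (-s)‖ ≤
      ‖s‖ * (K * Real.exp (|s.re| * K)) * b ^ (-(s.re + 2)) := by
  have hb0 : 0 < b := by linarith
  have hK : 0 ≤ K := by
    have := (abs_nonneg _).trans hab
    by_contra h
    exact absurd this (not_le.2 (div_neg_of_neg_of_pos (not_le.1 h) (by positivity)))
  have hexp : ∀ x : ℝ, 0 < x → (x : ℂ) ^ (-s) = Complex.exp ((Real.log x : ℂ) * (-s)) := by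
    intro x hx
    rw [cpow_def_of_ne_zero (ofReal_ne_zero.2 hx.ne'), ofReal_log hx.le]
  rw [hexp a ha, hexp b hb0]
  have hd : ∀ u ∈ uIcc (Real.log b) (Real.log a), HasDerivWithinAt
      (fun u : ℝ => Complex.exp ((u : ℂ) * (-s))) (Complex.exp ((u : ℂ) * (-s)) * (1 * -s))
      (uIcc (Real.log b) (Real.log a)) u := fun u _ =>
    ((((hasDerivAt_id u).ofReal_comp).mul_const (-s)).cexp).hasDerivWithinAt
  have hKb : K / b ^ 2 ≤ K := div_le_self hK (one_le_pow₀ hb)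
  have hbd : ∀ u ∈ uIcc (Real.log b) (Real.log a),
      ‖Complex.exp ((u : ℂ) * (-s)) * (1 * -s)‖ ≤ ‖s‖ * Real.exp (|s.re| * K) * b ^ (-s.re) := by
    intro u hu
    have h1 : |u - Real.log b| ≤ K := by
      refine le_trans ?_ (hab.trans hKb)
      rw [abs_sub_comm u]
      have := abs_sub_right_of_mem_uIcc hu
      have := abs_sub_left_of_mem_uIcc hu
      rwa [abs_sub_comm (Real.log b)]
    rw [one_mul, norm_mul, norm_neg, Complex.norm_exp, Real.rpow_def_of_pos hb0, mul_assoc,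
      ← Real.exp_add, mul_comm]
    refine mul_le_mul_of_nonneg_left (Real.exp_le_exp.2 ?_) (norm_nonneg _)
    simp only [mul_re, neg_re, ofReal_re, ofReal_im, zero_mul, sub_zero]
    have h2 : -s.re * (u - Real.log b) ≤ |s.re| * K := by
      refine (le_abs_self _).trans ?_
      rw [abs_mul, abs_neg]
      gcongr
    linarith
  have := (convex_uIcc (Real.log b) (Real.log a)).norm_image_sub_le_of_norm_hasDerivWithin_le hd hbd
    left_mem_uIcc right_mem_uIcc
  refine this.trans ?_
  rw [Real.norm_eq_abs]
  calc ‖s‖ * Real.exp (|s.re| * K) * b ^ (-s.re) * |Real.log a - Real.log b|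
      ≤ ‖s‖ * Real.exp (|s.re| * K) * b ^ (-s.re) * (K / b ^ 2) := by gcongr
    _ = _ := by
      rw [neg_add, Real.rpow_add hb0, Real.rpow_neg hb0.le 2]
      norm_cast
      field_simp

/-- Meromorphic continuation of `∑ m a ^ (-s)` when `a` is a small perturbation of a sequence `b`
whose logarithmic counting function has a good asymptotic expansion. -/
theorem exists_continuation_of_posLog {ι : Type*} [Countable ι] {m a b : ι → ℝ}
    (hm : ∀ i, 0 ≤ m i) (ha : ∀ i, 0 < a i) (hb : ∀ i, 1 ≤ b i) {K : ℝ}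
    (hK : 0 ≤ K) (hab : ∀ i, |Real.log (a i) - Real.log (b i)| ≤ K / b i ^ 2)
    {J E : ℝ → ℝ} {A B C D : ℝ}
    (hJ : ∀ r, 1 < r → HasSum (fun i => m i * Real.posLog (r / b i)) (J r))
    (hJE : ∀ r, 1 < r → J r = A * (r * Real.log r) + B * r + C * Real.log r + D + E r)
    (hE : ∀ ε : ℝ, 0 < ε → IntegrableOn (fun r : ℝ => E r * r ^ (-ε)) (Ioi 1)) :
    ∃ V : ℂ → ℂ, V 1 = A ∧ (∀ s : ℂ, -1 < s.re → DifferentiableAt ℂ V s) ∧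
      (∀ δ : ℝ, 0 < δ → ∃ (C : ℝ) (N : ℕ), ∀ s : ℂ, -1 + δ ≤ s.re → s.re ≤ 2 →
        ‖V s‖ ≤ C * (1 + ‖s‖) ^ N) ∧
      ∀ s : ℂ, 1 < s.re →
        HasSum (fun i => (m i : ℂ) * (a i : ℂ) ^ (-s)) (V s / (s - 1) ^ 2) := by
  have hE' : ∀ σ : ℝ, -1 < σ →
      IntegrableOn (fun r : ℝ => (E r : ℂ) * (r : ℂ) ^ (-(σ : ℂ) - 1)) (Ioi 1) := by
    intro σ hσ
    refine IntegrableOn.congr_fun (hE (σ + 1) (by linarith)).ofReal (fun r hr => ?_)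
      measurableSet_Ioi
    have : (-(σ : ℂ) - 1) = ((-(σ + 1) : ℝ) : ℂ) := by push_cast; ring
    rw [this, ← ofReal_cpow (zero_lt_one.trans hr).le]
    simp
  set G : ℂ → ℂ := fun s => ∫ r in Ioi (1 : ℝ), (E r : ℂ) * (r : ℂ) ^ (-s - 1) with hG
  set H : ℂ → ℂ := fun s => ∑' i, (m i : ℂ) * ((a i : ℂ) ^ (-s) - (b i : ℂ) ^ (-s)) with hH
  have hbs : ∀ σ : ℝ, 1 < σ → Summable fun i => m i * b i ^ (-σ) := by
    intro σ hσ
    have h1 := (hasSum_mul_cpow_of_posLog hm hb hJ hJE hE'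
      (s := (σ : ℂ)) (by simpa using hσ)).summable.norm
    refine h1.congr fun i => ?_
    rw [norm_mul, norm_cpow_eq_rpow_re_of_pos (by linarith [hb i]), norm_real,
      Real.norm_of_nonneg (hm i)]
    simp
  have hterm : ∀ (δ M : ℝ), 0 < δ → ∃ L : ℝ, 0 ≤ L ∧ ∀ i (s : ℂ), -1 + δ ≤ s.re → ‖s‖ ≤ M →
      ‖(m i : ℂ) * ((a i : ℂ) ^ (-s) - (b i : ℂ) ^ (-s))‖ ≤ L * (m i * b i ^ (-(1 + δ))) := by
    intro δ M hδ
    refine ⟨|M| * (K * Real.exp (|M| * K)), by positivity, fun i s hs hM => ?_⟩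
    have h1 := norm_cpow_sub_cpow_le (ha i) (hb i) (hab i) s
    rw [norm_mul, norm_real, Real.norm_of_nonneg (hm i), mul_left_comm]
    refine mul_le_mul_of_nonneg_left (h1.trans ?_) (hm i)
    have hbi := hb i
    have hM' : ‖s‖ ≤ |M| := hM.trans (le_abs_self _)
    have hre : |s.re| ≤ |M| := (abs_re_le_norm s).trans hM'
    have hp : b i ^ (-(s.re + 2)) ≤ b i ^ (-(1 + δ)) :=
      Real.rpow_le_rpow_of_exponent_le hbi (by linarith)
    have hbp : 0 ≤ b i ^ (-(s.re + 2)) := Real.rpow_nonneg (by linarith) _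
    gcongr
  have hHd : ∀ s : ℂ, -1 < s.re → DifferentiableAt ℂ H s := by
    intro s hs
    set δ := (s.re + 1) / 2 with hδ
    have hδ0 : 0 < δ := by rw [hδ]; linarith
    obtain ⟨L, hL0, hL⟩ := hterm δ (‖s‖ + 1) hδ0
    set U : Set ℂ := {z | -1 + δ < z.re} ∩ Metric.ball 0 (‖s‖ + 1) with hU
    have hUo : IsOpen U := (isOpen_lt continuous_const continuous_re).inter Metric.isOpen_ball
    have hsU : s ∈ U := ⟨by change -1 + δ < s.re; rw [hδ]; linarith, by simp⟩
    refine (differentiableOn_tsum_of_summable_norm ((hbs (1 + δ) (by linarith)).mul_left L)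
      (fun i => ?_) hUo (fun i z hz => ?_) s hsU).differentiableAt (hUo.mem_nhds hsU)
    · have h1 : (a i : ℂ) ≠ 0 := ofReal_ne_zero.2 (ha i).ne'
      have h2 : (b i : ℂ) ≠ 0 := ofReal_ne_zero.2 (by linarith [hb i])
      refine (Differentiable.const_mul (Differentiable.sub ?_ ?_) _).differentiableOn
      · exact Differentiable.const_cpow (by fun_prop) (Or.inl h1)
      · exact Differentiable.const_cpow (by fun_prop) (Or.inl h2)
    · refine hL i z hz.1.le ?_
      have := hz.2
      rw [mem_ball_zero_iff] at this
      exact this.le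
  have hGd : ∀ s : ℂ, -1 < s.re → DifferentiableAt ℂ G s := fun s hs =>
    differentiableAt_integral_Ioi_one hE' hs
  refine ⟨fun s => A * s ^ 2 + B * s ^ 2 * (s - 1) +
    (s - 1) ^ 2 * (C + D * s + s ^ 2 * G s + H s), by simp, ?_, ?_, ?_⟩
  · intro s hs
    have := hGd s hs
    have := hHd s hs
    fun_prop
  · intro δ hδ
    set MG := ∫ r in Ioi (1 : ℝ), ‖(E r : ℂ) * (r : ℂ) ^ (-((-1 + δ : ℝ) : ℂ) - 1)‖ with hMG
    set MH := ∑' i, (K * Real.exp (2 * K + K)) * (m i * b i ^ (-(1 + δ))) with hMH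
    have hH : ∀ s : ℂ, -1 + δ ≤ s.re → s.re ≤ 2 → ‖H s‖ ≤ ‖s‖ * |MH| := by
      intro s h1 h2
      have hle : ∀ i, ‖(m i : ℂ) * ((a i : ℂ) ^ (-s) - (b i : ℂ) ^ (-s))‖ ≤
          ‖s‖ * ((K * Real.exp (2 * K + K)) * (m i * b i ^ (-(1 + δ)))) := by
        intro i
        have hbi := hb i
        have h3 := norm_cpow_sub_cpow_le (ha i) (hb i) (hab i) s
        have hre : |s.re| ≤ 2 := abs_le.2 ⟨by linarith, h2⟩
        rw [norm_mul, norm_real, Real.norm_of_nonneg (hm i)]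
        have hp : b i ^ (-(s.re + 2)) ≤ b i ^ (-(1 + δ)) :=
          Real.rpow_le_rpow_of_exponent_le hbi (by linarith)
        have hbp : 0 ≤ b i ^ (-(s.re + 2)) := Real.rpow_nonneg (by linarith) _
        have he : |s.re| * K ≤ 2 * K + K := by nlinarith
        calc _ ≤ m i * (‖s‖ * (K * Real.exp (|s.re| * K)) * b i ^ (-(s.re + 2))) :=
              mul_le_mul_of_nonneg_left h3 (hm i)
          _ ≤ m i * (‖s‖ * (K * Real.exp (2 * K + K)) * b i ^ (-(1 + δ))) := by
              have := hm i
              gcongr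
          _ = _ := by ring
      have hs := (hbs (1 + δ) (by linarith)).mul_left (K * Real.exp (2 * K + K))
      have h4 := tsum_of_norm_bounded (hs.hasSum.mul_left ‖s‖) hle
      exact h4.trans (mul_le_mul_of_nonneg_left (le_abs_self _) (norm_nonneg _))
    have hG' : ∀ s : ℂ, -1 + δ ≤ s.re → ‖G s‖ ≤ |MG| := fun s h1 =>
      (norm_integral_Ioi_one_le (hE' (-1 + δ) (by linarith)) h1).trans (le_abs_self _)
    refine ⟨|A| + |B| + (|C| + |D| + |MG| + |MH|), 4, fun s h1 h2 => ?_⟩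
    set t := 1 + ‖s‖ with ht
    have hs := norm_nonneg s
    have h3 : ‖s‖ ≤ t := by linarith
    have ht1 : 1 ≤ t := by linarith
    have h4 : ‖s - 1‖ ≤ t := by
      refine (norm_sub_le _ _).trans ?_
      rw [norm_one]; linarith
    have p1 : t ≤ t ^ 4 := le_self_pow₀ ht1 (by norm_num)
    have p24 : t ^ 2 ≤ t ^ 4 := pow_le_pow_right₀ ht1 (by norm_num)
    have p34 : t ^ 3 ≤ t ^ 4 := pow_le_pow_right₀ ht1 (by norm_num)
    have t1 : ‖(A : ℂ) * s ^ 2‖ ≤ |A| * t ^ 4 := by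
      rw [norm_mul, norm_pow, norm_real, Real.norm_eq_abs]
      calc |A| * ‖s‖ ^ 2 ≤ |A| * t ^ 2 := by gcongr
        _ ≤ _ := by gcongr
    have t2 : ‖(B : ℂ) * s ^ 2 * (s - 1)‖ ≤ |B| * t ^ 4 := by
      rw [norm_mul, norm_mul, norm_pow, norm_real, Real.norm_eq_abs]
      calc |B| * ‖s‖ ^ 2 * ‖s - 1‖ ≤ |B| * t ^ 2 * t := by gcongr
        _ = |B| * t ^ 3 := by ring
        _ ≤ _ := by gcongr
    have t3 : ‖(C : ℂ) + D * s + s ^ 2 * G s + H s‖ ≤ (|C| + |D| + |MG| + |MH|) * t ^ 2 := by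
      have q1 : t ≤ t ^ 2 := le_self_pow₀ ht1 (by norm_num)
      have q0 : 1 ≤ t ^ 2 := one_le_pow₀ ht1
      have u1 : ‖(C : ℂ)‖ ≤ |C| * t ^ 2 := by
        rw [norm_real, Real.norm_eq_abs]; exact le_mul_of_one_le_right (abs_nonneg _) q0
      have u2 : ‖(D : ℂ) * s‖ ≤ |D| * t ^ 2 := by
        rw [norm_mul, norm_real, Real.norm_eq_abs]; gcongr; linarith
      have u3 : ‖s ^ 2 * G s‖ ≤ |MG| * t ^ 2 := by
        rw [norm_mul, norm_pow, mul_comm]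
        gcongr
        exact hG' s h1
      have u4 : ‖H s‖ ≤ |MH| * t ^ 2 := by
        refine (hH s h1 h2).trans ?_
        rw [mul_comm]; gcongr; linarith
      have := norm_add₃_le (a := (C : ℂ)) (b := D * s) (c := s ^ 2 * G s)
      have := norm_add_le ((C : ℂ) + D * s + s ^ 2 * G s) (H s)
      linarith
    have t4 : ‖(s - 1) ^ 2 * ((C : ℂ) + D * s + s ^ 2 * G s + H s)‖ ≤
        (|C| + |D| + |MG| + |MH|) * t ^ 4 := by
      rw [norm_mul, norm_pow]
      calc _ ≤ t ^ 2 * ((|C| + |D| + |MG| + |MH|) * t ^ 2) := by gcongr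
        _ = _ := by ring
    have := norm_add₃_le (a := (A : ℂ) * s ^ 2) (b := B * s ^ 2 * (s - 1))
      (c := (s - 1) ^ 2 * ((C : ℂ) + D * s + s ^ 2 * G s + H s))
    linarith
  · intro s hs
    have hs1 : s - 1 ≠ 0 := by
      intro h; rw [sub_eq_zero.1 h] at hs; simp at hs
    have h1 := hasSum_mul_cpow_of_posLog hm hb hJ hJE hE' hs
    obtain ⟨L, hL0, hL⟩ := hterm 1 ‖s‖ one_pos
    have h2 : HasSum (fun i => (m i : ℂ) * ((a i : ℂ) ^ (-s) - (b i : ℂ) ^ (-s))) (H s) :=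
      (Summable.of_norm_bounded ((hbs (1 + 1) (by norm_num)).mul_left L)
        fun i => hL i s (by linarith) le_rfl).hasSum
    have h3 := h1.add h2
    convert! h3 using 1
    · ext i; ring
    · field_simp
      ring

lemma log_mul_of_re {x y : ℂ} (hx : 0 ≤ x.re) (hx0 : x ≠ 0) (hy : 0 < y.re) :
    Complex.log (x * y) = Complex.log x + Complex.log y := by
  refine Complex.log_mul hx0 (by rintro rfl; simp at hy) ?_
  have h1 := abs_le.1 (abs_arg_le_pi_div_two_iff.2 hx)
  have h2 := abs_lt.1 (abs_arg_lt_pi_div_two_iff.2 (Or.inl hy))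
  constructor <;> linarith

/-- The main term `(u - 1/4) log u - u` in Stirling's formula for `log Γ(u + 1/4)`. -/
def stirlingMain (u : ℂ) : ℂ := (u - 1 / 4) * Complex.log u - u

lemma norm_stirlingMain_add_one_sub_le {u : ℂ} (hu : 0 ≤ u.re) (hu2 : 2 ≤ ‖u‖) :
    ‖stirlingMain (u + 1) - stirlingMain u - Complex.log (u + 1 / 4)‖ ≤ 3 / ‖u‖ ^ 2 := by
  have hu0 : u ≠ 0 := norm_pos_iff.1 (by linarith)
  set v := u⁻¹ with hv
  have huv : u * v = 1 := mul_inv_cancel₀ hu0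
  have hvn : ‖v‖ = ‖u‖⁻¹ := norm_inv u
  have hv2 : ‖v‖ ≤ 1 / 2 := by
    rw [hvn, one_div]; exact inv_anti₀ two_pos hu2
  have hvre : 0 ≤ v.re := by rw [hv, inv_re]; exact div_nonneg hu (normSq_nonneg _)
  have e1 : Complex.log (u + 1) = Complex.log u + Complex.log (1 + v) := by
    rw [← log_mul_of_re hu hu0 (by simp; linarith), mul_add, huv, mul_one]
  have e2 : Complex.log (u + 1 / 4) = Complex.log u + Complex.log (1 + v / 4) := by
    have h4 : (v / 4).re = v.re / 4 := div_ofNat_re v 4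
    rw [← log_mul_of_re hu hu0 (by rw [add_re, h4, one_re]; linarith), mul_add, ← mul_div_assoc,
      huv, mul_one]
  have r3 := Complex.norm_log_sub_logTaylor_le 2 (z := v) (by linarith)
  have hT : logTaylor (2 + 1) v = v - v ^ 2 / 2 := by
    simp [Complex.logTaylor_succ, Complex.logTaylor_zero]
    ring
  rw [hT] at r3
  have hv4 : ‖v / 4‖ = ‖v‖ / 4 := by rw [norm_div]; norm_num
  have r2 := Complex.norm_log_one_add_sub_self_le (z := v / 4) (by rw [hv4]; linarith)
  set R3 := Complex.log (1 + v) - (v - v ^ 2 / 2) with hR3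
  set R2 := Complex.log (1 + v / 4) - v / 4 with hR2
  have e : stirlingMain (u + 1) - stirlingMain u - Complex.log (u + 1 / 4) =
      -(3 / 8) * v ^ 2 + (u + 3 / 4) * R3 - R2 := by
    rw [stirlingMain, stirlingMain, e1, e2, hR3, hR2]
    linear_combination (1 - v / 2) * huv
  have hinv1 : (1 - ‖v‖)⁻¹ ≤ 2 := by
    rw [inv_le_comm₀ (by linarith) two_pos]; linarith
  have hinv2 : (1 - ‖v / 4‖)⁻¹ ≤ 2 := by
    rw [inv_le_comm₀ (by rw [hv4]; linarith) two_pos, hv4]; linarith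
  have hvnn := norm_nonneg v
  have b3 : ‖R3‖ ≤ ‖v‖ ^ 3 := by
    refine r3.trans ?_
    norm_num
    have := mul_le_mul_of_nonneg_left hinv1 (by positivity : 0 ≤ ‖v‖ ^ 3)
    nlinarith [pow_nonneg hvnn 3]
  have b2 : ‖R2‖ ≤ ‖v‖ ^ 2 := by
    refine r2.trans ?_
    have := mul_le_mul_of_nonneg_left hinv2 (by positivity : 0 ≤ ‖v / 4‖ ^ 2)
    rw [hv4] at this ⊢
    nlinarith [pow_nonneg hvnn 2]
  have bu : ‖(u + 3 / 4) * R3‖ ≤ 11 / 8 * ‖v‖ ^ 2 := by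
    have h1 : ‖u + 3 / 4‖ ≤ 11 / 8 * ‖u‖ := by
      refine (norm_add_le _ _).trans ?_
      have : ‖(3 / 4 : ℂ)‖ = 3 / 4 := by norm_num
      linarith
    rw [norm_mul]
    have h2 : ‖u‖ * ‖v‖ = 1 := by rw [← norm_mul, huv, norm_one]
    calc ‖u + 3 / 4‖ * ‖R3‖ ≤ (11 / 8 * ‖u‖) * ‖v‖ ^ 3 := by gcongr
      _ = 11 / 8 * ‖v‖ ^ 2 * (‖u‖ * ‖v‖) := by ring
      _ = _ := by rw [h2, mul_one]
  rw [e]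
  have hfirst : ‖-(3 / 8 : ℂ) * v ^ 2‖ = 3 / 8 * ‖v‖ ^ 2 := by
    rw [norm_mul, norm_pow, norm_neg]; norm_num
  have h3 : 3 / ‖u‖ ^ 2 = 3 * ‖v‖ ^ 2 := by rw [hvn, inv_pow, div_eq_mul_inv]
  rw [h3]
  refine (norm_sub_le _ _).trans ?_
  have := norm_add_le (-(3 / 8 : ℂ) * v ^ 2) ((u + 3 / 4) * R3)
  nlinarith [pow_nonneg hvnn 2]

lemma tendsto_log_norm_Gamma_add_nat {z : ℂ} (hz : 0 < z.re) :
    Tendsto (fun n : ℕ => Real.log ‖Complex.Gamma (z + n + 1)‖ -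
      ((z.re + n + 1 / 2) * Real.log n - n)) atTop (nhds (Real.log (2 * π) / 2)) := by
  have hG0 : Complex.Gamma z ≠ 0 := Complex.Gamma_ne_zero_of_re_pos hz
  have hprod : ∀ n : ℕ, Complex.Gamma (z + n + 1) =
      Complex.Gamma z * ∏ j ∈ Finset.range (n + 1), (z + j) := by
    intro n
    induction n with
    | zero =>
      have : z ≠ 0 := by rintro rfl; simp at hz
      simp [Complex.Gamma_add_one z this, mul_comm]
    | succ n ih =>
      have h0 : z + n + 1 ≠ 0 := by
        intro h
        have := congrArg re h
        simp at this
        have : (0 : ℝ) ≤ n := n.cast_nonneg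
        linarith
      rw [Finset.prod_range_succ, ← mul_assoc, ← ih]
      push_cast
      rw [← add_assoc, Complex.Gamma_add_one _ h0]
      ring
  have h1 : Tendsto (fun n : ℕ => Real.log ‖Complex.Gamma z‖ - Real.log ‖Complex.GammaSeq z n‖)
      atTop (nhds 0) := by
    have := ((Complex.GammaSeq_tendsto_Gamma z).norm.log (norm_ne_zero_iff.2 hG0)).const_sub
      (Real.log ‖Complex.Gamma z‖)
    rwa [sub_self] at this
  have hpi : √π ≠ 0 := by positivity
  have h2 := Stirling.tendsto_stirlingSeq_sqrt_pi.log hpi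
  have h3 := (h1.add h2).add_const (Real.log 2 / 2)
  have hlim : (0 : ℝ) + Real.log √π + Real.log 2 / 2 = Real.log (2 * π) / 2 := by
    rw [Real.log_sqrt pi_pos.le, Real.log_mul two_ne_zero pi_pos.ne']; ring
  rw [hlim] at h3
  refine h3.congr' ?_
  filter_upwards [eventually_gt_atTop 0] with n hn
  have hn0 : (0 : ℝ) < n := by exact_mod_cast hn
  have hP : ∏ j ∈ Finset.range (n + 1), (z + j) ≠ 0 := by
    refine Finset.prod_ne_zero_iff.2 fun j _ h => ?_
    have := congrArg re h
    simp at this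
    have : (0 : ℝ) ≤ j := j.cast_nonneg
    linarith
  rw [hprod, norm_mul, Real.log_mul (norm_ne_zero_iff.2 hG0) (norm_ne_zero_iff.2 hP),
    Stirling.log_stirlingSeq_formula, Complex.GammaSeq, norm_div, norm_mul, Complex.norm_natCast,
    ← ofReal_natCast, norm_cpow_eq_rpow_re_of_pos hn0,
    Real.log_div (by positivity) (norm_ne_zero_iff.2 hP), Real.log_mul (by positivity)
    (by positivity), Real.log_rpow hn0, Real.log_mul two_ne_zero hn0.ne',
    Real.log_div hn0.ne' (Real.exp_pos 1).ne', Real.log_exp]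
  ring

lemma tendsto_stirlingMain_add_nat {u : ℂ} (hu : 0 ≤ u.re) :
    Tendsto (fun n : ℕ => (stirlingMain (u + n + 1)).re -
      ((u.re + 1 / 4 + n + 1 / 2) * Real.log n - n)) atTop (nhds 0) := by
  set ℓ : ℕ → ℂ := fun n => Complex.log (1 + (u + 1) / n) with hℓ
  have hn1 : Tendsto (fun n : ℕ => (n : ℂ) * ℓ n) atTop (nhds (u + 1)) := by
    refine Complex.tendsto_nat_mul_log_one_add_of_tendsto ?_
    refine tendsto_const_nhds.congr' ?_
    filter_upwards [eventually_gt_atTop 0] with n hn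
    have : (n : ℂ) ≠ 0 := by exact_mod_cast hn.ne'
    field_simp
  have hinv : Tendsto (fun n : ℕ => ((n : ℂ))⁻¹) atTop (nhds 0) := tendsto_inv_atTop_nhds_zero_nat
  have h0 : Tendsto ℓ atTop (nhds 0) := by
    have := hn1.mul hinv
    rw [mul_zero] at this
    refine this.congr' ?_
    filter_upwards [eventually_gt_atTop 0] with n hn
    have : (n : ℂ) ≠ 0 := by exact_mod_cast hn.ne'
    field_simp
  have key : Tendsto (fun n : ℕ => (n : ℂ) * ℓ n + (u + 3 / 4) * ℓ n - u - 1) atTop (nhds 0) := by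
    have := ((hn1.add (h0.const_mul (u + 3 / 4))).sub_const u).sub_const 1
    simpa using this
  have key2 := (Complex.continuous_re.tendsto 0).comp key
  rw [zero_re] at key2
  refine key2.congr' ?_
  filter_upwards [eventually_gt_atTop 0] with n hn
  have hnr : (0 : ℝ) < n := by exact_mod_cast hn
  have hn0 : (n : ℂ) ≠ 0 := by exact_mod_cast hn.ne'
  have e : Complex.log (u + n + 1) = (Real.log n : ℂ) + ℓ n := by
    have h1 : u + n + 1 = (n : ℂ) * (1 + (u + 1) / n) := by field_simp; ring
    have h2 : 0 < (1 + (u + 1) / (n : ℂ)).re := by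
      have : ((u + 1) / (n : ℂ)).re = (u.re + 1) / n := by
        rw [div_natCast_re]; simp
      rw [add_re, this, one_re]
      positivity
    rw [h1, log_mul_of_re (by simp) hn0 h2, ofReal_log hnr.le, ofReal_natCast]
  have e2 : stirlingMain (u + n + 1) = ((n : ℂ) * ℓ n + (u + 3 / 4) * ℓ n - u - 1) +
      ((u + 3 / 4 + n) * (Real.log n : ℂ) - n) := by
    rw [stirlingMain, e]; ring
  have e3 : ((u + 3 / 4 + n) * (Real.log n : ℂ) - n).re =
      (u.re + 1 / 4 + n + 1 / 2) * Real.log n - n := by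
    rw [sub_re, re_mul_ofReal, natCast_re]
    have h34 : (3 / 4 : ℂ).re = 3 / 4 := by norm_num
    rw [add_re, add_re, natCast_re, h34]
    ring
  rw [e2, add_re, e3]
  simp

/-- Stirling's formula for `|Γ(u + 1/4)|` in the right half-plane. -/
theorem abs_log_norm_Gamma_sub_le {u : ℂ} (hu : 0 ≤ u.re) (hu2 : 2 ≤ ‖u‖) :
    |Real.log ‖Complex.Gamma (u + 1 / 4)‖ - (stirlingMain u).re - Real.log (2 * π) / 2| ≤
      12 / ‖u‖ := by
  set Δ : ℂ → ℝ := fun u => Real.log ‖Complex.Gamma (u + 1 / 4)‖ - (stirlingMain u).re with hΔ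
  have hlow : ∀ n : ℕ, ‖u‖ ^ 2 + (n : ℝ) ^ 2 ≤ ‖u + n‖ ^ 2 := by
    intro n
    rw [← normSq_eq_norm_sq, ← normSq_eq_norm_sq, normSq_apply, normSq_apply]
    simp
    nlinarith [mul_nonneg hu (n.cast_nonneg : (0 : ℝ) ≤ n)]
  have hstep : ∀ n : ℕ, |Δ (u + n) - Δ (u + (n + 1 : ℕ))| ≤
      6 * (1 / (‖u‖ + n - 1) - 1 / (‖u‖ + (n + 1 : ℕ) - 1)) := by
    intro n
    have hn0 : (0 : ℝ) ≤ n := n.cast_nonneg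
    have hre : 0 ≤ (u + n).re := by simp; linarith
    have hn2 : 2 ≤ ‖u + n‖ := by
      have := hlow n
      nlinarith [norm_nonneg (u + n)]
    have hb := norm_stirlingMain_add_one_sub_le hre hn2
    have hz0 : u + n + 1 / 4 ≠ 0 := by
      intro h
      have := congrArg re h
      norm_num at this
      linarith
    have hG : Real.log ‖Complex.Gamma (u + (n + 1 : ℕ) + 1 / 4)‖ =
        Real.log ‖u + n + 1 / 4‖ + Real.log ‖Complex.Gamma (u + n + 1 / 4)‖ := by
      have : u + (n + 1 : ℕ) + 1 / 4 = (u + n + 1 / 4) + 1 := by push_cast; ring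
      rw [this, Complex.Gamma_add_one _ hz0, norm_mul, Real.log_mul (norm_ne_zero_iff.2 hz0)]
      refine norm_ne_zero_iff.2 (Complex.Gamma_ne_zero_of_re_pos ?_)
      norm_num
      linarith
    have hE : Δ (u + n) - Δ (u + (n + 1 : ℕ)) =
        (stirlingMain (u + n + 1) - stirlingMain (u + n) - Complex.log (u + n + 1 / 4)).re := by
      simp only [hΔ, hG, sub_re, Complex.log_re]
      push_cast
      rw [add_assoc u]
      ring_nf
    rw [hE]
    refine (abs_re_le_norm _).trans (hb.trans ?_)
    have hx : 0 < ‖u‖ + n - 1 := by linarith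
    have hx1 : 0 < ‖u‖ + n := by linarith
    push_cast
    have : 6 * (1 / (‖u‖ + n - 1) - 1 / (‖u‖ + (n + 1) - 1)) =
        6 / ((‖u‖ + n - 1) * (‖u‖ + n)) := by
      have e : ‖u‖ + ((n : ℝ) + 1) - 1 = ‖u‖ + n := by ring
      rw [e]
      field_simp
      ring
    rw [this, div_le_div_iff₀ (by positivity) (by positivity)]
    nlinarith [hlow n, sq_nonneg (‖u‖ - n)]
  have hsum : ∀ n : ℕ, |Δ u - Δ (u + n)| ≤ 6 * (1 / (‖u‖ - 1) - 1 / (‖u‖ + n - 1)) := by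
    intro n
    induction n with
    | zero => simp
    | succ n ih =>
      have := abs_sub_le (Δ u) (Δ (u + n)) (Δ (u + (n + 1 : ℕ)))
      have := hstep n
      linarith
  have hsum' : ∀ n : ℕ, |Δ u - Δ (u + n)| ≤ 12 / ‖u‖ := by
    intro n
    have hn0 : (0 : ℝ) ≤ n := n.cast_nonneg
    have h1 : 0 ≤ 1 / (‖u‖ + n - 1) := by
      apply one_div_nonneg.2; linarith
    have h2 : 6 * (1 / (‖u‖ - 1)) ≤ 12 / ‖u‖ := by
      rw [mul_one_div, div_le_div_iff₀ (by linarith) (by linarith)]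
      linarith
    linarith [hsum n]
  have hlim : Tendsto (fun n : ℕ => Δ (u + (n + 1 : ℕ))) atTop (nhds (Real.log (2 * π) / 2)) := by
    have h1 := tendsto_log_norm_Gamma_add_nat (z := u + 1 / 4) (by norm_num; linarith)
    have h2 := h1.sub (tendsto_stirlingMain_add_nat hu)
    rw [sub_zero] at h2
    refine h2.congr fun n => ?_
    have e : (u + 1 / 4).re = u.re + 1 / 4 := by norm_num
    have e1 : u + (n + 1 : ℕ) + 1 / 4 = u + 1 / 4 + n + 1 := by push_cast; ring
    have e2 : u + (n + 1 : ℕ) = u + n + 1 := by push_cast; ring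
    simp only [hΔ, e, e1]
    rw [e2]
    ring
  exact le_of_tendsto ((hlim.const_sub (Δ u)).abs) (Eventually.of_forall fun n => hsum' (n + 1))

/-- The fractional part, restricted to `(1, ∞)`. -/
def fractTail : ℝ → ℂ := (Ioi 1).indicator fun t => ((Int.fract t : ℝ) : ℂ)

lemma norm_fractTail_le (t : ℝ) : ‖fractTail t‖ ≤ 1 := by
  rw [fractTail]
  refine (norm_indicator_le_norm_self _ _).trans ?_
  rw [norm_real, Real.norm_of_nonneg (Int.fract_nonneg t)]
  exact (Int.fract_lt_one t).le

lemma measurable_fractTail : Measurable fractTail :=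
  (measurable_ofReal.comp measurable_fract).indicator measurableSet_Ioi

lemma locallyIntegrableOn_fractTail : LocallyIntegrableOn fractTail (Ioi 0) := by
  refine LocallyIntegrable.locallyIntegrableOn ?_ _
  refine (locallyIntegrable_const (1 : ℝ)).mono measurable_fractTail.aestronglyMeasurable ?_
  exact Eventually.of_forall fun t => by simpa using norm_fractTail_le t

lemma fractTail_isBigO_atTop : fractTail =O[atTop] (fun t : ℝ => t ^ (-(0 : ℝ))) := by
  refine Asymptotics.IsBigO.of_bound 1 (Eventually.of_forall fun t => ?_)
  simpa using norm_fractTail_le t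

lemma fractTail_isBigO_zero (b : ℝ) :
    fractTail =O[nhdsWithin 0 (Ioi 0)] (fun t : ℝ => t ^ (-b)) := by
  refine Asymptotics.IsBigO.of_bound 1 ?_
  filter_upwards [Ioo_mem_nhdsGT zero_lt_one] with t ht
  rw [fractTail, indicator_of_notMem (by simpa using ht.2.le), norm_zero]
  positivity

lemma mellin_fractTail_neg (s : ℂ) :
    mellin fractTail (-s) = ∫ t in Ioi (1 : ℝ), (t : ℂ) ^ (-(s + 1)) * ((Int.fract t : ℝ) : ℂ) := by
  have h : ∀ t : ℝ, (t : ℂ) ^ (-s - 1) • fractTail t =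
      (Ioi (1 : ℝ)).indicator (fun t => (t : ℂ) ^ (-(s + 1)) * ((Int.fract t : ℝ) : ℂ)) t := by
    intro t
    by_cases ht : t ∈ Ioi (1 : ℝ)
    · rw [fractTail, indicator_of_mem ht, indicator_of_mem ht, smul_eq_mul, neg_add']
    · rw [fractTail, indicator_of_notMem ht, indicator_of_notMem ht, smul_zero]
  rw [mellin]
  simp_rw [h]
  rw [setIntegral_indicator measurableSet_Ioi,
    inter_eq_right.2 (Ioi_subset_Ioi zero_le_one)]

lemma norm_mellin_fractTail_neg_le {s : ℂ} (hs : 0 < s.re) :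
    ‖mellin fractTail (-s)‖ ≤ 1 / s.re := by
  rw [mellin_fractTail_neg]
  have hIntegrable := integral_Ioi_rpow_of_lt (a := -(s.re + 1)) (by linarith) one_pos
  have h1 : ∫ t in Ioi (1 : ℝ), t ^ (-(s.re + 1)) = 1 / s.re := by
    rw [hIntegrable, Real.one_rpow, show -(s.re + 1) + 1 = -s.re by ring, neg_div_neg_eq]
  rw [← h1]
  refine norm_integral_le_of_norm_le (integrableOn_Ioi_rpow_of_lt (by linarith) one_pos) ?_
  refine (ae_restrict_iff' measurableSet_Ioi).2 (Eventually.of_forall fun t ht => ?_)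
  have ht0 : (0 : ℝ) < t := zero_lt_one.trans ht
  rw [norm_mul, norm_cpow_eq_rpow_re_of_pos ht0, norm_real,
    Real.norm_of_nonneg (Int.fract_nonneg t)]
  simp only [neg_re, add_re, one_re]
  exact mul_le_of_le_one_right (by positivity) (Int.fract_lt_one t).le

lemma riemannZeta₁_eq_mul (s : ℂ) (hs : s ≠ 1) : riemannZeta₁ s = (s - 1) * riemannZeta s := by
  rw [riemannZeta_eq_inv_sub_mul hs, mul_inv_cancel_left₀ (sub_ne_zero.2 hs)]

lemma riemannZeta₁_eq_of_one_lt_re {s : ℂ} (hs : 1 < s.re) :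
    riemannZeta₁ s = s - s * (s - 1) * mellin fractTail (-s) := by
  have hs1 : s ≠ 1 := by rintro rfl; simp at hs
  have hs1' : s - 1 ≠ 0 := sub_ne_zero.2 hs1
  have hs0 : s ≠ 0 := by rintro rfl; simp at hs; linarith
  have h := LSeries_eq_mul_integral_of_nonneg (fun _ => 1) zero_le_one hs
    (by
      refine Asymptotics.IsBigO.of_bound 1 (Eventually.of_forall fun n => ?_)
      simp) (fun _ => zero_le_one)
  have hz : LSeries (fun _ => ((1 : ℝ) : ℂ)) s = riemannZeta s := by
    rw [← LSeries_one_eq_riemannZeta hs]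
    congr 1
  rw [hz] at h
  have hc : IntegrableOn (fun t : ℝ => (t : ℂ) ^ (-s)) (Ioi 1) :=
    integrableOn_Ioi_cpow_of_lt (by simpa using hs) one_pos
  have hI : ∫ t in Ioi (1 : ℝ), (t : ℂ) ^ (-s) = 1 / (s - 1) := by
    rw [integral_Ioi_cpow_of_lt (by simpa using hs) one_pos, ofReal_one, one_cpow,
      show -s + 1 = -(s - 1) by ring, neg_div_neg_eq]
  have hf : IntegrableOn (fun t : ℝ => (t : ℂ) ^ (-(s + 1)) * ((Int.fract t : ℝ) : ℂ)) (Ioi 1) := by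
    have := (integrableOn_Ioi_rpow_of_lt (a := -(s.re + 1)) (by linarith) one_pos)
    refine Integrable.mono' this ?_ ?_
    · refine ContinuousOn.aestronglyMeasurable (fun t ht => ?_) measurableSet_Ioi |>.mul
        (measurable_ofReal.comp measurable_fract).aestronglyMeasurable
      have ht0 : (0 : ℝ) < t := zero_lt_one.trans ht
      exact (continuousAt_ofReal_cpow_const _ _ (Or.inr ht0.ne')).continuousWithinAt
    · refine (ae_restrict_iff' measurableSet_Ioi).2 (Eventually.of_forall fun t ht => ?_)
      have ht0 : (0 : ℝ) < t := zero_lt_one.trans ht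
      rw [norm_mul, norm_cpow_eq_rpow_re_of_pos ht0, norm_real,
        Real.norm_of_nonneg (Int.fract_nonneg t)]
      simp only [neg_re, add_re, one_re]
      exact mul_le_of_le_one_right (by positivity) (Int.fract_lt_one t).le
  have h2 : ∫ t in Ioi (1 : ℝ), (∑ k ∈ Finset.Icc 1 ⌊t⌋₊, ((1 : ℝ) : ℂ)) * (t : ℂ) ^ (-(s + 1)) =
      1 / (s - 1) - mellin fractTail (-s) := by
    rw [mellin_fractTail_neg, ← hI, ← integral_sub hc hf]
    refine setIntegral_congr_fun measurableSet_Ioi fun t ht => ?_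
    have ht0 : (0 : ℝ) < t := zero_lt_one.trans ht
    have htc : (t : ℂ) ≠ 0 := by exact_mod_cast ht0.ne'
    have hfl : ((⌊t⌋₊ : ℝ) : ℂ) = (t : ℂ) - ((Int.fract t : ℝ) : ℂ) := by
      rw [natCast_floor_eq_intCast_floor ht0.le, Int.fract]
      push_cast; ring
    have hpow : (t : ℂ) ^ (-s) = t * (t : ℂ) ^ (-(s + 1)) := by
      rw [show -s = 1 + -(s + 1) by ring, cpow_add _ _ htc, cpow_one]
    simp only [Finset.sum_const, Nat.card_Icc, add_tsub_cancel_right, nsmul_eq_mul, ofReal_one,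
      mul_one]
    rw [← ofReal_natCast, hfl, hpow]
    ring
  rw [h2] at h
  rw [riemannZeta₁_eq_mul s hs1, h]
  field_simp

lemma riemannZeta₁_eq_of_re_pos {s : ℂ} (hs : 0 < s.re) :
    riemannZeta₁ s = s - s * (s - 1) * mellin fractTail (-s) := by
  set U : Set ℂ := {s | 0 < s.re}
  have hU : IsOpen U := isOpen_lt continuous_const continuous_re
  have hUc : IsPreconnected U := (convex_halfSpace_re_gt 0).isPreconnected
  have hf : AnalyticOnNhd ℂ riemannZeta₁ U :=
    differentiable_riemannZeta₁.differentiableOn.analyticOnNhd hU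
  have hg : AnalyticOnNhd ℂ (fun s => s - s * (s - 1) * mellin fractTail (-s)) U := by
    refine DifferentiableOn.analyticOnNhd (fun s hs => ?_) hU
    have hM : DifferentiableAt ℂ (mellin fractTail) (-s) := by
      refine mellin_differentiableAt_of_isBigO_rpow (a := 0) (b := -s.re - 1)
        locallyIntegrableOn_fractTail fractTail_isBigO_atTop ?_ (fractTail_isBigO_zero _) ?_
      · simpa [U] using hs
      · simp
    have hM' : DifferentiableAt ℂ (fun s => mellin fractTail (-s)) s :=
      hM.comp s differentiableAt_id.neg
    exact ((differentiableAt_id.sub ((differentiableAt_id.mul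
      (differentiableAt_id.sub_const 1)).mul hM'))).differentiableWithinAt
  refine hf.eqOn_of_preconnected_of_eventuallyEq hg hUc (z₀ := 2) (by simp [U]) ?_ hs
  filter_upwards [(isOpen_lt continuous_const continuous_re).mem_nhds
    (show (2 : ℂ) ∈ {s : ℂ | 1 < s.re} by simp)] with s hs using riemannZeta₁_eq_of_one_lt_re hs

lemma norm_riemannZeta₁_le {s : ℂ} (hs : 0 < s.re) :
    ‖riemannZeta₁ s‖ ≤ ‖s‖ + ‖s‖ * (‖s‖ + 1) / s.re := by
  rw [riemannZeta₁_eq_of_re_pos hs]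
  refine (norm_sub_le _ _).trans ?_
  rw [norm_mul, norm_mul, mul_div_assoc, mul_assoc]
  gcongr
  rw [div_eq_mul_one_div]
  gcongr
  · simpa using norm_sub_le s 1
  · exact norm_mellin_fractTail_neg_le hs

lemma norm_riemannZeta_sub_one_le {s : ℂ} (hs : 3 ≤ s.re) :
    ‖riemannZeta s - 1‖ ≤ 4 * (2 : ℝ) ^ (-s.re) := by
  have hsum : HasSum (fun n : ℕ => 1 / ((n : ℂ) + 1) ^ s) (riemannZeta s) := by
    rw [zeta_eq_tsum_one_div_nat_add_one_cpow (by linarith)]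
    refine Summable.hasSum ?_
    have := (Complex.summable_one_div_nat_cpow (p := s)).2 (by linarith)
    simpa using (summable_nat_add_iff 1).2 this
  have h1 : HasSum (fun n : ℕ => 1 / ((n : ℂ) + 2) ^ s) (riemannZeta s - 1) := by
    have := (hasSum_nat_add_iff' 1).2 hsum
    simpa [add_assoc, one_add_one_eq_two] using this
  have h2 : HasSum (fun n : ℕ => 1 / ((n : ℝ) + 2) ^ 2) (π ^ 2 / 6 - 1) := by
    have := (hasSum_nat_add_iff' 2).2 hasSum_zeta_two
    simpa [Finset.sum_range_succ] using this
  have h3 := h2.mul_left ((2 : ℝ) ^ (2 - s.re))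
  rw [← h1.tsum_eq]
  refine (tsum_of_norm_bounded h3 fun n => ?_).trans ?_
  · have hn : (0 : ℝ) < n + 2 := by positivity
    have : ((n : ℂ) + 2) = ((n + 2 : ℝ) : ℂ) := by push_cast; ring
    rw [this, norm_div, norm_one, norm_cpow_eq_rpow_re_of_pos hn, one_div, one_div,
      ← Real.rpow_neg hn.le, ← Real.rpow_two, ← Real.rpow_neg hn.le,
      show -s.re = (2 - s.re) + -2 by ring, Real.rpow_add hn]
    gcongr ?_ * _
    · exact Real.rpow_le_rpow_of_nonpos two_pos (by linarith [(n.cast_nonneg : (0 : ℝ) ≤ n)])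
        (by linarith)
  · rw [show (2 : ℝ) - s.re = 2 + -s.re by ring, Real.rpow_add two_pos, Real.rpow_two]
    have hpi : π ^ 2 / 6 - 1 ≤ 1 := by nlinarith [pi_lt_d2, pi_pos]
    have := Real.rpow_pos_of_pos two_pos (-s.re)
    nlinarith

lemma abs_log_norm_riemannZeta_le {s : ℂ} (hs : 3 ≤ s.re) :
    |Real.log ‖riemannZeta s‖| ≤ 6 * (2 : ℝ) ^ (-s.re) ∧ 1 / 2 ≤ ‖riemannZeta s‖ := by
  have h := norm_riemannZeta_sub_one_le hs
  have h8 : (2 : ℝ) ^ (-s.re) ≤ 1 / 8 := by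
    calc (2 : ℝ) ^ (-s.re) ≤ (2 : ℝ) ^ (-(3 : ℝ)) :=
          Real.rpow_le_rpow_of_exponent_le one_le_two (by linarith)
      _ = 1 / 8 := by rw [Real.rpow_neg two_pos.le]; norm_num
  have hz : ‖riemannZeta s - 1‖ ≤ 1 / 2 := by linarith
  have hl := norm_log_one_add_half_le_self hz
  rw [add_sub_cancel] at hl
  constructor
  · calc |Real.log ‖riemannZeta s‖| = |(Complex.log (riemannZeta s)).re| := by rw [Complex.log_re]
      _ ≤ ‖Complex.log (riemannZeta s)‖ := abs_re_le_norm _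
      _ ≤ _ := by linarith
  · have := norm_sub_norm_le (1 : ℂ) (1 - riemannZeta s)
    rw [norm_one, norm_sub_rev, sub_sub_cancel] at this
    linarith

lemma log_norm_le_circleAverage {f : ℂ → ℂ} (hf : Differentiable ℂ f) {c : ℂ} {r : ℝ}
    (hr : 0 < r) (hc : f c ≠ 0) :
    Real.log ‖f c‖ ≤ circleAverage (fun z => Real.log ‖f z‖) c r := by
  have hA : AnalyticOnNhd ℂ f (Metric.closedBall c |r|) := fun z _ => hf.analyticAt z
  rw [AnalyticOnNhd.circleAverage_log_norm hr.ne' hA hc]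
  refine le_add_of_nonneg_left (finsum_nonneg fun u => ?_)
  by_cases hu : u ∈ Metric.closedBall c |r|
  · refine mul_nonneg (mod_cast (MeromorphicOn.AnalyticOnNhd.divisor_nonneg hA) u) ?_
    rw [abs_of_pos hr, mem_closedBall_iff_norm'] at hu
    rcases eq_or_ne u c with rfl | huc
    · simp
    · have : 0 < ‖c - u‖ := norm_pos_iff.2 (sub_ne_zero.2 huc.symm)
      rw [← div_eq_mul_inv]
      exact Real.log_nonneg ((one_le_div this).2 hu)
  · rw [Function.locallyFinsuppWithin.apply_eq_zero_of_notMem _ hu]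
    simp

lemma circleIntegrable_log_norm_of_differentiable {f : ℂ → ℂ} (hf : Differentiable ℂ f) (c : ℂ)
    (r : ℝ) : CircleIntegrable (fun z => Real.log ‖f z‖) c r :=
  MeromorphicOn.circleIntegrable_log_norm fun z _ => (hf.analyticAt z).meromorphicAt

lemma circleAverage_abs_log_norm_le {f : ℂ → ℂ} (hf : Differentiable ℂ f) {c : ℂ} {r M : ℝ}
    (hr : 0 < r) (hc : 1 ≤ ‖f c‖) (hM1 : 1 ≤ M) (hM : ∀ z ∈ Metric.sphere c r, ‖f z‖ ≤ M) :
    circleAverage (fun z => |Real.log ‖f z‖|) c r ≤ 2 * Real.log M := by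
  have hi := circleIntegrable_log_norm_of_differentiable hf c r
  have hle : circleAverage (fun z => |Real.log ‖f z‖| + Real.log ‖f z‖) c r ≤ 2 * Real.log M := by
    refine circleAverage_mono_on_of_le_circle (hi.abs.add hi) fun z hz => ?_
    rw [abs_of_pos hr] at hz
    have hlog : Real.log ‖f z‖ ≤ Real.log M := by
      rcases (norm_nonneg (f z)).eq_or_lt with h0 | h0
      · rw [← h0, Real.log_zero]; exact Real.log_nonneg hM1
      · exact Real.log_le_log h0 (hM z hz)
    have := Real.log_nonneg hM1
    rcases abs_cases (Real.log ‖f z‖) with ⟨h, _⟩ | ⟨h, _⟩ <;> rw [h] <;> linarith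
  have hia : CircleIntegrable (fun z => |Real.log ‖f z‖|) c r := hi.abs
  rw [circleAverage_fun_add hia hi] at hle
  have h1 := log_norm_le_circleAverage hf hr (norm_pos_iff.1 (by linarith : 0 < ‖f c‖))
  have h2 := Real.log_nonneg hc
  linarith

lemma lintegral_circleMap_eq_circleAverage {g : ℂ → ℝ} {c : ℂ} {r : ℝ} (hg : CircleIntegrable g c r)
    (hg0 : ∀ z, 0 ≤ g z) :
    ∫⁻ θ in Ioo (-π) π, ENNReal.ofReal (g (circleMap c r θ)) =
      ENNReal.ofReal (2 * π * circleAverage g c r) := by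
  have hp : Function.Periodic (fun θ => g (circleMap c r θ)) (2 * π) := fun θ => by
    simp only [periodic_circleMap c r θ]
  have e : ∫ θ in (0)..(2 * π), g (circleMap c r θ) = ∫ θ in (-π)..π, g (circleMap c r θ) := by
    have := hp.intervalIntegral_add_eq 0 (-π)
    rw [zero_add, show -π + 2 * π = π by ring] at this
    exact this
  have hii : IntervalIntegrable (fun θ => g (circleMap c r θ)) volume (-π) π := by
    have : IntervalIntegrable (fun θ => g (circleMap c r θ)) volume 0 (0 + 2 * π) := by
      rw [zero_add]; exact hg
    exact hp.intervalIntegrable (by positivity) this _ _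
  rw [circleAverage_def, smul_eq_mul, mul_inv_cancel_left₀ (by positivity), e,
    intervalIntegral.integral_of_le (by linarith [pi_pos]), ← restrict_Ioo_eq_restrict_Ioc,
    ofReal_integral_eq_lintegral_ofReal]
  · exact ((intervalIntegrable_iff_integrableOn_Ioc_of_le (by linarith [pi_pos])).1 hii).mono_set
      Ioo_subset_Ioc_self
  · exact Eventually.of_forall fun θ => hg0 _

lemma polarCoord_symm_eq_circleMap (p : ℝ × ℝ) :
    Complex.polarCoord.symm p = circleMap 0 p.1 p.2 := by
  rw [Complex.polarCoord_symm_apply, circleMap_zero, Complex.exp_mul_I, ofReal_cos, ofReal_sin]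

/-- Tonelli in polar coordinates. -/
lemma lintegral_complex_eq_polar {g : ℂ → ENNReal} (hg : Measurable g) :
    ∫⁻ z, g z =
      ∫⁻ r in Ioi (0 : ℝ), ENNReal.ofReal r * ∫⁻ θ in Ioo (-π) π, g (circleMap 0 r θ) := by
  have hm : Measurable fun p : ℝ × ℝ => g (circleMap 0 p.1 p.2) := by
    refine hg.comp ?_
    simp_rw [circleMap_zero]
    fun_prop
  rw [← Complex.lintegral_comp_polarCoord_symm]
  simp_rw [polarCoord_symm_eq_circleMap, smul_eq_mul]
  rw [show polarCoord.target = Ioi (0 : ℝ) ×ˢ Ioo (-π) π from rfl, Measure.volume_eq_prod,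
    ← Measure.prod_restrict, lintegral_prod _ (by fun_prop)]
  refine lintegral_congr fun r => ?_
  have hr : Measurable fun θ : ℝ => g (circleMap 0 r θ) :=
    hm.comp (by fun_prop : Measurable fun θ : ℝ => (r, θ))
  exact lintegral_const_mul (ENNReal.ofReal r) hr

lemma lintegral_closedBall_abs_log_norm_le {f : ℂ → ℂ} (hf : Differentiable ℂ f) {c : ℂ}
    {r M : ℝ} (hc : 1 ≤ ‖f c‖) (hM1 : 1 ≤ M)
    (hM : ∀ z ∈ Metric.closedBall c r, ‖f z‖ ≤ M) :
    ∫⁻ z in Metric.closedBall c r, ENNReal.ofReal |Real.log ‖f z‖| ≤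
      ENNReal.ofReal (r * (r * (2 * π * (2 * Real.log M)))) := by
  have hm : Measurable fun z => ENNReal.ofReal |Real.log ‖f z‖| := by
    have := hf.continuous.measurable
    exact (measurable_norm.comp (Real.measurable_log.comp this.norm)).ennreal_ofReal
  have e1 : ∫⁻ z in Metric.closedBall c r, ENNReal.ofReal |Real.log ‖f z‖| =
      ∫⁻ z, (Metric.closedBall (0 : ℂ) r).indicator
        (fun z => ENNReal.ofReal |Real.log ‖f (c + z)‖|) z := by
    rw [← lintegral_indicator Metric.isClosed_closedBall.measurableSet,
      ← lintegral_add_left_eq_self _ c]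
    refine lintegral_congr fun z => ?_
    simp only [indicator, mem_closedBall_iff_norm, add_sub_cancel_left, sub_zero]
  have hm' : Measurable ((Metric.closedBall (0 : ℂ) r).indicator
      (fun z => ENNReal.ofReal |Real.log ‖f (c + z)‖|)) :=
    (hm.comp (measurable_const_add c)).indicator Metric.isClosed_closedBall.measurableSet
  have hL := Real.log_nonneg hM1
  rw [e1, lintegral_complex_eq_polar hm']
  calc _ ≤ ∫⁻ ρ in Ioi (0 : ℝ), (Ioc 0 r).indicator
        (fun _ => ENNReal.ofReal (r * (2 * π * (2 * Real.log M)))) ρ := by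
        refine setLIntegral_mono' measurableSet_Ioi fun ρ hρ => ?_
        have hρ0 : (0 : ℝ) < ρ := hρ
        by_cases h : ρ ≤ r
        · rw [indicator_of_mem (show ρ ∈ Ioc 0 r from ⟨hρ0, h⟩),
            ENNReal.ofReal_mul (hρ0.le.trans h)]
          gcongr
          calc _ ≤ ∫⁻ θ in Ioo (-π) π, ENNReal.ofReal |Real.log ‖f (circleMap c ρ θ)‖| := by
                refine lintegral_mono fun θ => ?_
                refine (indicator_le_self _ _ _).trans ?_
                rw [show c + circleMap 0 ρ θ = circleMap c ρ θ by simp [circleMap]]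
            _ = ENNReal.ofReal (2 * π * circleAverage (fun z => |Real.log ‖f z‖|) c ρ) :=
                lintegral_circleMap_eq_circleAverage
                  (g := fun z => |Real.log ‖f z‖|)
                  (circleIntegrable_log_norm_of_differentiable hf c ρ).abs fun z => abs_nonneg _
            _ ≤ _ := by
                refine ENNReal.ofReal_le_ofReal ?_
                gcongr
                exact circleAverage_abs_log_norm_le hf hρ0 hc hM1 fun z hz =>
                  hM z (Metric.sphere_subset_closedBall.trans
                    (Metric.closedBall_subset_closedBall h) hz)
        · rw [not_le] at h
          have : ∀ θ, (Metric.closedBall (0 : ℂ) r).indicator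
              (fun z => ENNReal.ofReal |Real.log ‖f (c + z)‖|) (circleMap 0 ρ θ) = 0 := by
            intro θ
            refine indicator_of_notMem ?_ _
            rw [mem_closedBall_zero_iff, norm_circleMap_zero, abs_of_pos hρ0]
            exact not_le.2 h
          simp [this]
    _ ≤ ∫⁻ ρ, (Ioc 0 r).indicator
        (fun _ => ENNReal.ofReal (r * (2 * π * (2 * Real.log M)))) ρ :=
        setLIntegral_le_lintegral _ _
    _ = ENNReal.ofReal (r * (2 * π * (2 * Real.log M))) * ENNReal.ofReal r := by
        rw [lintegral_indicator measurableSet_Ioc, setLIntegral_const, Real.volume_Ioc, sub_zero]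
    _ ≤ _ := by
        rcases le_total r 0 with h | h
        · rw [ENNReal.ofReal_of_nonpos h, mul_zero]; exact zero_le
        · rw [mul_comm, ← ENNReal.ofReal_mul h]

lemma integrable_rpow_neg_re_mul {ε : ℝ} (hε : 0 < ε) :
    Integrable fun w : ℂ => (Ioi (0 : ℝ)).indicator (fun x : ℝ => Real.exp (-Real.log 2 * x)) w.re *
      (1 + ‖w.im‖ ^ 2) ^ (-(1 + ε) / 2) := by
  have h1 : Integrable ((Ioi (0 : ℝ)).indicator fun x : ℝ => Real.exp (-Real.log 2 * x)) :=
    (integrable_indicator_iff measurableSet_Ioi).2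
      (exp_neg_integrableOn_Ioi 0 (Real.log_pos one_lt_two))
  have h2 : Integrable fun y : ℝ => (1 + ‖y‖ ^ 2) ^ (-(1 + ε) / 2) :=
    integrable_rpow_neg_one_add_norm_sq (by simpa using hε)
  have h3 := h1.mul_prod h2
  exact (Complex.volume_preserving_equiv_real_prod.integrable_comp_emb
    Complex.measurableEquivRealProd.measurableEmbedding).2 h3

lemma measurable_abs_log_norm_riemannZeta_half_add :
    Measurable fun w : ℂ => |Real.log ‖riemannZeta (1 / 2 + w)‖| := by
  have hz : Measurable riemannZeta := by
    have h : riemannZeta = fun s =>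
        if s = 1 then riemannZeta 1 else (s - 1)⁻¹ * riemannZeta₁ s := by
      ext s
      split_ifs with h
      · rw [h]
      · exact riemannZeta_eq_inv_sub_mul h
    rw [h]
    have h1 : Measurable riemannZeta₁ := differentiable_riemannZeta₁.continuous.measurable
    exact Measurable.ite (measurableSet_singleton 1) measurable_const (by fun_prop)
  have hs : Measurable fun w : ℂ => riemannZeta (1 / 2 + w) := hz.comp (measurable_const_add _)
  exact measurable_norm.comp (Real.measurable_log.comp hs.norm)

lemma lintegral_riemannZeta_far_right_lt_top {ε : ℝ} (hε : 0 < ε) :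
    ∫⁻ w in {w : ℂ | 5 / 2 ≤ w.re},
      ENNReal.ofReal (|Real.log ‖riemannZeta (1 / 2 + w)‖| * ‖w‖ ^ (-1 - ε)) < ⊤ := by
  refine lt_of_le_of_lt ?_ (((integrable_rpow_neg_re_mul hε).const_mul 6).lintegral_lt_top)
  refine (setLIntegral_mono' (measurableSet_le measurable_const measurable_re)
    fun w (hw : 5 / 2 ≤ w.re) => ?_).trans (setLIntegral_le_lintegral _ _)
  refine ENNReal.ofReal_le_ofReal ?_
  have hre : (1 / 2 + w).re = 1 / 2 + w.re := by simp
  have h1 := (abs_log_norm_riemannZeta_le (s := 1 / 2 + w) (by rw [hre]; linarith)).1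
  rw [hre] at h1
  have h2 : (2 : ℝ) ^ (-(1 / 2 + w.re)) ≤ Real.exp (-Real.log 2 * w.re) := by
    rw [Real.rpow_def_of_pos two_pos]
    refine Real.exp_le_exp.2 ?_
    have := Real.log_pos one_lt_two
    nlinarith
  have hn : ‖w‖ ^ 2 = w.re ^ 2 + w.im ^ 2 := by
    rw [← normSq_eq_norm_sq, normSq_apply]; ring
  have hw0 : 0 < ‖w‖ := lt_of_lt_of_le (by linarith) (re_le_norm w)
  have h3 : ‖w‖ ^ (-1 - ε) ≤ (1 + ‖w.im‖ ^ 2) ^ (-(1 + ε) / 2) := by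
    have : ‖w‖ ^ (-1 - ε) = (‖w‖ ^ 2) ^ (-(1 + ε) / 2) := by
      rw [← Real.rpow_natCast, ← Real.rpow_mul hw0.le]
      congr 1
      push_cast; ring
    rw [this]
    refine Real.rpow_le_rpow_of_nonpos (by positivity) ?_ (by linarith)
    rw [hn, Real.norm_eq_abs, sq_abs]
    nlinarith
  rw [indicator_of_mem (show w.re ∈ Ioi (0 : ℝ) by simp only [mem_Ioi]; linarith), ← mul_assoc]
  have h6 : |Real.log ‖riemannZeta (1 / 2 + w)‖| ≤ 6 * Real.exp (-Real.log 2 * w.re) := by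
    linarith
  gcongr

lemma summable_one_add_abs_int_rpow {b : ℝ} (hb : 1 < b) :
    Summable fun k : ℤ => (1 + |(k : ℝ)|) ^ (-b) := by
  have h : Summable fun n : ℕ => (1 + (n : ℝ)) ^ (-b) := by
    have := (summable_nat_add_iff 1).2 (Real.summable_nat_rpow.2 (show -b < -1 by linarith))
    refine this.congr fun n => ?_
    push_cast
    rw [add_comm]
  refine Summable.of_nat_of_neg ?_ ?_ <;> simpa using h

lemma lintegral_riemannZeta_disc_le {ε : ℝ} (hε : 0 < ε) : ∃ K : ℝ, ∀ k : ℤ,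
    ∫⁻ w in Metric.closedBall (5 / 2 + k * I : ℂ) (13 / 5) ∩ {w | 10 ≤ ‖w‖},
      ENNReal.ofReal (|Real.log ‖riemannZeta (1 / 2 + w)‖| * ‖w‖ ^ (-1 - ε)) ≤
      ENNReal.ofReal (K * (1 + |(k : ℝ)|) ^ (-(1 + ε / 2))) := by
  set v : ℝ := 13 / 5 * (13 / 5 * (2 * π * 2)) + (13 / 5) ^ 2 * π with hv
  have hv0 : 0 ≤ v := by positivity
  refine ⟨v * (5 + 4 / ε) * 2 ^ (1 + ε), fun k => ?_⟩
  set Q : ℝ := 1 + |(k : ℝ)| with hQ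
  have hQ1 : 1 ≤ Q := by linarith [abs_nonneg (k : ℝ)]
  set M : ℝ := 111 * Q ^ 2 with hMdef
  have hM1 : 1 ≤ M := by nlinarith
  have hL0 := Real.log_nonneg hM1
  set c : ℂ := 5 / 2 + k * I with hc
  have hcn : ‖c‖ ≤ 5 / 2 + |(k : ℝ)| := by
    refine (norm_add_le _ _).trans ?_
    rw [norm_mul, norm_I, mul_one, Complex.norm_intCast]
    norm_num
  set f : ℂ → ℂ := fun w => riemannZeta₁ (1 / 2 + w) with hf
  have hfd : Differentiable ℂ f := differentiable_riemannZeta₁.comp (by fun_prop)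
  have hball : ∀ w ∈ Metric.closedBall c (13 / 5), ‖w‖ ≤ 6 * Q - 1 / 2 ∧ Q - 18 / 5 ≤ ‖w‖ ∧
      2 / 5 ≤ (1 / 2 + w).re := by
    intro w hw
    rw [mem_closedBall_iff_norm] at hw
    refine ⟨?_, ?_, ?_⟩
    · have := norm_add_le (w - c) c
      rw [sub_add_cancel] at this
      linarith
    · have h1 := (abs_im_le_norm (w - c)).trans hw
      have h2 : (w - c).im = w.im - k := by simp [hc]
      rw [h2] at h1
      have h3 := abs_im_le_norm w
      have h4 := abs_sub_abs_le_abs_sub (k : ℝ) w.im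
      rw [abs_sub_comm] at h4
      linarith
    · have h1 := (abs_re_le_norm (w - c)).trans hw
      have h2 : (w - c).re = w.re - 5 / 2 := by simp [hc]
      rw [h2] at h1
      have := (abs_le.1 h1).1
      simp
      linarith
  have hfM : ∀ w ∈ Metric.closedBall c (13 / 5), ‖f w‖ ≤ M := by
    intro w hw
    obtain ⟨h1, -, h3⟩ := hball w hw
    have hs : ‖1 / 2 + w‖ ≤ 6 * Q := by
      refine (norm_add_le _ _).trans ?_
      norm_num
      linarith
    refine (norm_riemannZeta₁_le (by linarith)).trans ?_
    calc ‖1 / 2 + w‖ + ‖1 / 2 + w‖ * (‖1 / 2 + w‖ + 1) / (1 / 2 + w).re ≤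
        6 * Q + 6 * Q * (6 * Q + 1) / (2 / 5) := by gcongr
      _ ≤ M := by rw [hMdef]; nlinarith
  have hfc : 1 ≤ ‖f c‖ := by
    have e : 1 / 2 + c = 3 + k * I := by rw [hc]; ring
    have hre : (3 + k * I : ℂ).re = 3 := by simp
    have hne : (3 + k * I : ℂ) ≠ 1 := fun h => by
      have := congrArg re h
      rw [hre] at this
      norm_num at this
    have h1 := (abs_log_norm_riemannZeta_le (s := 3 + k * I) hre.ge).2
    have h2 : 2 ≤ ‖(3 + k * I : ℂ) - 1‖ := by
      have := re_le_norm ((3 + k * I : ℂ) - 1)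
      rw [sub_re, hre, one_re] at this
      linarith
    change 1 ≤ ‖riemannZeta₁ (1 / 2 + c)‖
    rw [e, riemannZeta₁_eq_mul _ hne, norm_mul]
    nlinarith
  have hmain := lintegral_closedBall_abs_log_norm_le hfd hfc hM1 hfM
  have hpt : ∀ w ∈ Metric.closedBall c (13 / 5) ∩ {w | 10 ≤ ‖w‖},
      ENNReal.ofReal (|Real.log ‖riemannZeta (1 / 2 + w)‖| * ‖w‖ ^ (-1 - ε)) ≤
      ENNReal.ofReal (2 ^ (1 + ε) * Q ^ (-1 - ε)) *
        (ENNReal.ofReal |Real.log ‖f w‖| + ENNReal.ofReal (Real.log M)) := by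
    rintro w ⟨hw, hw10 : 10 ≤ ‖w‖⟩
    obtain ⟨h1, h2, h3⟩ := hball w hw
    rw [← ENNReal.ofReal_add (abs_nonneg _) hL0, ← ENNReal.ofReal_mul (by positivity), mul_comm]
    refine ENNReal.ofReal_le_ofReal ?_
    have hlo : 1 ≤ ‖w - 1 / 2‖ := by
      have := norm_sub_norm_le w (1 / 2)
      have h5 : ‖(1 / 2 : ℂ)‖ = 1 / 2 := by norm_num
      linarith
    have hhi : ‖w - 1 / 2‖ ≤ M := by
      have := norm_sub_le w (1 / 2)
      have h5 : ‖(1 / 2 : ℂ)‖ = 1 / 2 := by norm_num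
      rw [hMdef]
      nlinarith
    have hp : ‖w‖ ^ (-1 - ε) ≤ 2 ^ (1 + ε) * Q ^ (-1 - ε) := by
      calc ‖w‖ ^ (-1 - ε) ≤ (2⁻¹ * Q) ^ (-1 - ε) :=
            Real.rpow_le_rpow_of_nonpos (by positivity) (by linarith) (by linarith)
        _ = _ := by
            rw [Real.mul_rpow (by norm_num) (by positivity), Real.inv_rpow two_pos.le,
              ← Real.rpow_neg two_pos.le]
            congr 2
            ring
    have hlog : |Real.log ‖riemannZeta (1 / 2 + w)‖| ≤ |Real.log ‖f w‖| + Real.log M := by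
      have hne : 1 / 2 + w ≠ 1 := by
        intro h
        have : w = 1 / 2 := by linear_combination h
        rw [this] at hlo
        norm_num at hlo
      rw [riemannZeta_eq_inv_sub_mul hne, norm_mul, norm_inv,
        show (1 / 2 + w - 1 : ℂ) = w - 1 / 2 by ring]
      rcases eq_or_ne (f w) 0 with h0 | h0
      · have : riemannZeta₁ (1 / 2 + w) = 0 := h0
        rw [this, norm_zero, mul_zero, Real.log_zero, abs_zero]
        positivity
      · have h0' : riemannZeta₁ (1 / 2 + w) ≠ 0 := h0
        rw [Real.log_mul (by positivity) (norm_ne_zero_iff.2 h0'), Real.log_inv, add_comm,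
          ← sub_eq_add_neg]
        refine (abs_sub _ _).trans ?_
        rw [abs_of_nonneg (Real.log_nonneg hlo)]
        have := Real.log_le_log (by linarith) hhi
        exact add_le_add_right this _
    gcongr
  have hm1 : Measurable fun w => ENNReal.ofReal |Real.log ‖f w‖| := by
    have := hfd.continuous.measurable
    exact (measurable_norm.comp (Real.measurable_log.comp this.norm)).ennreal_ofReal
  have hlogM : Real.log M ≤ (5 + 4 / ε) * Q ^ (ε / 2) := by
    have hQe : 1 ≤ Q ^ (ε / 2) := Real.one_le_rpow hQ1 (by positivity)
    have h111 : Real.log 111 ≤ 5 := by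
      rw [Real.log_le_iff_le_exp (by norm_num)]
      have := Real.exp_one_gt_d9
      calc (111 : ℝ) ≤ 2.7 ^ 5 := by norm_num
        _ ≤ (Real.exp 1) ^ 5 := by gcongr; linarith
        _ = Real.exp 5 := by rw [← Real.exp_nat_mul]; norm_num
    have hlQ := Real.log_le_rpow_div (x := Q) (by linarith) (show 0 < ε / 2 by positivity)
    rw [hMdef, Real.log_mul (by norm_num) (by positivity), Real.log_pow]
    have e : Q ^ (ε / 2) / (ε / 2) = 2 / ε * Q ^ (ε / 2) := by field_simp
    rw [e] at hlQ
    push_cast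
    have : (5 + 4 / ε) * Q ^ (ε / 2) = 5 * Q ^ (ε / 2) + 2 * (2 / ε * Q ^ (ε / 2)) := by ring
    nlinarith
  calc _ ≤ ∫⁻ w in Metric.closedBall c (13 / 5) ∩ {w | 10 ≤ ‖w‖},
        ENNReal.ofReal (2 ^ (1 + ε) * Q ^ (-1 - ε)) *
          (ENNReal.ofReal |Real.log ‖f w‖| + ENNReal.ofReal (Real.log M)) :=
        setLIntegral_mono' (Metric.isClosed_closedBall.measurableSet.inter
          (measurableSet_le measurable_const measurable_norm)) hpt
    _ ≤ ∫⁻ w in Metric.closedBall c (13 / 5),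
        ENNReal.ofReal (2 ^ (1 + ε) * Q ^ (-1 - ε)) *
          (ENNReal.ofReal |Real.log ‖f w‖| + ENNReal.ofReal (Real.log M)) :=
        lintegral_mono_set inter_subset_left
    _ = ENNReal.ofReal (2 ^ (1 + ε) * Q ^ (-1 - ε)) *
        ((∫⁻ w in Metric.closedBall c (13 / 5), ENNReal.ofReal |Real.log ‖f w‖|) +
          ENNReal.ofReal (Real.log M) * ENNReal.ofReal ((13 / 5) ^ 2 * π)) := by
        rw [lintegral_const_mul _ (hm1.add_const _), lintegral_add_right _ measurable_const,
          setLIntegral_const, Complex.volume_closedBall]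
        congr 3
        rw [ENNReal.ofReal_mul (by positivity), ENNReal.ofReal_pow (by norm_num)]
        congr 1
        rw [← NNReal.coe_real_pi, ENNReal.ofReal_coe_nnreal]
    _ ≤ ENNReal.ofReal (2 ^ (1 + ε) * Q ^ (-1 - ε)) * ENNReal.ofReal (v * Real.log M) := by
        gcongr
        rw [← ENNReal.ofReal_mul hL0]
        refine (add_le_add_left hmain _).trans ?_
        rw [← ENNReal.ofReal_add (by positivity) (by positivity)]
        refine ENNReal.ofReal_le_ofReal (le_of_eq ?_)
        rw [hv]; ring
    _ ≤ ENNReal.ofReal (v * (5 + 4 / ε) * 2 ^ (1 + ε) * Q ^ (-(1 + ε / 2))) := by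
        rw [← ENNReal.ofReal_mul (by positivity)]
        refine ENNReal.ofReal_le_ofReal ?_
        have e : Q ^ (-(1 + ε / 2)) = Q ^ (-1 - ε) * Q ^ (ε / 2) := by
          rw [← Real.rpow_add (by linarith)]; congr 1; ring
        rw [e]
        calc 2 ^ (1 + ε) * Q ^ (-1 - ε) * (v * Real.log M) ≤
            2 ^ (1 + ε) * Q ^ (-1 - ε) * (v * ((5 + 4 / ε) * Q ^ (ε / 2))) := by gcongr
          _ = _ := by ring

/-- `log |ζ(1/2 + w)|` is integrable against `|w| ^ (-1 - ε)` on the right half-plane away from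
the origin. -/
theorem lintegral_abs_log_riemannZeta_lt_top {ε : ℝ} (hε : 0 < ε) :
    ∫⁻ w in {w : ℂ | 0 ≤ w.re ∧ 10 ≤ ‖w‖},
      ENNReal.ofReal (|Real.log ‖riemannZeta (1 / 2 + w)‖| * ‖w‖ ^ (-1 - ε)) < ⊤ := by
  obtain ⟨K, hK⟩ := lintegral_riemannZeta_disc_le hε
  have hsub : {w : ℂ | 0 ≤ w.re ∧ 10 ≤ ‖w‖} ⊆ {w : ℂ | 5 / 2 ≤ w.re} ∪
      ⋃ k : ℤ, Metric.closedBall (5 / 2 + k * I : ℂ) (13 / 5) ∩ {w | 10 ≤ ‖w‖} := by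
    rintro w ⟨h0, h10⟩
    by_cases h : 5 / 2 ≤ w.re
    · exact Or.inl h
    · refine Or.inr (mem_iUnion.2 ⟨round w.im, ?_, h10⟩)
      rw [mem_closedBall_iff_norm]
      refine abs_le_of_sq_le_sq' ?_ (by norm_num) |>.2
      rw [← normSq_eq_norm_sq, normSq_apply]
      have hr := abs_le.1 (abs_sub_round w.im)
      simp
      rw [not_le] at h
      nlinarith
  refine (lintegral_mono_set hsub).trans_lt ((lintegral_union_le _ _ _).trans_lt ?_)
  refine ENNReal.add_lt_top.2 ⟨lintegral_riemannZeta_far_right_lt_top hε, ?_⟩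
  refine (lintegral_iUnion_le _ _).trans_lt ((ENNReal.tsum_le_tsum hK).trans_lt ?_)
  exact ((summable_one_add_abs_int_rpow (by linarith : 1 < 1 + ε / 2)).mul_left
    K).tsum_ofReal_lt_top

/-- The completed zeta function `s (s - 1) Λ(s)`, extended to an entire function. -/
def riemannXi (s : ℂ) : ℂ := s * (s - 1) * completedRiemannZeta₀ s + 1

lemma differentiable_riemannXi : Differentiable ℂ riemannXi := by
  have := differentiable_completedZeta₀
  unfold riemannXi
  fun_prop

lemma riemannXi_one_sub (s : ℂ) : riemannXi (1 - s) = riemannXi s := by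
  rw [riemannXi, riemannXi, completedRiemannZeta₀_one_sub]; ring

lemma riemannXi_zero : riemannXi 0 = 1 := by simp [riemannXi]

lemma riemannXi_eq_of_re_pos {s : ℂ} (hs : 0 < s.re) :
    riemannXi s = s * Gammaℝ s * riemannZeta₁ s := by
  have hs0 : s ≠ 0 := by rintro rfl; simp at hs
  rcases eq_or_ne s 1 with rfl | hs1
  · simp [riemannXi, Gammaℝ_one]
  · have h1 : 1 - s ≠ 0 := sub_ne_zero.2 hs1.symm
    rw [riemannZeta₁_eq_mul s hs1, riemannZeta_def_of_ne_zero hs0, completedRiemannZeta_eq,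
      riemannXi]
    have := Gammaℝ_ne_zero_of_re_pos hs
    field_simp
    ring

lemma riemannXi_ne_zero_of_one_le_re {s : ℂ} (hs : 1 ≤ s.re) : riemannXi s ≠ 0 := by
  have hs0 : 0 < s.re := by linarith
  rw [riemannXi_eq_of_re_pos hs0]
  refine mul_ne_zero (mul_ne_zero (fun h => by simp [h] at hs0) (Gammaℝ_ne_zero_of_re_pos hs0)) ?_
  rcases eq_or_ne s 1 with rfl | hs1
  · simp
  · rw [riemannZeta₁_eq_mul s hs1]
    exact mul_ne_zero (sub_ne_zero.2 hs1) (riemannZeta_ne_zero_of_one_le_re hs)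

lemma riemannXi_eq_zero_iff {s : ℂ} : riemannXi s = 0 ↔ IsNontrivialZero s := by
  constructor
  · intro h
    have h1 : s.re < 1 := by
      by_contra! h1
      exact riemannXi_ne_zero_of_one_le_re h1 h
    have h0 : 0 < s.re := by
      by_contra! h0
      rw [← riemannXi_one_sub] at h
      exact riemannXi_ne_zero_of_one_le_re (by simpa using h0) h
    refine ⟨?_, h0, h1⟩
    have hs1 : s ≠ 1 := by rintro rfl; simp at h1
    rw [riemannXi_eq_of_re_pos h0] at h
    rw [riemannZeta_eq_inv_sub_mul hs1]
    have hs0 : s ≠ 0 := by rintro rfl; simp at h0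
    rw [(mul_eq_zero.1 h).resolve_left (mul_ne_zero hs0 (Gammaℝ_ne_zero_of_re_pos h0)), mul_zero]
  · rintro ⟨h, h0, h1⟩
    have hs1 : s ≠ 1 := by rintro rfl; simp at h1
    rw [riemannXi_eq_of_re_pos h0, riemannZeta₁_eq_mul s hs1, h, mul_zero, mul_zero]

lemma countable_nontrivialZeros : {ρ : ℂ | IsNontrivialZero ρ}.Countable :=
  ((HereditarilyLindelofSpace.isLindelof _).countable_of_isDiscrete
    isDiscrete_riemannZetaZeros).mono fun _ h => h.1

lemma finite_nontrivialZeros_inter_closedBall (c : ℂ) (r : ℝ) :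
    (Metric.closedBall c r ∩ {ρ : ℂ | IsNontrivialZero ρ}).Finite :=
  (isCompact_closedBall c r).inter_riemannZetaZeros_finite.subset fun _ h => ⟨h.1, h.2.1⟩

/-- The order of vanishing is finite for an entire function which is not identically zero. -/
lemma analyticOrderAt_ne_top_of_differentiable {f : ℂ → ℂ} (hf : Differentiable ℂ f) {a : ℂ}
    (ha : f a ≠ 0) (z : ℂ) : analyticOrderAt f z ≠ ⊤ := by
  intro h
  rw [analyticOrderAt_eq_top] at h
  have hA : AnalyticOnNhd ℂ f univ := fun z _ => hf.analyticAt z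
  exact ha (hA.eqOn_zero_of_preconnected_of_eventuallyEq_zero isPreconnected_univ (mem_univ z) h
    (mem_univ a))

lemma zetaMult_eq_analyticOrderNatAt {ρ : ℂ} (hρ : IsNontrivialZero ρ) :
    zetaMult ρ = analyticOrderNatAt riemannXi ρ := by
  obtain ⟨hz, h0, h1⟩ := hρ
  have hρ1 : ρ ≠ 1 := by rintro rfl; simp at h1
  have hρ0 : ρ ≠ 0 := by rintro rfl; simp at h0
  have hζ : AnalyticAt ℂ riemannZeta ρ :=
    (differentiableOn_riemannZeta.analyticOnNhd isOpen_compl_singleton) ρ hρ1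
  set g : ℂ → ℂ := fun s => s * (s - 1) * ((Gammaℝ s)⁻¹)⁻¹ with hg
  have hU : IsOpen {s : ℂ | 0 < s.re} := isOpen_lt continuous_const continuous_re
  have hga : AnalyticAt ℂ g ρ := by
    refine (DifferentiableOn.analyticOnNhd (s := {s : ℂ | 0 < s.re}) (fun s hs => ?_) hU) ρ h0
    refine DifferentiableAt.differentiableWithinAt ?_
    exact (differentiableAt_id.mul (differentiableAt_id.sub_const 1)).mul
      ((differentiable_Gammaℝ_inv s).inv (inv_ne_zero (Gammaℝ_ne_zero_of_re_pos hs)))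
  have hg0 : g ρ ≠ 0 := mul_ne_zero (mul_ne_zero hρ0 (sub_ne_zero.2 hρ1))
    (inv_ne_zero (inv_ne_zero (Gammaℝ_ne_zero_of_re_pos h0)))
  have hord : analyticOrderAt riemannXi ρ = analyticOrderAt riemannZeta ρ := by
    have he : riemannXi =ᶠ[nhds ρ] g * riemannZeta := by
      filter_upwards [hU.mem_nhds h0, isOpen_compl_singleton.mem_nhds hρ1] with s hs hs1
      rw [riemannXi_eq_of_re_pos hs, riemannZeta₁_eq_mul s hs1, Pi.mul_apply, hg]
      simp only [inv_inv]
      ring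
    rw [analyticOrderAt_congr he, analyticOrderAt_mul hga hζ, hga.analyticOrderAt_eq_zero.2 hg0,
      zero_add]
  have htop := analyticOrderAt_ne_top_of_differentiable differentiable_riemannXi
    (a := 0) (by rw [riemannXi_zero]; exact one_ne_zero) ρ
  have hn := Nat.cast_analyticOrderNatAt htop
  rw [hord] at hn
  obtain ⟨hlt, hne⟩ := (analyticOrderAt_eq_nat_iff_iteratedDeriv_eq_zero hζ).1 hn.symm
  refine le_antisymm (Nat.sInf_le hne) (le_csInf ⟨_, hne⟩ fun k hk => ?_)
  by_contra! hlt'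
  exact hk (hlt k hlt')

/-- **Jensen's formula** for an entire function, over an arbitrary finite set containing the zeros
in the disc. -/
lemma exists_circleAverage_log_norm_eq_sum {f : ℂ → ℂ} (hf : Differentiable ℂ f) {a : ℂ}
    (ha : f a ≠ 0) (c : ℂ) : ∃ κ : ℝ, ∀ r : ℝ, 0 < r → ∀ F : Finset ℂ,
      (∀ u ∈ Metric.closedBall c r, f u = 0 → u ∈ F) →
      circleAverage (fun z => Real.log ‖f z‖) c r =
        ∑ u ∈ F, analyticOrderNatAt f u * Real.posLog (r / ‖u - c‖) +
          analyticOrderNatAt f c * Real.log r + κ := by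
  refine ⟨Real.log ‖meromorphicTrailingCoeffAt f c‖, fun r hr F hF => ?_⟩
  have hA : AnalyticOnNhd ℂ f (Metric.closedBall c |r|) := fun z _ => hf.analyticAt z
  have hD : ∀ u ∈ Metric.closedBall c |r|,
      MeromorphicOn.divisor f (Metric.closedBall c |r|) u = (analyticOrderNatAt f u : ℤ) := by
    intro u hu
    rw [MeromorphicOn.divisor_apply hA.meromorphicOn hu, (hf.analyticAt u).meromorphicOrderAt_eq,
      ← Nat.cast_analyticOrderNatAt (analyticOrderAt_ne_top_of_differentiable hf ha u)]
    simp
  rw [MeromorphicOn.circleAverage_log_norm hr.ne' hA.meromorphicOn,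
    hD c (Metric.mem_closedBall_self (abs_nonneg r))]
  push_cast
  congr 2
  have hterm : ∀ u, (MeromorphicOn.divisor f (Metric.closedBall c |r|) u : ℝ) *
      Real.log (r * ‖c - u‖⁻¹) = analyticOrderNatAt f u * Real.posLog (r / ‖u - c‖) := by
    intro u
    rw [← div_eq_mul_inv, norm_sub_rev c u]
    by_cases hu : u ∈ Metric.closedBall c |r|
    · rw [hD u hu, Int.cast_natCast]
      rcases eq_or_ne u c with rfl | huc
      · simp
      rw [abs_of_pos hr, mem_closedBall_iff_norm] at hu
      have h0 : 0 < ‖u - c‖ := norm_pos_iff.2 (sub_ne_zero.2 huc)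
      rw [Real.posLog_eq_log]
      rw [abs_of_pos (by positivity)]
      exact (one_le_div h0).2 hu
    · rw [Function.locallyFinsuppWithin.apply_eq_zero_of_notMem _ hu, Int.cast_zero, zero_mul]
      rw [abs_of_pos hr, mem_closedBall_iff_norm, not_le] at hu
      have h0 : 0 < ‖u - c‖ := hr.trans hu
      rw [(Real.posLog_eq_zero_iff _).2, mul_zero]
      rw [abs_of_pos (by positivity)]
      exact (div_le_one h0).2 hu.le
  simp_rw [hterm]
  refine finsum_eq_sum_of_support_subset _ fun u hu => ?_
  rw [Function.mem_support] at hu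
  refine hF u ?_ ?_
  · by_contra h
    rw [mem_closedBall_iff_norm, not_le] at h
    refine hu ?_
    have h0 : 0 < ‖u - c‖ := hr.trans h
    rw [(Real.posLog_eq_zero_iff _).2, mul_zero]
    rw [abs_of_pos (by positivity)]
    exact (div_le_one h0).2 h.le
  · by_contra h
    refine hu ?_
    rw [analyticOrderNatAt, (hf.analyticAt u).analyticOrderAt_eq_zero.2 h]
    simp

lemma posLog_div_sub_posLog_div {d r r₀ : ℝ} (hd : 0 < d) (hr₀ : 0 < r₀) (hr : r₀ ≤ r) :
    Real.posLog (r / d) - Real.posLog (r₀ / d) = Real.posLog (r / max d r₀) := by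
  have hr' : 0 < r := hr₀.trans_le hr
  have hpos : ∀ x y : ℝ, 0 < x → 0 < y → y ≤ x → Real.posLog (x / y) = Real.log x - Real.log y := by
    intro x y hx hy h
    rw [Real.posLog_eq_log (by rw [abs_of_pos (by positivity)]; exact (one_le_div hy).2 h),
      Real.log_div hx.ne' hy.ne']
  have hzero : ∀ x y : ℝ, 0 < x → 0 < y → x ≤ y → Real.posLog (x / y) = 0 := by
    intro x y hx hy h
    exact (Real.posLog_eq_zero_iff _).2
      (by rw [abs_of_pos (by positivity)]; exact (div_le_one hy).2 h)
  rcases le_total d r₀ with h | h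
  · rw [max_eq_right h, hpos r d hr' hd (h.trans hr), hpos r₀ d hr₀ hd h, hpos r r₀ hr' hr₀ hr]
    ring
  · rw [max_eq_left h, hzero r₀ d hr₀ hd h, sub_zero]

/-- The zeros of `ξ` counted with logarithmic weights, through Jensen's formula. -/
lemma hasSum_zetaMult_mul_posLog {r₀ r : ℝ} (hr₀ : 0 < r₀) (hr : r₀ ≤ r) :
    HasSum (fun ρ : {ρ : ℂ // IsNontrivialZero ρ} =>
      (zetaMult ρ.1 : ℝ) * Real.posLog (r / max ‖ρ.1 - 1 / 2‖ r₀))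
      (circleAverage (fun z => Real.log ‖riemannXi z‖) (1 / 2) r -
        circleAverage (fun z => Real.log ‖riemannXi z‖) (1 / 2) r₀) := by
  have hr' : 0 < r := hr₀.trans_le hr
  obtain ⟨κ, hκ⟩ := exists_circleAverage_log_norm_eq_sum differentiable_riemannXi
    (a := 0) (by rw [riemannXi_zero]; exact one_ne_zero) (1 / 2)
  set F : Finset ℂ := insert (1 / 2)
    (finite_nontrivialZeros_inter_closedBall (1 / 2) r).toFinset with hF
  have hmem : ∀ u ∈ Metric.closedBall (1 / 2 : ℂ) r, riemannXi u = 0 → u ∈ F := by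
    intro u hu h
    rw [hF, Finset.mem_insert]
    exact Or.inr ((Finite.mem_toFinset _).2 ⟨hu, riemannXi_eq_zero_iff.1 h⟩)
  rw [hκ r hr' F hmem, hκ r₀ hr₀ F fun u hu => hmem u (Metric.closedBall_subset_closedBall hr hu)]
  set G : ℂ → ℝ := fun u => analyticOrderNatAt riemannXi u *
    Real.posLog (r / max ‖u - 1 / 2‖ r₀) with hG
  have hsum : ∑ u ∈ F, (analyticOrderNatAt riemannXi u : ℝ) * Real.posLog (r / ‖u - 1 / 2‖) +
      analyticOrderNatAt riemannXi (1 / 2) * Real.log r + κ -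
      (∑ u ∈ F, (analyticOrderNatAt riemannXi u : ℝ) * Real.posLog (r₀ / ‖u - 1 / 2‖) +
      analyticOrderNatAt riemannXi (1 / 2) * Real.log r₀ + κ) = ∑ u ∈ F, G u := by
    have hG' : ∀ u ∈ F, G u = (analyticOrderNatAt riemannXi u : ℝ) * Real.posLog (r / ‖u - 1 / 2‖) -
        (analyticOrderNatAt riemannXi u : ℝ) * Real.posLog (r₀ / ‖u - 1 / 2‖) +
        if u = 1 / 2 then (analyticOrderNatAt riemannXi u : ℝ) * (Real.log r - Real.log r₀)
          else 0 := by
      intro u _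
      split_ifs with h
      · rw [hG, h]
        simp only [sub_self, norm_zero, div_zero, Real.posLog_zero, mul_zero, zero_add,
          max_eq_right hr₀.le]
        rw [Real.posLog_eq_log (by rw [abs_of_pos (by positivity)]; exact (one_le_div hr₀).2 hr),
          Real.log_div hr'.ne' hr₀.ne']
      · have h0 : 0 < ‖u - 1 / 2‖ := norm_pos_iff.2 (sub_ne_zero.2 h)
        rw [hG, add_zero, ← mul_sub, posLog_div_sub_posLog_div h0 hr₀ hr]
    rw [Finset.sum_congr rfl hG', Finset.sum_add_distrib, Finset.sum_sub_distrib,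
      Finset.sum_ite_eq' F (1 / 2), if_pos (Finset.mem_insert_self _ _)]
    ring
  rw [hsum]
  have hord : ∀ u, riemannXi u ≠ 0 → analyticOrderNatAt riemannXi u = 0 := by
    intro u h
    rw [analyticOrderNatAt, (differentiable_riemannXi.analyticAt u).analyticOrderAt_eq_zero.2 h]
    rfl
  have hGs : HasSum G (∑ u ∈ F, G u) := by
    refine hasSum_sum_of_ne_finset_zero fun u hu => ?_
    by_cases h : riemannXi u = 0
    · have hb : u ∉ Metric.closedBall (1 / 2 : ℂ) r := fun hb => hu (hmem u hb h)
      rw [mem_closedBall_iff_norm, not_le] at hb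
      have hmax : r ≤ max ‖u - 1 / 2‖ r₀ := hb.le.trans (le_max_left _ _)
      have h0 : 0 < max ‖u - 1 / 2‖ r₀ := hr'.trans_le hmax
      rw [hG]
      dsimp only
      rw [(Real.posLog_eq_zero_iff _).2
        (by rw [abs_of_pos (by positivity)]; exact (div_le_one h0).2 hmax), mul_zero]
    · simp [hG, hord u h]
  have hsub : Function.support G ⊆ {ρ | IsNontrivialZero ρ} := by
    intro u hu
    by_contra h
    have : riemannXi u ≠ 0 := fun h' => h (riemannXi_eq_zero_iff.1 h')
    exact hu (by simp [hG, hord u this])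
  have := (hasSum_subtype_iff_of_support_subset hsub).2 hGs
  refine this.congr_fun ?_
  intro ρ
  simp only [Function.comp, hG]
  rw [zetaMult_eq_analyticOrderNatAt ρ.2]

lemma abs_log_norm_add_sub_log_norm_le {w d : ℂ} (hd : ‖d‖ ≤ 1 / 2) (hw : 1 ≤ ‖w‖) :
    |Real.log ‖w + d‖ - Real.log ‖w‖| ≤ 1 / ‖w‖ := by
  have hw0 : 0 < ‖w‖ := by linarith
  have h1 : ‖w + d‖ ≤ ‖w‖ + 1 / 2 := (norm_add_le _ _).trans (by linarith)
  have h2 : ‖w‖ - 1 / 2 ≤ ‖w + d‖ := by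
    have := norm_sub_le (w + d) d
    rw [add_sub_cancel_right] at this
    linarith
  have h0 : 0 < ‖w + d‖ := by linarith
  rw [abs_le]
  constructor
  · have h := Real.log_le_sub_one_of_pos (div_pos hw0 h0)
    rw [Real.log_div hw0.ne' h0.ne'] at h
    have : ‖w‖ / ‖w + d‖ - 1 ≤ 1 / ‖w‖ := by
      rw [div_sub_one h0.ne', div_le_div_iff₀ h0 hw0]
      nlinarith
    linarith
  · have h := Real.log_le_sub_one_of_pos (div_pos h0 hw0)
    rw [Real.log_div h0.ne' hw0.ne'] at h
    have : ‖w + d‖ / ‖w‖ - 1 ≤ 1 / ‖w‖ := by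
      rw [div_sub_one hw0.ne']
      gcongr
      linarith
    linarith

/-- The elementary part of `log ‖riemannXi (1 / 2 + w)‖` in the right half-plane. -/
def logXiMain (w : ℂ) : ℝ :=
  2 * Real.log ‖w‖ - (1 / 4 + w.re / 2) * Real.log π + (stirlingMain (w / 2)).re +
    Real.log (2 * π) / 2

lemma abs_log_norm_riemannXi_sub_le {w : ℂ} (hre : 0 ≤ w.re) (hw : 10 ≤ ‖w‖)
    (h0 : riemannXi (1 / 2 + w) ≠ 0) :
    |Real.log ‖riemannXi (1 / 2 + w)‖ - Real.log ‖riemannZeta (1 / 2 + w)‖ - logXiMain w| ≤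
      26 / ‖w‖ := by
  set s : ℂ := 1 / 2 + w with hs
  have hsre : s.re = 1 / 2 + w.re := by rw [hs, add_re]; norm_num
  have hspos : 0 < s.re := by rw [hsre]; linarith
  have hs1 : s ≠ 1 := by
    intro h
    have : w = 1 / 2 := by rw [hs] at h; linear_combination h
    rw [this] at hw
    norm_num at hw
  have hfac : riemannXi s = s * (s - 1) * ((π : ℂ) ^ (-s / 2) * Complex.Gamma (w / 2 + 1 / 4)) *
      riemannZeta s := by
    rw [riemannXi_eq_of_re_pos hspos, riemannZeta₁_eq_mul s hs1, Gammaℝ_def,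
      show w / 2 + 1 / 4 = s / 2 by rw [hs]; ring]
    ring
  have hne := h0
  rw [hfac] at hne
  simp only [mul_ne_zero_iff] at hne
  obtain ⟨⟨⟨ha, hb⟩, hc, hd⟩, he⟩ := hne
  have hπ : Real.log ‖(π : ℂ) ^ (-s / 2)‖ = -(1 / 4 + w.re / 2) * Real.log π := by
    rw [norm_cpow_eq_rpow_re_of_pos pi_pos, Real.log_rpow pi_pos]
    congr 1
    rw [show -s / 2 = ((-(1 / 2) : ℝ) : ℂ) * s by push_cast; ring, re_ofReal_mul, hsre]
    ring
  have hlog : Real.log ‖riemannXi s‖ = Real.log ‖s‖ + Real.log ‖s - 1‖ +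
      (-(1 / 4 + w.re / 2) * Real.log π + Real.log ‖Complex.Gamma (w / 2 + 1 / 4)‖) +
      Real.log ‖riemannZeta s‖ := by
    rw [hfac, norm_mul, norm_mul, norm_mul, norm_mul, Real.log_mul, Real.log_mul, Real.log_mul,
      Real.log_mul, hπ]
    all_goals simp only [← norm_mul, norm_ne_zero_iff, ne_eq, mul_eq_zero, not_or]
    all_goals tauto
  have b1 := abs_log_norm_add_sub_log_norm_le (w := w) (d := 1 / 2) (by norm_num) (by linarith)
  have b2 := abs_log_norm_add_sub_log_norm_le (w := w) (d := -(1 / 2)) (by norm_num) (by linarith)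
  rw [show w + 1 / 2 = s by rw [hs]; ring] at b1
  rw [show w + -(1 / 2) = s - 1 by rw [hs]; ring] at b2
  have hn2 : ‖w / 2‖ = ‖w‖ / 2 := by simp
  have b3 := abs_log_norm_Gamma_sub_le (u := w / 2) (by simp; linarith) (by rw [hn2]; linarith)
  rw [hn2, show 12 / (‖w‖ / 2) = 24 / ‖w‖ by field_simp; norm_num] at b3
  have e26 : 26 / ‖w‖ = 1 / ‖w‖ + 1 / ‖w‖ + 24 / ‖w‖ := by ring
  rw [hlog, logXiMain, e26]
  rw [abs_le] at b1 b2 b3 ⊢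
  constructor <;> linarith [b1.1, b1.2, b2.1, b2.2, b3.1, b3.2]

lemma logXiMain_circleMap {r θ : ℝ} (hr : 0 < r) (hθ : θ ∈ Ioc (-π) π) :
    logXiMain (circleMap 0 r θ) = (7 / 4 * Real.log r + (Real.log 2 / 4 - Real.log π / 4 +
      Real.log (2 * π) / 2)) + r / 2 * (Real.log r - Real.log 2 - 1 - Real.log π) * Real.cos θ -
      r / 2 * (θ * Real.sin θ) := by
  have hre : (circleMap 0 r θ).re = r * Real.cos θ := by simp [circleMap_zero, exp_ofReal_mul_I_re]
  have him : (circleMap 0 r θ).im = r * Real.sin θ := by simp [circleMap_zero, exp_ofReal_mul_I_im]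
  have hlog : Complex.log (circleMap 0 r θ / 2) = ((Real.log r - Real.log 2 : ℝ) : ℂ) + θ * I := by
    rw [circleMap_zero, show (r : ℂ) * Complex.exp (θ * I) / 2 =
      ((r / 2 : ℝ) : ℂ) * Complex.exp (θ * I) by push_cast; ring,
      Complex.log_ofReal_mul (by positivity) (Complex.exp_ne_zero _), Complex.log_exp
      (by simpa using hθ.1) (by simpa using hθ.2), Real.log_div hr.ne' two_ne_zero]
  have hnorm : ‖circleMap 0 r θ‖ = r := by rw [norm_circleMap_zero, abs_of_pos hr]
  have h2 : (circleMap 0 r θ / 2).re = r * Real.cos θ / 2 := by simp [hre]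
  have h3 : (circleMap 0 r θ / 2).im = r * Real.sin θ / 2 := by simp [him]
  have h4 : (circleMap 0 r θ / 2 - 1 / 4).re = r * Real.cos θ / 2 - 1 / 4 := by
    rw [sub_re, h2]; norm_num
  have h5 : (circleMap 0 r θ / 2 - 1 / 4).im = r * Real.sin θ / 2 := by
    rw [sub_im, h3]; norm_num
  rw [logXiMain, stirlingMain, sub_re, mul_re, hlog, hnorm, hre, h2, h4, h5]
  simp only [add_re, ofReal_re, re_ofReal_mul, I_re, add_im, ofReal_im, im_ofReal_mul, I_im]
  ring

/-- The main term of the circle average of `log ‖riemannXi‖` around `1 / 2`. -/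
def xiAverageMain (r : ℝ) : ℝ :=
  1 / π * (r * Real.log r) + (-Real.log 2 - 2 - Real.log π) / π * r + 7 / 4 * Real.log r +
    (Real.log 2 / 4 - Real.log π / 4 + Real.log (2 * π) / 2)

lemma integral_mul_sin_half_circle : ∫ θ in (-(π / 2))..(π / 2), θ * Real.sin θ = 2 := by
  have h : ∀ θ ∈ uIcc (-(π / 2)) (π / 2),
      HasDerivAt (fun θ => Real.sin θ - θ * Real.cos θ) (θ * Real.sin θ) θ := fun θ _ => by
    have := (Real.hasDerivAt_sin θ).sub ((hasDerivAt_id θ).mul (Real.hasDerivAt_cos θ))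
    refine this.congr_deriv ?_
    simp only [id]
    ring
  rw [intervalIntegral.integral_eq_sub_of_hasDerivAt h
    (Continuous.intervalIntegrable (by fun_prop) _ _)]
  simp
  norm_num

lemma integrable_logXiMain_and_integral {r : ℝ} (hr : 0 < r) :
    IntervalIntegrable (fun θ => logXiMain (circleMap 0 r θ)) volume (-(π / 2)) (π / 2) ∧
      ∫ θ in (-(π / 2))..(π / 2), logXiMain (circleMap 0 r θ) = π * xiAverageMain r := by
  have hpi := pi_pos
  have hle : -(π / 2) ≤ π / 2 := by linarith
  have hcongr : EqOn (fun θ => logXiMain (circleMap 0 r θ)) (fun θ =>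
      (7 / 4 * Real.log r + (Real.log 2 / 4 - Real.log π / 4 + Real.log (2 * π) / 2)) +
      r / 2 * (Real.log r - Real.log 2 - 1 - Real.log π) * Real.cos θ -
      r / 2 * (θ * Real.sin θ)) (uIcc (-(π / 2)) (π / 2)) := by
    intro θ hθ
    rw [uIcc_of_le hle] at hθ
    exact logXiMain_circleMap hr ⟨by linarith [hθ.1], by linarith [hθ.2]⟩
  constructor
  · refine IntervalIntegrable.congr (hcongr.symm.mono uIoc_subset_uIcc) ?_
    exact Continuous.intervalIntegrable (by fun_prop) _ _
  · rw [intervalIntegral.integral_congr hcongr, intervalIntegral.integral_sub,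
      intervalIntegral.integral_add, intervalIntegral.integral_const,
      intervalIntegral.integral_const_mul, intervalIntegral.integral_const_mul,
      integral_mul_sin_half_circle, integral_cos, Real.sin_neg, Real.sin_pi_div_two, xiAverageMain,
      smul_eq_mul]
    · field_simp
      ring
    all_goals exact Continuous.intervalIntegrable (by fun_prop) _ _

lemma circleAverage_riemannXi_eq (r : ℝ) :
    IntervalIntegrable (fun θ => Real.log ‖riemannXi (1 / 2 + circleMap 0 r θ)‖) volume
        (-(π / 2)) (π / 2) ∧
      ∫ θ in (-(π / 2))..(π / 2), Real.log ‖riemannXi (1 / 2 + circleMap 0 r θ)‖ =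
        π * circleAverage (fun z => Real.log ‖riemannXi z‖) (1 / 2) r := by
  have hpi := pi_pos
  set F : ℝ → ℝ := fun θ => Real.log ‖riemannXi (1 / 2 + circleMap 0 r θ)‖ with hF
  have hF' : ∀ θ, Real.log ‖riemannXi (circleMap (1 / 2) r θ)‖ = F θ := fun θ => by
    simp [hF, circleMap]
  have hp : Function.Periodic F π := fun θ => by
    simp only [hF]
    rw [← riemannXi_one_sub, show (1 : ℂ) - (1 / 2 + circleMap 0 r (θ + π)) =
      1 / 2 + circleMap 0 r θ by
        simp only [circleMap_zero, ofReal_add, add_mul, Complex.exp_add, Complex.exp_pi_mul_I]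
        ring]
  have hi : IntervalIntegrable F volume 0 (2 * π) := by
    have := circleIntegrable_log_norm_of_differentiable differentiable_riemannXi (1 / 2) r
    simpa only [CircleIntegrable, hF'] using this
  have hiπ : IntervalIntegrable F volume 0 (0 + π) := by
    refine hi.mono_set ?_
    rw [uIcc_of_le (by linarith), uIcc_of_le (by linarith)]
    exact Icc_subset_Icc_right (by linarith)
  have hall : ∀ a b, IntervalIntegrable F volume a b := fun a b =>
    hp.intervalIntegrable pi_pos.ne' hiπ a b
  refine ⟨hall _ _, ?_⟩
  have e1 := hp.intervalIntegral_add_eq (-(π / 2)) 0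
  have e2 := hp.intervalIntegral_add_eq (-(π / 2)) π
  rw [show -(π / 2) + π = π / 2 by ring] at e1 e2
  rw [zero_add] at e1
  have e3 := intervalIntegral.integral_add_adjacent_intervals (hall 0 π) (hall π (π + π))
  rw [← e1, ← e2, show π + π = 2 * π by ring] at e3
  rw [circleAverage_def, smul_eq_mul]
  simp only [hF']
  rw [← e3]
  field_simp
  ring

lemma enorm_circleAverage_riemannXi_sub_le {r : ℝ} (hr : 10 ≤ r) :
    ‖circleAverage (fun z => Real.log ‖riemannXi z‖) (1 / 2) r - xiAverageMain r‖ₑ ≤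
      (∫⁻ θ in Ioc (-(π / 2)) (π / 2),
        ENNReal.ofReal |Real.log ‖riemannZeta (1 / 2 + circleMap 0 r θ)‖|) +
      ENNReal.ofReal (26 * π / r) := by
  have hpi := pi_pos
  have hr0 : 0 < r := by linarith
  have hle : -(π / 2) ≤ π / 2 := by linarith
  obtain ⟨i1, e1⟩ := circleAverage_riemannXi_eq r
  obtain ⟨i2, e2⟩ := integrable_logXiMain_and_integral hr0
  have e := intervalIntegral.integral_sub i1 i2
  rw [e1, e2, ← mul_sub, intervalIntegral.integral_of_le hle] at e
  have hae : ∀ᵐ θ ∂(volume.restrict (Ioc (-(π / 2)) (π / 2))),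
      riemannXi (1 / 2 + circleMap 0 r θ) ≠ 0 := by
    refine ae_restrict_of_ae ?_
    have hc : {θ : ℝ | riemannXi (1 / 2 + circleMap 0 r θ) = 0}.Countable := by
      have := countable_nontrivialZeros.preimage_circleMap (1 / 2) hr0.ne'
      refine this.mono fun θ hθ => ?_
      have h := riemannXi_eq_zero_iff.1 hθ
      simpa [circleMap] using h
    filter_upwards [hc.ae_notMem volume] with θ hθ using hθ
  calc _ ≤ ‖π * (circleAverage (fun z => Real.log ‖riemannXi z‖) (1 / 2) r -
        xiAverageMain r)‖ₑ := by
        rw [enorm_le_iff_norm_le, norm_mul, Real.norm_of_nonneg hpi.le]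
        exact le_mul_of_one_le_left (norm_nonneg _) (by linarith [pi_gt_three])
    _ ≤ ∫⁻ θ in Ioc (-(π / 2)) (π / 2), ‖Real.log ‖riemannXi (1 / 2 + circleMap 0 r θ)‖ -
        logXiMain (circleMap 0 r θ)‖ₑ := by
        rw [← e]; exact enorm_integral_le_lintegral_enorm _
    _ ≤ ∫⁻ θ in Ioc (-(π / 2)) (π / 2),
        (ENNReal.ofReal |Real.log ‖riemannZeta (1 / 2 + circleMap 0 r θ)‖| +
          ENNReal.ofReal (26 / r)) := by
        refine lintegral_mono_ae ?_
        filter_upwards [hae, ae_restrict_mem measurableSet_Ioc] with θ h0 hθ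
        rw [← ENNReal.ofReal_add (abs_nonneg _) (by positivity), ← ofReal_norm]
        refine ENNReal.ofReal_le_ofReal ?_
        have hn : ‖circleMap 0 r θ‖ = r := by rw [norm_circleMap_zero, abs_of_pos hr0]
        have hre : 0 ≤ (circleMap 0 r θ).re := by
          rw [circleMap_zero, re_ofReal_mul, exp_ofReal_mul_I_re]
          exact mul_nonneg hr0.le (Real.cos_nonneg_of_neg_pi_div_two_le_of_le
            (by linarith [hθ.1]) hθ.2)
        have hb := abs_log_norm_riemannXi_sub_le hre (by rw [hn]; exact hr) h0
        rw [hn] at hb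
        rw [Real.norm_eq_abs]
        set x := Real.log ‖riemannZeta (1 / 2 + circleMap 0 r θ)‖
        have := abs_add_le (Real.log ‖riemannXi (1 / 2 + circleMap 0 r θ)‖ - x -
          logXiMain (circleMap 0 r θ)) x
        rw [show Real.log ‖riemannXi (1 / 2 + circleMap 0 r θ)‖ - x -
          logXiMain (circleMap 0 r θ) + x = Real.log ‖riemannXi (1 / 2 + circleMap 0 r θ)‖ -
          logXiMain (circleMap 0 r θ) by ring] at this
        linarith
    _ = _ := by
        rw [lintegral_add_right _ measurable_const, setLIntegral_const, Real.volume_Ioc,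
          ← ENNReal.ofReal_mul (by positivity)]
        congr 2
        ring

lemma monotoneOn_circleAverage_riemannXi :
    MonotoneOn (fun r => circleAverage (fun z => Real.log ‖riemannXi z‖) (1 / 2) r) (Ioi 0) := by
  intro r₀ hr₀ r _ h
  have := (hasSum_zetaMult_mul_posLog hr₀ h).nonneg fun ρ =>
    mul_nonneg (Nat.cast_nonneg _) Real.posLog_nonneg
  simpa using this

lemma lintegral_half_circle_riemannZeta_lt_top {ε : ℝ} (hε : 0 < ε) :
    ∫⁻ r in Ioi (10 : ℝ), (∫⁻ θ in Ioc (-(π / 2)) (π / 2),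
      ENNReal.ofReal |Real.log ‖riemannZeta (1 / 2 + circleMap 0 r θ)‖|) *
        ENNReal.ofReal (r ^ (-ε)) < ⊤ := by
  have hpi := pi_pos
  have hS : MeasurableSet {w : ℂ | 0 ≤ w.re ∧ 10 ≤ ‖w‖} :=
    (measurableSet_le measurable_const measurable_re).inter
      (measurableSet_le measurable_const measurable_norm)
  set f : ℂ → ENNReal := {w : ℂ | 0 ≤ w.re ∧ 10 ≤ ‖w‖}.indicator fun w =>
    ENNReal.ofReal (|Real.log ‖riemannZeta (1 / 2 + w)‖| * ‖w‖ ^ (-1 - ε)) with hf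
  have hfm : Measurable f :=
    (measurable_abs_log_norm_riemannZeta_half_add.mul (by fun_prop)).ennreal_ofReal.indicator hS
  have h := lintegral_abs_log_riemannZeta_lt_top hε
  rw [← lintegral_indicator hS, ← hf, lintegral_complex_eq_polar hfm] at h
  refine lt_of_le_of_lt ?_ h
  refine le_trans ?_ (lintegral_mono_set (Ioi_subset_Ioi (by norm_num : (0 : ℝ) ≤ 10)))
  refine setLIntegral_mono' measurableSet_Ioi fun r hr => ?_
  have hr10 : (10 : ℝ) < r := hr
  have hr0 : 0 < r := by linarith
  have hm : Measurable fun θ : ℝ =>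
      ENNReal.ofReal |Real.log ‖riemannZeta (1 / 2 + circleMap 0 r θ)‖| :=
    (measurable_abs_log_norm_riemannZeta_half_add.comp
      (continuous_circleMap 0 r).measurable).ennreal_ofReal
  have e1 : ENNReal.ofReal (r ^ (-ε)) = ENNReal.ofReal (r ^ (-1 - ε)) * ENNReal.ofReal r := by
    rw [← ENNReal.ofReal_mul (by positivity), ← Real.rpow_add_one hr0.ne']
    ring_nf
  rw [e1, ← mul_assoc, mul_comm, ← lintegral_mul_const _ hm]
  refine mul_le_mul_right ?_ _
  refine le_trans ?_ (lintegral_mono_set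
    (show Ioc (-(π / 2)) (π / 2) ⊆ Ioo (-π) π from fun θ hθ =>
      ⟨by linarith [hθ.1], by linarith [hθ.2]⟩))
  refine setLIntegral_mono' measurableSet_Ioc fun θ hθ => ?_
  have hn : ‖circleMap 0 r θ‖ = r := by rw [norm_circleMap_zero, abs_of_pos hr0]
  have hre : 0 ≤ (circleMap 0 r θ).re := by
    rw [circleMap_zero, re_ofReal_mul, exp_ofReal_mul_I_re]
    exact mul_nonneg hr0.le (Real.cos_nonneg_of_neg_pi_div_two_le_of_le (by linarith [hθ.1]) hθ.2)
  rw [hf, indicator_of_mem (show circleMap 0 r θ ∈ {w : ℂ | 0 ≤ w.re ∧ 10 ≤ ‖w‖} from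
    ⟨hre, by rw [hn]; exact hr10.le⟩), hn, ENNReal.ofReal_mul (abs_nonneg _)]

lemma integrableOn_circleAverage_riemannXi_sub {ε : ℝ} (hε : 0 < ε) :
    IntegrableOn (fun r => (circleAverage (fun z => Real.log ‖riemannXi z‖) (1 / 2) r -
      xiAverageMain r) * r ^ (-ε)) (Ioi 10) := by
  have hmeas : AEStronglyMeasurable (fun r => (circleAverage (fun z => Real.log ‖riemannXi z‖)
      (1 / 2) r - xiAverageMain r) * r ^ (-ε)) (volume.restrict (Ioi 10)) := by
    have h1 : AEMeasurable (fun r => circleAverage (fun z => Real.log ‖riemannXi z‖) (1 / 2) r)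
        (volume.restrict (Ioi 10)) :=
      aemeasurable_restrict_of_monotoneOn measurableSet_Ioi
        (monotoneOn_circleAverage_riemannXi.mono (Ioi_subset_Ioi (by norm_num)))
    have h2 : Measurable xiAverageMain := by unfold xiAverageMain; fun_prop
    exact ((h1.sub h2.aemeasurable).mul (by fun_prop)).aestronglyMeasurable
  refine ⟨hmeas, ?_⟩
  have hIntegrable : IntegrableOn (fun r : ℝ => 26 * π * r ^ (-1 - ε)) (Ioi 10) :=
    (integrableOn_Ioi_rpow_of_lt (by linarith) (by norm_num)).const_mul _
  have hfin := ENNReal.add_lt_top.2 ⟨lintegral_half_circle_riemannZeta_lt_top hε,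
    hIntegrable.lintegral_lt_top⟩
  rw [← lintegral_add_right _ (by fun_prop)] at hfin
  refine lt_of_le_of_lt (setLIntegral_mono' measurableSet_Ioi fun r hr => ?_) hfin
  have hr10 : (10 : ℝ) < r := hr
  have hr0 : 0 < r := by linarith
  rw [enorm_mul, Real.enorm_of_nonneg (by positivity : 0 ≤ r ^ (-ε))]
  calc _ ≤ _ := mul_le_mul_left (enorm_circleAverage_riemannXi_sub_le hr10.le) _
    _ = _ := by
      rw [add_mul, ← ENNReal.ofReal_mul (by positivity)]
      congr 2
      rw [show -1 - ε = -ε - 1 by ring, Real.rpow_sub_one hr0.ne']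
      ring

instance : Countable {ρ : ℂ // IsNontrivialZero ρ} := countable_nontrivialZeros.to_subtype

lemma norm_pos_of_isNontrivialZero {ρ : ℂ} (h : IsNontrivialZero ρ) : 0 < ‖ρ‖ :=
  lt_of_lt_of_le h.2.1 (re_le_norm ρ)

lemma abs_log_norm_sub_log_norm_sub_half_le {ρ : ℂ} (h0 : 0 < ρ.re) (h1 : ρ.re < 1)
    (hd : 10 ≤ ‖ρ - 1 / 2‖) :
    |Real.log ‖ρ‖ - Real.log ‖ρ - 1 / 2‖| ≤ 1 / ‖ρ - 1 / 2‖ ^ 2 := by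
  set d := ‖ρ - 1 / 2‖ with hdd
  have hρ : 0 < ‖ρ‖ := lt_of_lt_of_le h0 (re_le_norm ρ)
  have hd0 : 0 < d := by linarith
  have hsq : ‖ρ‖ ^ 2 = d ^ 2 + ρ.re - 1 / 4 := by
    rw [hdd, ← normSq_eq_norm_sq, ← normSq_eq_norm_sq, normSq_apply, normSq_apply, sub_re, sub_im]
    norm_num
    ring
  have hl1 : Real.log (‖ρ‖ ^ 2) = 2 * Real.log ‖ρ‖ := by rw [Real.log_pow]; norm_num
  have hl2 : Real.log (d ^ 2) = 2 * Real.log d := by rw [Real.log_pow]; norm_num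
  have hρ2 : 0 < ‖ρ‖ ^ 2 := by positivity
  have hd2 : 0 < d ^ 2 := by positivity
  have hd100 : 100 ≤ d ^ 2 := by nlinarith
  rw [abs_le]
  constructor
  · have h := Real.log_le_sub_one_of_pos (div_pos hd2 hρ2)
    rw [Real.log_div hd2.ne' hρ2.ne', hl1, hl2] at h
    have : d ^ 2 / ‖ρ‖ ^ 2 - 1 ≤ 2 * (1 / d ^ 2) := by
      rw [div_sub_one hρ2.ne', mul_one_div, div_le_div_iff₀ hρ2 hd2, hsq]
      nlinarith
    linarith
  · have h := Real.log_le_sub_one_of_pos (div_pos hρ2 hd2)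
    rw [Real.log_div hρ2.ne' hd2.ne', hl1, hl2] at h
    have : ‖ρ‖ ^ 2 / d ^ 2 - 1 ≤ 2 * (1 / d ^ 2) := by
      rw [div_sub_one hd2.ne', mul_one_div]
      gcongr
      linarith
    linarith

lemma exists_abs_log_norm_zero_sub_le : ∃ K : ℝ, 0 ≤ K ∧ ∀ ρ : {ρ : ℂ // IsNontrivialZero ρ},
    |Real.log ‖ρ.1‖ - Real.log (max ‖ρ.1 - 1 / 2‖ 10)| ≤ K / max ‖ρ.1 - 1 / 2‖ 10 ^ 2 := by
  obtain ⟨B, hB⟩ := ((finite_nontrivialZeros_inter_closedBall (1 / 2) 10).image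
    fun ρ => |Real.log ‖ρ‖ - Real.log 10|).bddAbove
  refine ⟨max 1 (100 * B), by positivity, fun ρ => ?_⟩
  rcases le_total ‖ρ.1 - 1 / 2‖ 10 with h | h
  · rw [max_eq_right h]
    have := hB ⟨ρ.1, ⟨mem_closedBall_iff_norm.2 h, ρ.2⟩, rfl⟩
    simp only at this
    have h2 := le_max_right 1 (100 * B)
    rw [le_div_iff₀ (by norm_num)]
    linarith
  · rw [max_eq_left h]
    refine (abs_log_norm_sub_log_norm_sub_half_le ρ.2.2.1 ρ.2.2.2 h).trans ?_
    gcongr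
    exact le_max_left _ _

/-- The Dirichlet series over the moduli of the zeros continues to `-1 < re s`, with a double pole
at `1` and at most polynomial growth. -/
theorem exists_continuation_zeros : ∃ V : ℂ → ℂ, V 1 = ((1 / π : ℝ) : ℂ) ∧
    (∀ s : ℂ, -1 < s.re → DifferentiableAt ℂ V s) ∧
    (∀ δ : ℝ, 0 < δ → ∃ (C : ℝ) (N : ℕ), ∀ s : ℂ, -1 + δ ≤ s.re → s.re ≤ 2 →
      ‖V s‖ ≤ C * (1 + ‖s‖) ^ N) ∧
    ∀ s : ℂ, 1 < s.re → HasSum (fun ρ : {ρ : ℂ // IsNontrivialZero ρ} =>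
      (((zetaMult ρ.1 : ℕ) : ℝ) : ℂ) * ((‖ρ.1‖ : ℝ) : ℂ) ^ (-s)) (V s / (s - 1) ^ 2) := by
  obtain ⟨K, hK, hab⟩ := exists_abs_log_norm_zero_sub_le
  set CA : ℝ → ℝ := fun r => circleAverage (fun z => Real.log ‖riemannXi z‖) (1 / 2) r with hCA
  set J : ℝ → ℝ := fun r => if 10 ≤ r then CA r - CA 10 else 0 with hJdef
  set D : ℝ := Real.log 2 / 4 - Real.log π / 4 + Real.log (2 * π) / 2 - CA 10 with hD
  set E : ℝ → ℝ := fun r => J r - (xiAverageMain r - CA 10) with hEdef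
  refine exists_continuation_of_posLog
    (m := fun ρ : {ρ : ℂ // IsNontrivialZero ρ} => (zetaMult ρ.1 : ℝ))
    (a := fun ρ => ‖ρ.1‖) (b := fun ρ => max ‖ρ.1 - 1 / 2‖ 10) (J := J) (E := E)
    (B := (-Real.log 2 - 2 - Real.log π) / π) (C := 7 / 4) (D := D)
    (fun ρ => Nat.cast_nonneg _) (fun ρ => norm_pos_of_isNontrivialZero ρ.2)
    (fun ρ => le_trans (by norm_num) (le_max_right _ _)) hK hab ?_ ?_ ?_
  · intro r hr
    by_cases h : 10 ≤ r
    · simp only [hJdef, if_pos h]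
      exact hasSum_zetaMult_mul_posLog (by norm_num) h
    · simp only [hJdef, if_neg h]
      convert hasSum_zero using 2 with ρ
      rw [mul_eq_zero]
      right
      rw [Real.posLog_eq_zero_iff]
      have hb : 10 ≤ max ‖ρ.1 - 1 / 2‖ 10 := le_max_right _ _
      rw [abs_of_nonneg (by positivity), div_le_one (by linarith)]
      linarith
  · intro r hr
    simp only [hEdef, hD, xiAverageMain]
    ring
  · intro ε hε
    rw [← Ioc_union_Ioi_eq_Ioi (by norm_num : (1 : ℝ) ≤ 10)]
    refine IntegrableOn.union ?_ ?_
    · have hcont : ContinuousOn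
          (fun r : ℝ => -(xiAverageMain r - CA 10) * r ^ (-ε)) (Icc 1 10) := by
        unfold xiAverageMain
        have h0 : ∀ r ∈ Icc (1 : ℝ) 10, r ≠ 0 := fun r hr => by linarith [hr.1]
        have hlog : ContinuousOn Real.log (Icc (1 : ℝ) 10) :=
          Real.continuousOn_log.mono fun r hr => h0 r hr
        refine ContinuousOn.mul ?_ (continuousOn_id.rpow_const fun r hr => Or.inl (h0 r hr))
        fun_prop
      refine ((hcont.integrableOn_compact isCompact_Icc).mono_set
        (Ioo_subset_Icc_self)).congr_fun ?_ measurableSet_Ioo |>.congr_set_ae Ioo_ae_eq_Ioc.symm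
      intro r hr
      simp only [hEdef, hJdef, if_neg (not_le.2 hr.2)]
      ring
    · refine (integrableOn_circleAverage_riemannXi_sub hε).congr_fun ?_ measurableSet_Ioi
      intro r hr
      have : (10 : ℝ) ≤ r := le_of_lt hr
      simp only [hEdef, hJdef, if_pos this, hCA]
      ring

/-- The continuation of a Dirichlet series with real coefficients commutes with conjugation. -/
lemma conj_continuation {ι : Type*} {m a : ι → ℝ} (ha : ∀ i, 0 < a i) {V : ℂ → ℂ}
    (hV : ∀ s : ℂ, -1 < s.re → DifferentiableAt ℂ V s)
    (hser : ∀ s : ℂ, 1 < s.re → HasSum (fun i => (m i : ℂ) * (a i : ℂ) ^ (-s)) (V s / (s - 1) ^ 2))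
    {s : ℂ} (hs : -1 < s.re) : (starRingEnd ℂ) (V ((starRingEnd ℂ) s)) = V s := by
  have hU : IsOpen {s : ℂ | -1 < s.re} := isOpen_lt continuous_const continuous_re
  have hUc : IsPreconnected {s : ℂ | -1 < s.re} := (convex_halfSpace_re_gt (-1)).isPreconnected
  have h1 : AnalyticOnNhd ℂ (fun s => (starRingEnd ℂ) (V ((starRingEnd ℂ) s)))
      {s : ℂ | -1 < s.re} := by
    refine DifferentiableOn.analyticOnNhd (fun s hs => ?_) hU
    have h := (hV ((starRingEnd ℂ) s) (by simpa using hs)).conj_conj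
    rw [Complex.conj_conj] at h
    exact h.differentiableWithinAt
  have h2 : AnalyticOnNhd ℂ V {s : ℂ | -1 < s.re} :=
    DifferentiableOn.analyticOnNhd (fun s hs => (hV s hs).differentiableWithinAt) hU
  refine h1.eqOn_of_preconnected_of_eventuallyEq h2 hUc (z₀ := 2) (by simp; norm_num) ?_ hs
  filter_upwards [(isOpen_lt continuous_const continuous_re).mem_nhds
    (show (2 : ℂ) ∈ {s : ℂ | 1 < s.re} by simp)] with s hs
  have hs' : 1 < s.re := hs
  have hs1 : s - 1 ≠ 0 := fun h => by
    have := congrArg re h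
    simp at this
    linarith
  have e1 := Complex.hasSum_conj'.2 (hser ((starRingEnd ℂ) s) (by simpa using hs'))
  have e2 : (fun i => (starRingEnd ℂ) ((m i : ℂ) * (a i : ℂ) ^ (-(starRingEnd ℂ) s))) =
      fun i => (m i : ℂ) * (a i : ℂ) ^ (-s) := by
    ext i
    have harg : ((a i : ℝ) : ℂ).arg ≠ π := by
      rw [arg_ofReal_of_nonneg (ha i).le]; exact pi_pos.ne
    have := Complex.conj_cpow (a i : ℂ) (-s) harg
    rw [conj_ofReal, map_neg] at this
    rw [map_mul, conj_ofReal, ← this]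
  rw [e2] at e1
  have e3 := e1.unique (hser s hs')
  rw [map_div₀, map_pow, map_sub, Complex.conj_conj, map_one] at e3
  exact (div_left_inj' (pow_ne_zero 2 hs1)).1 e3

/-- Two meromorphic functions on `-1 < re s` with pole only at `1` which agree for `1 < re s` have
the same value at `0`. -/
lemma eq_at_zero_of_eqOn_one_lt_re {R V : ℂ → ℂ}
    (hR : ∀ s : ℂ, -1 < s.re → s ≠ 1 → DifferentiableAt ℂ R s)
    (hV : ∀ s : ℂ, -1 < s.re → DifferentiableAt ℂ V s)
    (h : ∀ s : ℂ, 1 < s.re → R s = V s / (s - 1) ^ 2) : R 0 = V 0 := by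
  set g : ℂ → ℂ := fun s => V s / (s - 1) ^ 2 with hg
  have hgd : ∀ s : ℂ, -1 < s.re → s ≠ 1 → DifferentiableAt ℂ g s := fun s hs hs1 =>
    (hV s hs).div ((differentiableAt_id.sub_const 1).pow 2) (pow_ne_zero 2 (sub_ne_zero.2 hs1))
  set U : Set ℂ := {s : ℂ | -1 < s.re} ∩ {s : ℂ | 0 < s.im} with hUdef
  have hU : IsOpen U := (isOpen_lt continuous_const continuous_re).inter
    (isOpen_lt continuous_const continuous_im)
  have hUc : IsPreconnected U :=
    ((convex_halfSpace_re_gt (-1)).inter (convex_halfSpace_im_gt 0)).isPreconnected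
  have hne : ∀ s ∈ U, s ≠ 1 := by
    rintro s ⟨-, hs⟩ rfl
    simp at hs
  have hRU : AnalyticOnNhd ℂ R U :=
    DifferentiableOn.analyticOnNhd
      (fun s hs => (hR s hs.1 (hne s hs)).differentiableWithinAt) hU
  have hgU : AnalyticOnNhd ℂ g U :=
    DifferentiableOn.analyticOnNhd
      (fun s hs => (hgd s hs.1 (hne s hs)).differentiableWithinAt) hU
  have heq : EqOn R g U := by
    refine hRU.eqOn_of_preconnected_of_eventuallyEq hgU hUc (z₀ := 2 + I) ?_ ?_
    · constructor <;> simp; norm_num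
    · filter_upwards [(isOpen_lt continuous_const continuous_re).mem_nhds
        (show (2 + I : ℂ) ∈ {s : ℂ | 1 < s.re} by simp)] with s hs using h s hs
  have hfr : ∃ᶠ s in nhds (0 : ℂ), R s = g s := by
    have h0 : (0 : ℂ) ∈ closure {s : ℂ | 0 < s.im} := by
      rw [Complex.closure_setOfPred_lt_im]; simp
    refine ((mem_closure_iff_frequently.1 h0).and_eventually
      ((isOpen_lt continuous_const continuous_re).mem_nhds
        (show (0 : ℂ) ∈ {s : ℂ | -1 < s.re} by simp))).mono fun s hs => heq ⟨hs.2, hs.1⟩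
  have hR0 := (hR 0 (by simp) zero_ne_one).continuousAt
  have hg0 := (hgd 0 (by simp) zero_ne_one).continuousAt
  have := tendsto_nhds_unique_of_frequently_eq hR0 hg0 hfr
  simpa [hg] using this

theorem statement9
    (R : ℂ → ℂ)
    (hRser : ∀ s : ℂ, 1 < s.re →
      R s = ∑' ρ : {ρ : ℂ // IsNontrivialZero ρ},
        (zetaMult ρ.1 : ℂ) * (‖ρ.1‖ : ℂ) ^ (-s))
    (hRan : ∀ s : ℂ, -1 < s.re → s ≠ 1 → DifferentiableAt ℂ R s)
    : ∀ n : ℕ, 1 ≤ n → ∃ α : ℕ → ℝ, α (2 * n - 1) ≠ 0 ∧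
      ∀ ε : ℝ, 0 < ε → ∃ K : ℝ, ∀ X : ℝ, 2 ≤ X →
        ‖((∑' ρs : Fin n → {ρ : ℂ // IsNontrivialZero ρ},
              (∏ i, (zetaMult (ρs i).1 : ℝ)) *
                Real.exp (-(∏ i, ‖(ρs i).1‖) / X) : ℝ) : ℂ)
            - (X : ℂ) * ∑ j ∈ Finset.range (2 * n), (α j : ℂ) * (Real.log X : ℂ) ^ j
            - (R 0) ^ n‖ ≤ K * X ^ (ε - 1) := by
  intro n hn
  obtain ⟨V, hV1, hV, hgrow, hser⟩ := exists_continuation_zeros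
  have ha : ∀ ρ : {ρ : ℂ // IsNontrivialZero ρ}, 0 < ‖ρ.1‖ := fun ρ =>
    norm_pos_of_isNontrivialZero ρ.2
  have hR0 : R 0 = V 0 := eq_at_zero_of_eqOn_one_lt_re hRan hV fun s hs => by
    rw [hRser s hs, ← (hser s hs).tsum_eq]
    simp
  have hreal : ((V 0).re : ℂ) = V 0 := by
    have := conj_continuation ha hV hser (s := 0) (by simp)
    rw [map_zero] at this
    exact Complex.conj_eq_iff_re.1 this
  obtain ⟨c, hc, hasym⟩ := exists_exp_sum_asymptotic ha hV hgrow hser hn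
  refine ⟨fun j => (c j).re, ?_, fun ε hε => ?_⟩
  · have : c (2 * n - 1) = (((1 / π) ^ n / (2 * n - 1).factorial : ℝ) : ℂ) := by
      rw [hc, hV1]; push_cast; rfl
    simp only [this, ofReal_re]
    have := pi_pos
    positivity
  · obtain ⟨K, hK⟩ := hasym ε hε
    refine ⟨K, fun X hX => le_trans ?_ (hK X hX)⟩
    rw [hR0]
    set S : ℝ := ∑' ρs : Fin n → {ρ : ℂ // IsNontrivialZero ρ},
      (∏ i, (zetaMult (ρs i).1 : ℝ)) * Real.exp (-(∏ i, ‖(ρs i).1‖) / X)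
    have hre : (S : ℂ) - X * ∑ j ∈ Finset.range (2 * n), ((c j).re : ℂ) * (Real.log X : ℂ) ^ j -
        V 0 ^ n = (((S : ℂ) - X * ∑ j ∈ Finset.range (2 * n), c j * (Real.log X : ℂ) ^ j -
          V 0 ^ n).re : ℂ) := by
      rw [← hreal]
      simp only [sub_re, re_ofReal_mul, re_sum, ← ofReal_pow, ofReal_re, re_mul_ofReal]
      push_cast
      rfl
    rw [hre, norm_real]
    exact abs_re_le_norm _
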